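/- arXiv:1312.1524 — 6 statements merged into one kernel-verified Lean document; each statement's English description precedes it below -/
import Mathlib

section
/- Let m ≥ 0 and r ≥ 1 be integers, and let p be a real polynomial in the m+1 variables X_0,…,X_m with total degree at most r such that eval p(λ) = 0 for every λ ∈ S_m having λ_i = 0 for some i ∈ {0,…,m} (i.e., the trace of p on S_m vanishes on the boundary of S_m). Then there exists a real polynomial q in X_0,…,X_m with total degree at most r such that: (a) K_m(eval p)(λ) = eval q(λ) for every λ ∈ ℝ^{m+1} with λ_j ≥ 0 for all j and Σ_{j=0}^m λ_j < 1; (b) eval q(λ) = eval p(λ) for every λ ∈ S_m; and (c) eval q(λ) = 0 for every λ ∈ S_m^c with λ_i = 0 for some i ∈ {0,…,m}. -/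
open Finset

/-- `b(λ) = 1 - Σ_{j=0}^m λ_j`. -/
noncomputable def bfun (m : ℕ) (lam : Fin (m + 1) → ℝ) : ℝ := 1 - ∑ j, lam j

/-- The projection `P_I` setting the coordinates in `I` to zero. -/
def Pproj (m : ℕ) (I : Finset (Fin (m + 1))) (lam : Fin (m + 1) → ℝ) : Fin (m + 1) → ℝ :=
  fun i => if i ∈ I then 0 else lam i

/-- The trace-preserving cut-off operator
`K_m w(λ) = w(λ) + Σ_{∅ ≠ I ⊆ {0,…,m}} (−1)^{|I|} (b(λ)/b(P_I λ)) w(P_I λ)`. -/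
noncomputable def Kop (m : ℕ) (w : (Fin (m + 1) → ℝ) → ℝ) (lam : Fin (m + 1) → ℝ) : ℝ :=
  w lam + ∑ I ∈ (Finset.univ : Finset (Finset (Fin (m + 1)))).erase ∅,
    (-1 : ℝ) ^ I.card * (bfun m lam / bfun m (Pproj m I lam)) * w (Pproj m I lam)

open MvPolynomial in
/-- The polynomial `λ ↦ b(P_I λ)`. -/
noncomputable def Bpoly (m : ℕ) (I : Finset (Fin (m + 1))) : MvPolynomial (Fin (m + 1)) ℝ :=
  1 - ∑ j, (if j ∈ I then 0 else X j)

lemma eval_Bpoly (m : ℕ) (I : Finset (Fin (m + 1))) (lam : Fin (m + 1) → ℝ) :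
    MvPolynomial.eval lam (Bpoly m I) = bfun m (Pproj m I lam) := by
  simp only [Bpoly, bfun, Pproj, map_sub, map_one, map_sum]
  congr 1
  refine Finset.sum_congr rfl fun j _ => ?_
  split_ifs <;> simp

lemma Bpoly_deg (m : ℕ) (I : Finset (Fin (m + 1))) : (Bpoly m I).totalDegree ≤ 1 := by
  unfold Bpoly
  refine (MvPolynomial.totalDegree_sub _ _).trans (max_le (by simp) ?_)
  refine MvPolynomial.totalDegree_finsetSum_le fun j _ => ?_
  split_ifs <;> simp

/-- Substituting the coordinates in `I` by zero. -/
noncomputable def subI (m : ℕ) (I : Finset (Fin (m + 1))) (p : MvPolynomial (Fin (m + 1)) ℝ) :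
    MvPolynomial (Fin (m + 1)) ℝ :=
  MvPolynomial.bind₁ (fun i => if i ∈ I then 0 else MvPolynomial.X i) p

lemma eval_subI (m : ℕ) (I : Finset (Fin (m + 1))) (p : MvPolynomial (Fin (m + 1)) ℝ)
    (lam : Fin (m + 1) → ℝ) :
    MvPolynomial.eval lam (subI m I p) = MvPolynomial.eval (Pproj m I lam) p := by
  unfold subI
  rw [← MvPolynomial.coe_aeval_eq_eval, ← MvPolynomial.coe_aeval_eq_eval]
  simp only [RingHom.coe_coe, MvPolynomial.aeval_bind₁]
  congr 2
  funext j
  simp only [Pproj]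
  split_ifs <;> simp

lemma subI_deg (m : ℕ) (I : Finset (Fin (m + 1))) (p : MvPolynomial (Fin (m + 1)) ℝ) :
    (subI m I p).totalDegree ≤ p.totalDegree := by
  unfold subI
  conv_lhs => rw [p.as_sum, map_sum]
  refine MvPolynomial.totalDegree_finsetSum_le fun d hd => ?_
  rw [MvPolynomial.bind₁_monomial]
  refine (MvPolynomial.totalDegree_mul _ _).trans ?_
  rw [MvPolynomial.totalDegree_C, zero_add]
  refine (MvPolynomial.totalDegree_finsetProd _ _).trans ?_
  refine le_trans ?_ (MvPolynomial.le_totalDegree hd)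
  refine Finset.sum_le_sum fun i _ => ?_
  refine (MvPolynomial.totalDegree_pow _ _).trans ?_
  split_ifs <;> simp

lemma dvd_subst {n : ℕ} (B : MvPolynomial (Fin n) ℝ) (s : Fin n → MvPolynomial (Fin n) ℝ)
    (hs : ∀ i, B ∣ s i - MvPolynomial.X i) (f : MvPolynomial (Fin n) ℝ) :
    B ∣ MvPolynomial.bind₁ s f - f := by
  induction f using MvPolynomial.induction_on with
  | C a => simp
  | add p q hp hq =>
    have := dvd_add hp hq
    rw [map_add]
    convert this using 1
    ring
  | mul_X p i hp =>
    rw [map_mul, MvPolynomial.bind₁_X_right]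
    have := dvd_add (hp.mul_right (s i)) ((hs i).mul_left p)
    convert this using 1
    ring

lemma exists_quot (m r : ℕ) (hr : 1 ≤ r)
    (p : MvPolynomial (Fin (m + 1)) ℝ) (hdeg : p.totalDegree ≤ r)
    (hp : ∀ lam : Fin (m + 1) → ℝ, (∀ j, 0 ≤ lam j) → ∑ j, lam j = 1 →
      (∃ i, lam i = 0) → MvPolynomial.eval lam p = 0)
    (I : Finset (Fin (m + 1))) (hI : I ≠ ∅) :
    ∃ g : MvPolynomial (Fin (m + 1)) ℝ, g.totalDegree ≤ r - 1 ∧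
      ∀ lam, MvPolynomial.eval (Pproj m I lam) p =
        bfun m (Pproj m I lam) * MvPolynomial.eval lam g := by
  by_cases hall : ∃ j0, j0 ∉ I
  · obtain ⟨j0, hj0⟩ := hall
    obtain ⟨i0, hi0⟩ := Finset.nonempty_iff_ne_empty.mpr hI
    set B := Bpoly m I with hB
    set s : Fin (m + 1) → MvPolynomial (Fin (m + 1)) ℝ :=
      fun j => MvPolynomial.X j + if j = j0 then B else 0 with hs
    have hz : MvPolynomial.bind₁ s (subI m I p) = 0 := by
      refine MvPolynomial.funext_set (fun _ => Set.Icc (0 : ℝ) (1 / (m + 1)))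
        (fun _ => Set.Icc_infinite (by positivity)) fun x hx => ?_
      have hx' : ∀ j, 0 ≤ x j ∧ x j ≤ 1 / (m + 1) := fun j => hx j (Set.mem_univ j)
      set b := bfun m (Pproj m I x) with hb
      have hb0 : 0 ≤ b := by
        rw [hb, bfun, sub_nonneg]
        calc ∑ j, Pproj m I x j ≤ ∑ j : Fin (m + 1), (1 / (m + 1) : ℝ) := by
              refine Finset.sum_le_sum fun j _ => ?_
              unfold Pproj
              split_ifs
              · positivity
              · exact (hx' j).2
          _ = 1 := by
              simp
              field_simp
      have he : MvPolynomial.eval x (MvPolynomial.bind₁ s (subI m I p)) =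
          MvPolynomial.eval (fun j => x j + if j = j0 then b else 0) (subI m I p) := by
        rw [← MvPolynomial.coe_aeval_eq_eval, ← MvPolynomial.coe_aeval_eq_eval]
        simp only [RingHom.coe_coe, MvPolynomial.aeval_bind₁]
        congr 2
        funext j
        simp only [hs, MvPolynomial.coe_aeval_eq_eval, MvPolynomial.aeval_eq_eval, map_add,
          MvPolynomial.eval_X]
        split_ifs
        · rw [hB, hb, ← eval_Bpoly]
        · simp
      rw [he, eval_subI, map_zero]
      apply hp
      · intro j
        unfold Pproj
        have := (hx' j).1
        dsimp only; split_ifs <;> linarith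
      · have h1 : ∀ j, Pproj m I (fun j => x j + if j = j0 then b else 0) j =
            Pproj m I x j + if j = j0 then b else 0 := by
          intro j
          unfold Pproj
          by_cases hj : j ∈ I
          · have : j ≠ j0 := fun h => hj0 (h ▸ hj)
            simp [hj, this]
          · simp [hj]
        rw [Finset.sum_congr rfl fun j _ => h1 j, Finset.sum_add_distrib]
        simp [hb, bfun]
      · exact ⟨i0, by simp [Pproj, hi0]⟩
    have hd : B ∣ subI m I p := by
      have := dvd_subst B s (fun i => by
        simp only [hs, add_sub_cancel_left]
        split_ifs <;> simp) (subI m I p)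
      rw [hz, zero_sub, dvd_neg] at this
      exact this
    obtain ⟨g, hg⟩ := hd
    have hev : ∀ lam, MvPolynomial.eval (Pproj m I lam) p =
        bfun m (Pproj m I lam) * MvPolynomial.eval lam g := by
      intro lam
      rw [← eval_subI, hg, map_mul, hB, eval_Bpoly]
    by_cases hg0 : g = 0
    · exact ⟨g, by simp [hg0], hev⟩
    · refine ⟨g, ?_, hev⟩
      have e0 : MvPolynomial.eval 0 B = 1 := by
        rw [hB, eval_Bpoly]
        simp [bfun, Pproj]
      have e1 : MvPolynomial.eval (Pi.single j0 1) B = 0 := by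
        rw [hB, eval_Bpoly]
        have : Pproj m I (Pi.single j0 1) = Pi.single j0 1 := by
          funext j
          unfold Pproj
          by_cases hj : j ∈ I
          · have : j ≠ j0 := fun h => hj0 (h ▸ hj)
            simp [hj, this]
          · simp [hj]
        rw [this]
        simp [bfun]
      have hB0 : B ≠ 0 := by
        intro h
        rw [h] at e0
        simp at e0
      have hB1 : B.totalDegree ≠ 0 := by
        intro h
        rw [MvPolynomial.totalDegree_eq_zero_iff_eq_C] at h
        rw [h, MvPolynomial.eval_C] at e0 e1
        linarith
      have h1 := MvPolynomial.totalDegree_mul_of_isDomain hB0 hg0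
      rw [← hg] at h1
      have h2 := subI_deg m I p
      omega
  · push Not at hall
    refine ⟨MvPolynomial.C (MvPolynomial.eval 0 p), by simp, fun lam => ?_⟩
    have : Pproj m I lam = 0 := by
      funext j
      simp [Pproj, hall j]
    simp [this, bfun]

lemma Kop_vanish (m : ℕ) (w : (Fin (m + 1) → ℝ) → ℝ) (lam : Fin (m + 1) → ℝ)
    (hb : bfun m lam ≠ 0) (i : Fin (m + 1)) (hi : lam i = 0) : Kop m w lam = 0 := by
  have h0 : Kop m w lam = ∑ I : Finset (Fin (m + 1)),
      (-1 : ℝ) ^ I.card * (bfun m lam / bfun m (Pproj m I lam)) * w (Pproj m I lam) := by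
    rw [Kop, ← Finset.add_sum_erase _ _ (Finset.mem_univ ∅)]
    have : Pproj m ∅ lam = lam := by
      funext j
      simp [Pproj]
    simp [this, div_self hb]
  rw [h0, ← Finset.powerset_univ, ← Finset.insert_erase (Finset.mem_univ i),
    Finset.sum_powerset_insert (Finset.notMem_erase i _), ← Finset.sum_add_distrib]
  refine Finset.sum_eq_zero fun I hI => ?_
  have hiI : i ∉ I := fun h => Finset.notMem_erase i _ (Finset.mem_powerset.mp hI h)
  have : Pproj m (insert i I) lam = Pproj m I lam := by
    funext j
    unfold Pproj
    by_cases hj : j = i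
    · subst hj
      simp [hi]
    · simp [hj]
  rw [this, Finset.card_insert_of_notMem hiI, pow_succ]
  ring

/-- Polynomial preservation of the trace-preserving cut-off operator `K_m`
(Lemma `pol-preserve-E`): if `p` has total degree at most `r` and its trace on `S_m`
vanishes on `∂S_m`, then `K_m (eval p)` agrees on the open part of `S_m^c` with a
polynomial `q` of total degree at most `r`, `q` agrees with `p` on `S_m`, and `q`
vanishes on `∂S_m^c \ S_m`. -/
theorem Kop_preserves_polynomials (m r : ℕ) (hr : 1 ≤ r)
    (p : MvPolynomial (Fin (m + 1)) ℝ) (hdeg : p.totalDegree ≤ r)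
    (hp : ∀ lam : Fin (m + 1) → ℝ, (∀ j, 0 ≤ lam j) → ∑ j, lam j = 1 →
      (∃ i, lam i = 0) → MvPolynomial.eval lam p = 0) :
    ∃ q : MvPolynomial (Fin (m + 1)) ℝ, q.totalDegree ≤ r ∧
      (∀ lam : Fin (m + 1) → ℝ, (∀ j, 0 ≤ lam j) → ∑ j, lam j < 1 →
        Kop m (fun μ => MvPolynomial.eval μ p) lam = MvPolynomial.eval lam q) ∧
      (∀ lam : Fin (m + 1) → ℝ, (∀ j, 0 ≤ lam j) → ∑ j, lam j = 1 →
        MvPolynomial.eval lam q = MvPolynomial.eval lam p) ∧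
      (∀ lam : Fin (m + 1) → ℝ, (∀ j, 0 ≤ lam j) → ∑ j, lam j ≤ 1 →
        (∃ i, lam i = 0) → MvPolynomial.eval lam q = 0) := by
  classical
  choose! g hgd hg using exists_quot m r hr p hdeg hp
  set q : MvPolynomial (Fin (m + 1)) ℝ :=
    p + ∑ I ∈ (Finset.univ : Finset (Finset (Fin (m + 1)))).erase ∅,
      MvPolynomial.C ((-1 : ℝ) ^ I.card) * (Bpoly m ∅ * g I) with hq
  have hP : ∀ lam, Pproj m ∅ lam = lam := fun lam => by
    funext j
    simp [Pproj]
  have hqe : ∀ lam, MvPolynomial.eval lam q = MvPolynomial.eval lam p +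
      ∑ I ∈ (Finset.univ : Finset (Finset (Fin (m + 1)))).erase ∅,
        (-1 : ℝ) ^ I.card * (bfun m lam * MvPolynomial.eval lam (g I)) := by
    intro lam
    simp only [hq, map_add, map_sum, map_mul, MvPolynomial.eval_C, eval_Bpoly, hP]
  have ha : ∀ lam : Fin (m + 1) → ℝ, (∀ j, 0 ≤ lam j) → ∑ j, lam j < 1 →
      Kop m (fun μ => MvPolynomial.eval μ p) lam = MvPolynomial.eval lam q := by
    intro lam h0 h1
    rw [hqe, Kop]
    congr 1
    refine Finset.sum_congr rfl fun I hI => ?_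
    have hne : bfun m (Pproj m I lam) ≠ 0 := by
      have : ∑ j, Pproj m I lam j ≤ ∑ j, lam j := by
        refine Finset.sum_le_sum fun j _ => ?_
        unfold Pproj
        split_ifs
        · exact h0 j
        · exact le_rfl
      unfold bfun
      linarith
    rw [hg I (Finset.ne_of_mem_erase hI) lam]
    field_simp
  have hbb : ∀ lam : Fin (m + 1) → ℝ, (∀ j, 0 ≤ lam j) → ∑ j, lam j = 1 →
      MvPolynomial.eval lam q = MvPolynomial.eval lam p := by
    intro lam h0 h1
    rw [hqe]
    simp [bfun, h1]
  refine ⟨q, ?_, ha, hbb, ?_⟩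
  · refine (MvPolynomial.totalDegree_add _ _).trans (max_le hdeg ?_)
    refine MvPolynomial.totalDegree_finsetSum_le fun I hI => ?_
    refine (MvPolynomial.totalDegree_mul _ _).trans ?_
    rw [MvPolynomial.totalDegree_C, zero_add]
    refine (MvPolynomial.totalDegree_mul _ _).trans ?_
    have h1 := Bpoly_deg m ∅
    have h2 := hgd I (Finset.ne_of_mem_erase hI)
    omega
  · rintro lam h0 h1 ⟨i, hi⟩
    rcases h1.lt_or_eq with h | h
    · rw [← ha lam h0 h]
      refine Kop_vanish m _ lam ?_ i hi
      unfold bfun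
      linarith
    · rw [hbb lam h0 h]
      exact hp lam h0 h ⟨i, hi⟩
end

section
/- Let 0 ≤ m < n be integers. Let x_0,…,x_n ∈ ℝ^n be affinely independent with T = conv{x_0,…,x_n}, and let x'_{m+1},…,x'_n ∈ ℝ^n be points such that x_0,…,x_m, x'_{m+1},…,x'_n are affinely independent, with T' = conv{x_0,…,x_m, x'_{m+1},…,x'_n}. Let λ'(x) = (λ'_0(x),…,λ'_m(x)) denote the first m+1 barycentric coordinates of x with respect to the vertices of T'. Then there exists a constant c, depending only on T, T' and m, such that for every continuously differentiable function v : ℝ^n → ℝ, the function F(x) = ⨍_T v(G_m(λ'(x), y)) dy is differentiable and satisfies ∫_{T'} ‖DF(x)‖² dx ≤ c ∫_T ‖Dv(y)‖² dy, where DF and Dv denote the total (Fréchet) derivatives and ‖·‖ the operator norm. (This is the H¹ boundedness of the pulled-back averaging operator.) -/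
open Finset MeasureTheory

/-- `G_m(λ, y) = Σ_{j=0}^m λ_j x_j + b(λ) y`. -/
noncomputable def Gmap (n m : ℕ) (x : Fin (m + 1) → Fin n → ℝ)
    (lam : Fin (m + 1) → ℝ) (y : Fin n → ℝ) : Fin n → ℝ :=
  (∑ j, lam j • x j) + bfun m lam • y

/-- The averaged pull-back `⨍_T v(G_m(λ, y)) dy = vol(T)⁻¹ ∫_T v(G_m(λ, y)) dy`. -/
noncomputable def Avg (n m : ℕ) (x : Fin (m + 1) → Fin n → ℝ) (T : Set (Fin n → ℝ))
    (v : (Fin n → ℝ) → ℝ) (lam : Fin (m + 1) → ℝ) : ℝ :=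
  (volume T).toReal⁻¹ * ∫ y in T, v (Gmap n m x lam y)

lemma lint_scale (n : ℕ) (a : Fin n → ℝ) (r : ℝ) (hr : 0 < r)
    (f : (Fin n → ℝ) → ENNReal) (hf : Measurable f) :
    ENNReal.ofReal (r ^ n) * ∫⁻ y, f (a + r • y) = ∫⁻ y, f y := by
  have h1 : ∫⁻ y, f (a + r • y) = ∫⁻ y, f (a + y) ∂(Measure.map (fun y : Fin n → ℝ => r • y) volume) := by
    rw [lintegral_map (by fun_prop) (by fun_prop)]
  have h2 := Measure.map_addHaar_smul (volume : Measure (Fin n → ℝ)) hr.ne'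
  rw [h1, h2, lintegral_smul_measure, lintegral_add_left_eq_self, smul_eq_mul, ← mul_assoc,
    ← ENNReal.ofReal_mul (by positivity)]
  simp only [Module.finrank_fintype_fun_eq_card, Fintype.card_fin]
  rw [abs_of_pos (by positivity), mul_inv_cancel₀ (by positivity)]
  simp

/-- sum of the coordinates of index at least `m` -/
noncomputable def btail (n m : ℕ) (u : Fin n → ℝ) : ℝ := ∑ i : Fin n, if m ≤ (i : ℕ) then u i else 0

/-- projection to the first `m` coordinates -/
noncomputable def phead (n m : ℕ) (u : Fin n → ℝ) : Fin n → ℝ := fun i => if m ≤ (i : ℕ) then 0 else u i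

/-- corner simplex -/
def Scorn (n : ℕ) : Set (Fin n → ℝ) := {u | (∀ i, 0 ≤ u i) ∧ ∑ i, u i ≤ 1}

lemma btail_cont (n m : ℕ) : Continuous (btail n m) := by
  unfold btail
  refine continuous_finsetSum _ fun i _ => ?_
  split_ifs <;> fun_prop

lemma phead_cont (n m : ℕ) : Continuous (phead n m) := by
  unfold phead
  refine continuous_pi fun i => ?_
  split_ifs <;> fun_prop

lemma btail_comb (n m : ℕ) (z y : Fin n → ℝ) (r : ℝ) :
    btail n m (phead n m z + r • y) = r * btail n m y := by
  unfold btail phead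
  rw [Finset.mul_sum]
  refine Finset.sum_congr rfl fun i _ => ?_
  by_cases h : m ≤ (i : ℕ) <;> simp [h]

lemma btail_nonneg {n m : ℕ} {u : Fin n → ℝ} (hu : u ∈ Scorn n) : 0 ≤ btail n m u := by
  unfold btail
  refine Finset.sum_nonneg fun i _ => ?_
  split_ifs
  · exact hu.1 i
  · exact le_rfl

lemma le_btail {n m : ℕ} {u : Fin n → ℝ} (hu : u ∈ Scorn n) (i : Fin n) (hi : m ≤ (i : ℕ)) :
    u i ≤ btail n m u := by
  unfold btail
  have := Finset.single_le_sum (f := fun i : Fin n => if m ≤ (i : ℕ) then u i else 0)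
    (s := Finset.univ) (fun j _ => by
      show 0 ≤ if m ≤ (j : ℕ) then u j else 0
      split_ifs
      · exact hu.1 j
      · exact le_rfl) (Finset.mem_univ i)
  simpa [hi] using this

lemma btail_add_head (n m : ℕ) (u : Fin n → ℝ) :
    ∑ i, phead n m u i + btail n m u = ∑ i, u i := by
  unfold btail phead
  rw [← Finset.sum_add_distrib]
  refine Finset.sum_congr rfl fun i _ => ?_
  split_ifs <;> simp

lemma phead_nonneg {n m : ℕ} {u : Fin n → ℝ} (hu : u ∈ Scorn n) (i : Fin n) :
    0 ≤ phead n m u i := by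
  unfold phead
  split_ifs
  · exact le_rfl
  · exact hu.1 i

lemma btail_le_sum {n m : ℕ} {u : Fin n → ℝ} (hu : u ∈ Scorn n) : btail n m u ≤ ∑ i, u i := by
  rw [← btail_add_head n m u]
  have : 0 ≤ ∑ i, phead n m u i := Finset.sum_nonneg fun i _ => phead_nonneg hu i
  linarith

lemma coord_le_one {n : ℕ} {u : Fin n → ℝ} (hu : u ∈ Scorn n) (i : Fin n) : u i ≤ 1 :=
  (Finset.single_le_sum (fun j _ => hu.1 j) (Finset.mem_univ i)).trans hu.2

lemma comb_mem {n m : ℕ} {z y : Fin n → ℝ} (hz : z ∈ Scorn n) (hy : y ∈ Scorn n) :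
    phead n m z + btail n m z • y ∈ Scorn n := by
  refine ⟨fun i => ?_, ?_⟩
  · have := mul_nonneg (btail_nonneg (m := m) hz) (hy.1 i)
    have := phead_nonneg (m := m) hz i
    simp only [Pi.add_apply, Pi.smul_apply, smul_eq_mul]
    linarith
  · simp only [Pi.add_apply, Pi.smul_apply, smul_eq_mul]
    rw [Finset.sum_add_distrib, ← Finset.mul_sum]
    have h1 := btail_add_head n m z
    have h2 := mul_le_mul_of_nonneg_left hy.2 (btail_nonneg (m := m) hz)
    have := hz.2
    linarith

lemma Scorn_meas (n : ℕ) : MeasurableSet (Scorn n) := by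
  refine IsClosed.measurableSet ?_
  unfold Scorn
  rw [Set.ofPred_and]
  refine IsClosed.inter ?_ ?_
  · rw [Set.ofPred_forall]
    exact isClosed_iInter fun i => isClosed_le continuous_const (continuous_apply i)
  · exact isClosed_le (by fun_prop) continuous_const

lemma ae_btail_pos {n m : ℕ} (h : m < n) :
    ∀ᵐ u ∂(volume : Measure (Fin n → ℝ)), u ∈ Scorn n → 0 < btail n m u := by
  have := Measure.pi_hyperplane (fun _ : Fin n => (volume : Measure ℝ)) ⟨m, h⟩ 0
  have h2 : ∀ᵐ u ∂(volume : Measure (Fin n → ℝ)), ¬ (u ⟨m, h⟩ = 0) := by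
    rw [ae_iff]; simpa [volume_pi] using this
  filter_upwards [h2] with u hu hS
  exact lt_of_lt_of_le (lt_of_le_of_ne (hS.1 _) (Ne.symm hu)) (le_btail hS ⟨m, h⟩ le_rfl)

lemma weight_fin {n m : ℕ} (h : m < n) :
    ∫⁻ u in Scorn n, ENNReal.ofReal ((√(btail n m u))⁻¹) < ⊤ := by
  let f : Fin n → ℝ → ℝ := fun i => Set.indicator (Set.Ioc 0 1)
    (fun t => if (i : ℕ) = m then t ^ (-(1/2) : ℝ) else 1)
  have hf : ∀ i, Integrable (f i) volume := by
    intro i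
    rw [integrable_indicator_iff measurableSet_Ioc]
    by_cases hi : (i : ℕ) = m
    · simp only [hi, if_true]
      have := intervalIntegral.intervalIntegrable_rpow' (r := (-(1/2) : ℝ)) (a := 0) (b := 1) (by norm_num)
      rwa [intervalIntegrable_iff_integrableOn_Ioc_of_le zero_le_one] at this
    · simp only [hi, if_false]
      simp
  have hI := Integrable.fintype_prod hf
  have hI2 := hI.lintegral_lt_top
  refine lt_of_le_of_lt ?_ hI2
  rw [← lintegral_indicator (Scorn_meas n)]
  refine lintegral_mono_ae ?_
  have h2 : ∀ i : Fin n, ∀ᵐ u ∂(volume : Measure (Fin n → ℝ)), ¬ (u i = 0) := by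
    intro i
    have := Measure.pi_hyperplane (fun _ : Fin n => (volume : Measure ℝ)) i 0
    rw [ae_iff]; simpa [volume_pi] using this
  filter_upwards [ae_all_iff.2 h2] with u hu
  by_cases hS : u ∈ Scorn n
  · rw [Set.indicator_of_mem hS]
    refine ENNReal.ofReal_le_ofReal ?_
    have hpos : ∀ i, 0 < u i := fun i => lt_of_le_of_ne (hS.1 i) (Ne.symm (hu i))
    have hfi : ∀ i, f i (u i) = if i = ⟨m, h⟩ then (u i) ^ (-(1/2) : ℝ) else 1 := by
      intro i
      simp only [f]
      rw [Set.indicator_of_mem (show u i ∈ Set.Ioc (0:ℝ) 1 from ⟨hpos i, coord_le_one hS i⟩)]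
      simp [Fin.ext_iff]
    simp only [hfi]
    rw [Finset.prod_ite_eq']
    simp only [Finset.mem_univ, if_true]
    rw [Real.rpow_neg (hpos _).le, ← Real.sqrt_eq_rpow]
    have := hpos ⟨m, h⟩
    have := le_btail (m := m) hS ⟨m, h⟩ le_rfl
    gcongr
  · rw [Set.indicator_of_notMem hS]; exact zero_le

/-- Schur kernel -/
noncomputable def Kker (n m : ℕ) (z w : Fin n → ℝ) : ℝ :=
  open Classical in
  if ‖z - phead n m w‖ ≤ btail n m z ∧ btail n m w ≤ btail n m z ∧ 0 < btail n m w then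
    ((btail n m z) ^ n)⁻¹ * √(btail n m w / btail n m z) else 0

lemma Kker_meas (n m : ℕ) :
    Measurable (fun p : (Fin n → ℝ) × (Fin n → ℝ) => Kker n m p.1 p.2) := by
  have hb := (btail_cont n m).measurable
  have hp := (phead_cont n m).measurable
  unfold Kker
  refine Measurable.ite ?_ (by fun_prop) measurable_const
  have h1 : MeasurableSet {p : (Fin n → ℝ) × (Fin n → ℝ) |
      ‖p.1 - phead n m p.2‖ ≤ btail n m p.1} := measurableSet_le (by fun_prop) (by fun_prop)
  have h2 : MeasurableSet {p : (Fin n → ℝ) × (Fin n → ℝ) |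
      btail n m p.2 ≤ btail n m p.1} := measurableSet_le (by fun_prop) (by fun_prop)
  have h3 : MeasurableSet {p : (Fin n → ℝ) × (Fin n → ℝ) |
      0 < btail n m p.2} := measurableSet_lt (by fun_prop) (by fun_prop)
  exact h1.inter (h2.inter h3)

lemma phead_comb (n m : ℕ) (z y : Fin n → ℝ) (r : ℝ) :
    phead n m (phead n m z + r • y) = phead n m z + r • phead n m y := by
  ext i
  unfold phead
  by_cases h : m ≤ (i : ℕ) <;> simp [h]

lemma Kker_lower {n m : ℕ} {z y : Fin n → ℝ} (hz : z ∈ Scorn n) (hy : y ∈ Scorn n)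
    (hbz : 0 < btail n m z) (hby : 0 < btail n m y) :
    (btail n m z) ^ n * Kker n m z (phead n m z + btail n m z • y) = √(btail n m y) := by
  unfold Kker
  have hy1 : btail n m y ≤ 1 := (btail_le_sum hy).trans hy.2
  rw [if_pos, btail_comb, mul_inv_cancel_left₀ (by positivity), mul_div_cancel_left₀ _ hbz.ne']
  rw [btail_comb]
  refine ⟨?_, by nlinarith, by positivity⟩
  rw [pi_norm_le_iff_of_nonneg hbz.le]
  intro i
  rw [phead_comb, Real.norm_eq_abs]
  simp only [Pi.add_apply, Pi.sub_apply, Pi.smul_apply, smul_eq_mul, phead]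
  by_cases h : m ≤ (i : ℕ)
  · simp only [h, if_true]
    have := le_btail hz i h
    have := hz.1 i
    rw [abs_le]; constructor <;> nlinarith
  · simp only [h, if_false]
    have := coord_le_one hy i
    have := hy.1 i
    rw [abs_le]; constructor <;> nlinarith

lemma Kker_upper (n m : ℕ) (w ζ : Fin n → ℝ) (hw : 0 < btail n m w) :
    (btail n m w) ^ n * Kker n m (phead n m w + btail n m w • ζ) w ≤
      2 ^ ((n : ℝ) + 1/2) * (1 + ‖ζ‖) ^ (-((n : ℝ) + 1/2)) := by
  unfold Kker
  split_ifs with h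
  · obtain ⟨h1, h2, -⟩ := h
    rw [btail_comb] at *
    rw [add_sub_cancel_left, norm_smul, Real.norm_eq_abs, abs_of_pos hw] at h1
    have h3 : ‖ζ‖ ≤ btail n m ζ := le_of_mul_le_mul_left h1 hw
    have h4 : 1 ≤ btail n m ζ := by
      refine le_of_mul_le_mul_left ?_ hw
      linarith
    set b := btail n m ζ
    have hb : 0 < b := by linarith
    have e1 : (btail n m w) ^ n * (((btail n m w * b) ^ n)⁻¹ * √(btail n m w / (btail n m w * b)))
        = b ^ (-((n : ℝ) + 1/2)) := by
      rw [Real.rpow_neg hb.le, Real.rpow_add hb, Real.rpow_natCast, ← Real.sqrt_eq_rpow, mul_pow,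
        div_mul_cancel_left₀ hw.ne', Real.sqrt_inv]
      field_simp
    rw [e1]
    have h5 : (1 + ‖ζ‖) / 2 ≤ b := by linarith
    calc b ^ (-((n : ℝ) + 1/2)) ≤ ((1 + ‖ζ‖) / 2) ^ (-((n : ℝ) + 1/2)) :=
          Real.rpow_le_rpow_of_nonpos (by positivity) h5 (by
            have : (0:ℝ) ≤ n := by positivity
            linarith)
      _ = _ := by
          rw [Real.div_rpow (by positivity) (by norm_num), Real.rpow_neg (by norm_num : (0:ℝ) ≤ 2)]
          field_simp
  · rw [mul_zero]; positivity

lemma Kker_int (n m : ℕ) : ∃ C : ENNReal, C < ⊤ ∧ ∀ w : Fin n → ℝ, 0 < btail n m w →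
    ∫⁻ z, ENNReal.ofReal (Kker n m z w) ≤ C := by
  refine ⟨∫⁻ ζ : Fin n → ℝ, ENNReal.ofReal
    (2 ^ ((n : ℝ) + 1/2) * (1 + ‖ζ‖) ^ (-((n : ℝ) + 1/2))), ?_, ?_⟩
  · have : Integrable (fun ζ : Fin n → ℝ => 2 ^ ((n : ℝ) + 1/2) * (1 + ‖ζ‖) ^ (-((n : ℝ) + 1/2))) := by
      refine (integrable_one_add_norm ?_).const_mul _
      simp
    exact this.lintegral_lt_top
  · intro w hw
    have hm : Measurable fun z => ENNReal.ofReal (Kker n m z w) :=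
      ((Kker_meas n m).comp (measurable_id.prodMk measurable_const)).ennreal_ofReal
    rw [← lint_scale n (phead n m w) _ hw _ hm, ← lintegral_const_mul _ (by exact hm.comp (by fun_prop))]
    refine lintegral_mono fun ζ => ?_
    rw [← ENNReal.ofReal_mul (by positivity)]
    exact ENNReal.ofReal_le_ofReal (Kker_upper n m w ζ hw)

lemma core2 {n m : ℕ} (h : m < n) : ∃ C : ENNReal, C < ⊤ ∧
    ∀ f : (Fin n → ℝ) → ENNReal, Measurable f →
    ∫⁻ z in Scorn n, ∫⁻ y in Scorn n, f (phead n m z + btail n m z • y) *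
      ENNReal.ofReal (√(btail n m y)) ≤ C * ∫⁻ w in Scorn n, f w := by
  obtain ⟨C, hC, hK⟩ := Kker_int n m
  refine ⟨C, hC, fun f hf => ?_⟩
  have hb := (btail_cont n m).measurable
  have hp := (phead_cont n m).measurable
  let F := (Scorn n).indicator f
  have hF : Measurable F := hf.indicator (Scorn_meas n)
  have hKm := Kker_meas n m
  have hKm1 : ∀ w, Measurable fun z => ENNReal.ofReal (Kker n m z w) := fun w =>
      ((Kker_meas n m).comp (measurable_id.prodMk measurable_const)).ennreal_ofReal
  have hKm2 : ∀ z, Measurable fun w => ENNReal.ofReal (Kker n m z w) := fun w =>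
      ((Kker_meas n m).comp (measurable_const.prodMk measurable_id)).ennreal_ofReal
  have step1 : ∫⁻ z in Scorn n, ∫⁻ y in Scorn n, f (phead n m z + btail n m z • y) *
      ENNReal.ofReal (√(btail n m y)) ≤ ∫⁻ z, ∫⁻ w, F w * ENNReal.ofReal (Kker n m z w) := by
    refine le_trans (lintegral_mono_ae ?_) (setLIntegral_le_lintegral (Scorn n) _)
    refine (ae_restrict_iff' (Scorn_meas n)).2 ?_
    filter_upwards [ae_btail_pos h] with z hz hzS
    rw [← lint_scale n (phead n m z) _ (hz hzS) (fun w => F w * ENNReal.ofReal (Kker n m z w))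
      (hF.mul (hKm2 z)), ← lintegral_const_mul _ (by
        have := hKm2 z
        exact (hF.mul (hKm2 z)).comp (by fun_prop))]
    refine le_trans (lintegral_mono_ae ?_) (setLIntegral_le_lintegral (Scorn n) _)
    refine (ae_restrict_iff' (Scorn_meas n)).2 ?_
    filter_upwards [ae_btail_pos h] with y hy hyS
    rw [← Kker_lower hzS hyS (hz hzS) (hy hyS),
      ENNReal.ofReal_mul (pow_nonneg (hz hzS).le _)]
    simp only [F]
    rw [Set.indicator_of_mem (comb_mem hzS hyS)]
    refine le_of_eq ?_
    ring
  refine step1.trans ?_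
  rw [lintegral_lintegral_swap]
  swap
  · exact ((hF.comp measurable_snd).mul hKm.ennreal_ofReal).aemeasurable
  rw [← lintegral_indicator (Scorn_meas n), ← lintegral_const_mul _ hF]
  refine lintegral_mono_ae ?_
  filter_upwards [ae_btail_pos h] with w hw
  by_cases hS : w ∈ Scorn n
  · rw [lintegral_const_mul _ (hKm1 w), mul_comm]
    gcongr
    exact hK w (hw hS)
  · simp [F, hS]

lemma core {n m : ℕ} (h : m < n) : ∃ C : ENNReal, C < ⊤ ∧
    ∀ g : (Fin n → ℝ) → ENNReal, Measurable g →
    ∫⁻ z in Scorn n, (∫⁻ y in Scorn n, g (phead n m z + btail n m z • y)) ^ 2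
      ≤ C * ∫⁻ w in Scorn n, g w ^ 2 := by
  obtain ⟨C, hC, hK⟩ := core2 h
  set W := ∫⁻ u in Scorn n, ENNReal.ofReal ((√(btail n m u))⁻¹) with hW
  have hWt := weight_fin h
  refine ⟨W * C, ENNReal.mul_lt_top hWt hC, fun g hg => ?_⟩
  have hb := (btail_cont n m).measurable
  have hp := (phead_cont n m).measurable
  rw [mul_assoc]
  refine le_trans ?_ (mul_le_mul_right (hK (fun w => g w ^ 2) (hg.pow_const 2)) W)
  rw [← lintegral_const_mul' _ _ hWt.ne]
  refine lintegral_mono fun z => ?_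
  have key := ENNReal.lintegral_mul_le_Lp_mul_Lq (volume.restrict (Scorn n))
    Real.HolderConjugate.two_two
    (f := fun y => g (phead n m z + btail n m z • y) * ENNReal.ofReal (√√(btail n m y)))
    (g := fun y => ENNReal.ofReal ((√√(btail n m y))⁻¹)) (by fun_prop) (by fun_prop)
  have e1 : ∫⁻ y in Scorn n, g (phead n m z + btail n m z • y) =
      ∫⁻ y in Scorn n, ((fun y => g (phead n m z + btail n m z • y) * ENNReal.ofReal (√√(btail n m y)))
       * fun y => ENNReal.ofReal ((√√(btail n m y))⁻¹)) y := by
    refine lintegral_congr_ae ?_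
    rw [Filter.EventuallyEq, ae_restrict_iff' (Scorn_meas n)]
    filter_upwards [ae_btail_pos h] with y hy hyS
    have := hy hyS
    simp only [Pi.mul_apply]
    rw [mul_assoc, ← ENNReal.ofReal_mul (by positivity), mul_inv_cancel₀ (by positivity)]
    simp
  have e2 : ∀ t : ℝ, 0 ≤ t → ENNReal.ofReal (√t) ^ 2 = ENNReal.ofReal t := by
    intro t ht
    rw [← ENNReal.ofReal_pow (by positivity), Real.sq_sqrt ht]
  rw [← e1] at key
  refine (pow_le_pow_left' key 2).trans (le_of_eq ?_)
  rw [mul_pow, ← ENNReal.rpow_natCast, ← ENNReal.rpow_natCast, ← ENNReal.rpow_mul, ← ENNReal.rpow_mul]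
  norm_num
  rw [mul_comm]
  congr 1
  · refine lintegral_congr fun y => ?_
    rw [← Real.sqrt_inv, e2 _ (by positivity)]
  · refine lintegral_congr fun y => ?_
    rw [mul_pow, e2 _ (by positivity)]

/-- linear part of the parametrization of the simplex -/
noncomputable def Llin (n : ℕ) (x : Fin (n + 1) → Fin n → ℝ) : (Fin n → ℝ) →L[ℝ] (Fin n → ℝ) :=
  ∑ i : Fin n, (ContinuousLinearMap.proj (R := ℝ) (φ := fun _ : Fin n => ℝ) i).smulRight (x i.succ - x 0)

lemma Llin_apply (n : ℕ) (x : Fin (n + 1) → Fin n → ℝ) (u : Fin n → ℝ) :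
    Llin n x u = ∑ i : Fin n, u i • (x i.succ - x 0) := by
  simp [Llin]

/-- parametrization of the simplex -/
noncomputable def Phi (n : ℕ) (x : Fin (n + 1) → Fin n → ℝ) (u : Fin n → ℝ) : Fin n → ℝ :=
  x 0 + Llin n x u

lemma Llin_inj (n : ℕ) (x : Fin (n + 1) → Fin n → ℝ) (hx : AffineIndependent ℝ x) :
    Function.Injective (Llin n x) := by
  rw [affineIndependent_iff_linearIndependent_vsub ℝ x 0] at hx
  have h2 : LinearIndependent ℝ (fun i : Fin n => x i.succ - x 0) := by
    have := hx.comp (fun i : Fin n => (⟨i.succ, Fin.succ_ne_zero i⟩ : {j : Fin (n+1) // j ≠ 0}))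
      (fun a b hab => by simpa using hab)
    exact this
  rw [Fintype.linearIndependent_iff] at h2
  rw [injective_iff_map_eq_zero]
  intro u hu
  rw [Llin_apply] at hu
  funext i
  exact h2 u hu i

lemma Llin_det (n : ℕ) (x : Fin (n + 1) → Fin n → ℝ) (hx : AffineIndependent ℝ x) :
    (Llin n x).det ≠ 0 := by
  intro h
  have := LinearMap.bot_lt_ker_of_det_eq_zero (f := (Llin n x : (Fin n → ℝ) →ₗ[ℝ] (Fin n → ℝ))) h
  have h2 : LinearMap.ker (Llin n x : (Fin n → ℝ) →ₗ[ℝ] (Fin n → ℝ)) = ⊥ :=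
    LinearMap.ker_eq_bot.2 (Llin_inj n x hx)
  rw [h2] at this
  exact lt_irrefl _ this

lemma Phi_image (n : ℕ) (x : Fin (n + 1) → Fin n → ℝ) :
    Phi n x '' Scorn n = convexHull ℝ (Set.range x) := by
  apply Set.Subset.antisymm
  · rintro _ ⟨u, hu, rfl⟩
    have e : Phi n x u = ∑ j : Fin (n + 1), (Fin.cons (1 - ∑ i, u i) u : Fin (n+1) → ℝ) j • x j := by
      rw [Fin.sum_univ_succ]
      simp only [Fin.cons_zero, Fin.cons_succ]
      rw [Phi, Llin_apply]
      simp only [smul_sub, Finset.sum_sub_distrib]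
      rw [← Finset.sum_smul]
      module
    rw [e]
    refine (convex_convexHull ℝ _).sum_mem ?_ ?_ ?_
    · intro j _
      refine Fin.cases ?_ (fun i => ?_) j
      · simpa using hu.2
      · simpa using hu.1 i
    · rw [Fin.sum_univ_succ]; simp
    · intro j _
      exact subset_convexHull ℝ _ ⟨j, rfl⟩
  · refine convexHull_min ?_ ?_
    · rintro _ ⟨j, rfl⟩
      refine Fin.cases ?_ (fun i => ?_) j
      · exact ⟨0, ⟨fun _ => le_rfl, by simp⟩, by simp [Phi]⟩
      · refine ⟨Pi.single i 1, ⟨fun k => ?_, by simp⟩, ?_⟩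
        · by_cases h : k = i
          · subst h; simp
          · simp [h]
        · rw [Phi, Llin_apply]
          simp [Pi.single_apply]
    · rintro _ ⟨u, hu, rfl⟩ _ ⟨w, hw, rfl⟩ a b ha hb hab
      refine ⟨a • u + b • w, ⟨fun i => ?_, ?_⟩, ?_⟩
      · have := mul_nonneg ha (hu.1 i)
        have := mul_nonneg hb (hw.1 i)
        simp only [Pi.add_apply, Pi.smul_apply, smul_eq_mul]
        linarith
      · simp only [Pi.add_apply, Pi.smul_apply, smul_eq_mul]
        rw [Finset.sum_add_distrib, ← Finset.mul_sum, ← Finset.mul_sum]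
        nlinarith [hu.2, hw.2]
      · simp only [Phi, map_add, map_smul]
        obtain rfl : b = 1 - a := by linarith
        module

lemma lint_hull (n : ℕ) (x : Fin (n + 1) → Fin n → ℝ) (hx : AffineIndependent ℝ x)
    (g : (Fin n → ℝ) → ENNReal) :
    ∫⁻ z in convexHull ℝ (Set.range x), g z =
      ENNReal.ofReal |(Llin n x).det| * ∫⁻ u in Scorn n, g (Phi n x u) := by
  rw [← Phi_image, lintegral_image_eq_lintegral_abs_det_fderiv_mul volume (Scorn_meas n)
    (f' := fun _ => Llin n x), lintegral_const_mul' _ _ ENNReal.ofReal_ne_top]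
  · intro u _
    exact ((Llin n x).hasFDerivAt.const_add (x 0)).hasFDerivWithinAt
  · intro u _ w _ h
    exact Llin_inj n x hx (add_left_cancel h)

lemma sum_castLE (n m : ℕ) (h : m ≤ n) {M : Type*} [AddCommMonoid M] (f : Fin n → M) :
    ∑ k : Fin m, f (Fin.castLE h k) = ∑ i : Fin n, if m ≤ (i : ℕ) then 0 else f i := by
  obtain ⟨d, rfl⟩ := Nat.exists_eq_add_of_le h
  rw [Fin.sum_univ_add]
  simp only [Fin.val_castAdd, Fin.val_natAdd, Nat.le_add_right, if_true, Finset.sum_const_zero, add_zero]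
  refine Finset.sum_congr rfl fun k _ => ?_
  rw [if_neg (by have := k.2; omega)]
  rfl

lemma lam_Phi (n : ℕ) (x' : Fin (n + 1) → Fin n → ℝ)
    (l : (Fin n → ℝ) →ᵃ[ℝ] ℝ) (u : Fin n → ℝ) :
    l (Phi n x' u) = l (x' 0) + ∑ i, u i * (l (x' i.succ) - l (x' 0)) := by
  have h1 : l (Phi n x' u) = l (x' 0) + l.linear (Llin n x' u) := by
    have := l.map_vadd (x' 0) (Llin n x' u)
    simp only [vadd_eq_add] at this
    rw [Phi, add_comm, this, add_comm]
  rw [h1, Llin_apply, map_sum]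
  congr 1
  refine Finset.sum_congr rfl fun i _ => ?_
  rw [map_smul, smul_eq_mul]
  congr 1
  have := l.linearMap_vsub (x' i.succ) (x' 0)
  simpa using this

lemma G_Phi (n m : ℕ) (hmn : m < n) (hm : m + 1 ≤ n + 1)
    (x : Fin (n + 1) → Fin n → ℝ)
    (x' : Fin (n + 1) → Fin n → ℝ)
    (lam : Fin (n + 1) → ((Fin n → ℝ) →ᵃ[ℝ] ℝ))
    (hlam_basis : ∀ i j, lam i (x' j) = if i = j then 1 else 0) (u y : Fin n → ℝ) :
    Gmap n m (fun j : Fin (m + 1) => x (Fin.castLE hm j))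
      (fun i : Fin (m + 1) => lam (Fin.castLE hm i) (Phi n x' u)) (Phi n x y) =
    Phi n x (phead n m u + btail n m u • y) := by
  have l0 : lam 0 (Phi n x' u) = 1 - ∑ i, u i := by
    rw [lam_Phi]
    simp [hlam_basis, Fin.succ_ne_zero, (Fin.succ_ne_zero _).symm]
    ring
  have ls : ∀ k : Fin n, lam k.succ (Phi n x' u) = u k := by
    intro k
    rw [lam_Phi]
    simp [hlam_basis, Fin.succ_ne_zero]
  have c0 : Fin.castLE hm 0 = 0 := rfl
  have cs : ∀ k : Fin m, Fin.castLE hm k.succ = (Fin.castLE hmn.le k).succ := fun k => rfl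
  have hb : bfun m (fun i : Fin (m + 1) => lam (Fin.castLE hm i) (Phi n x' u)) = btail n m u := by
    unfold bfun
    rw [Fin.sum_univ_succ]
    simp only [c0, cs, ls, l0]
    rw [sum_castLE n m hmn.le u, ← btail_add_head n m u]
    simp only [phead]
    ring
  unfold Gmap
  rw [hb, Fin.sum_univ_succ]
  simp only [c0, cs, ls, l0]
  rw [sum_castLE n m hmn.le (fun k => u k • x k.succ)]
  have hL : Llin n x (phead n m u) = (∑ i : Fin n, if m ≤ (i : ℕ) then 0 else u i • x i.succ)
      - (∑ i, phead n m u i) • x 0 := by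
    rw [Llin_apply, Finset.sum_smul, ← Finset.sum_sub_distrib]
    refine Finset.sum_congr rfl fun i _ => ?_
    unfold phead
    split_ifs
    · simp
    · rw [smul_sub]
  rw [← btail_add_head n m u]
  simp only [Phi, map_add, map_smul, hL]
  module

lemma diff_int (n : ℕ) (T : Set (Fin n → ℝ)) (hT : IsCompact T)
    (G : (Fin n → ℝ) → (Fin n → ℝ) → (Fin n → ℝ))
    (hG : Continuous fun p : (Fin n → ℝ) × (Fin n → ℝ) => G p.1 p.2)
    (D : (Fin n → ℝ) → ((Fin n → ℝ) →L[ℝ] (Fin n → ℝ))) (hD : Continuous D)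
    (hGD : ∀ z y, HasFDerivAt (fun z => G z y) (D y) z)
    (v : (Fin n → ℝ) → ℝ) (hv : ContDiff ℝ 1 v) (z : Fin n → ℝ) :
    HasFDerivAt (fun z => ∫ y in T, v (G z y))
      (∫ y in T, (fderiv ℝ v (G z y)).comp (D y)) z := by
  have hfv : Continuous (fderiv ℝ v) := hv.continuous_fderiv one_ne_zero
  have hvc := hv.continuous
  have hjoint : Continuous fun p : (Fin n → ℝ) × (Fin n → ℝ) =>
      (fderiv ℝ v (G p.1 p.2)).comp (D p.2) :=
    (hfv.comp hG).clm_comp (hD.comp continuous_snd)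
  obtain ⟨B, hB⟩ := ((isCompact_closedBall z 1).prod hT).exists_bound_of_continuousOn
    hjoint.continuousOn
  have hGz : ∀ z, Continuous fun y => G z y := fun z => hG.comp (by fun_prop : Continuous fun y => (z, y))
  refine hasFDerivAt_integral_of_dominated_of_fderiv_le
    (F := fun z y => v (G z y)) (F' := fun z y => (fderiv ℝ v (G z y)).comp (D y))
    (s := Metric.closedBall z 1) (bound := fun _ => B)
    (Metric.closedBall_mem_nhds z one_pos) ?_ ?_ ?_ ?_ ?_ ?_
  · exact Filter.Eventually.of_forall fun z => (hvc.comp (hGz z)).aestronglyMeasurable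
  · exact (hvc.comp (hGz z)).continuousOn.integrableOn_compact hT
  · exact (hjoint.comp (by fun_prop : Continuous fun y => (z, y))).aestronglyMeasurable
  · refine (ae_restrict_iff' hT.measurableSet).2 (Filter.Eventually.of_forall fun y hy z hz => ?_)
    exact hB (z, y) ⟨hz, hy⟩
  · exact integrableOn_const hT.measure_lt_top.ne
  · refine Filter.Eventually.of_forall fun y z _ => ?_
    exact ((hv.differentiable one_ne_zero (G z y)).hasFDerivAt).comp z (hGD z y)

lemma diff_bound (n : ℕ) (T : Set (Fin n → ℝ)) (hT : IsCompact T)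
    (G : (Fin n → ℝ) → (Fin n → ℝ) → (Fin n → ℝ))
    (hG : Continuous fun p : (Fin n → ℝ) × (Fin n → ℝ) => G p.1 p.2)
    (D : (Fin n → ℝ) → ((Fin n → ℝ) →L[ℝ] (Fin n → ℝ))) (hD : Continuous D)
    (hGD : ∀ z y, HasFDerivAt (fun z => G z y) (D y) z) (c : ℝ) :
    ∃ C : ENNReal, C < ⊤ ∧ ∀ (v : (Fin n → ℝ) → ℝ) (_ : ContDiff ℝ 1 v),
      Differentiable ℝ (fun z => c * ∫ y in T, v (G z y)) ∧
      ∀ z, ‖fderiv ℝ (fun z => c * ∫ y in T, v (G z y)) z‖ₑ ≤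
        C * ∫⁻ y in T, ‖fderiv ℝ v (G z y)‖ₑ := by
  obtain ⟨M, hM⟩ := hT.exists_bound_of_continuousOn hD.continuousOn
  refine ⟨‖c‖ₑ * ENNReal.ofReal M, ENNReal.mul_lt_top enorm_lt_top ENNReal.ofReal_lt_top, fun v hv => ?_⟩
  have key := fun z => (diff_int n T hT G hG D hD hGD v hv z).const_mul c
  refine ⟨fun z => (key z).differentiableAt, fun z => ?_⟩
  rw [(key z).fderiv, enorm_smul, mul_assoc]
  gcongr
  refine (enorm_integral_le_lintegral_enorm _).trans ?_
  rw [← lintegral_const_mul' _ _ ENNReal.ofReal_ne_top]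
  refine lintegral_mono_ae ?_
  refine (ae_restrict_iff' hT.measurableSet).2 (Filter.Eventually.of_forall fun y hy => ?_)
  rw [← ofReal_norm, ← ofReal_norm, ← ENNReal.ofReal_mul' (norm_nonneg _)]
  refine ENNReal.ofReal_le_ofReal ?_
  refine (ContinuousLinearMap.opNorm_comp_le _ _).trans ?_
  rw [mul_comm]
  exact mul_le_mul_of_nonneg_right (hM y hy) (norm_nonneg _)

lemma int_sq_eq {n : ℕ} (μ : Measure (Fin n → ℝ)) (f : (Fin n → ℝ) → ((Fin n → ℝ) →L[ℝ] ℝ))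
    (hf : Measurable f) : ∫ z, ‖f z‖ ^ 2 ∂μ = (∫⁻ z, ‖f z‖ₑ ^ 2 ∂μ).toReal := by
  rw [integral_eq_lintegral_of_nonneg_ae (Filter.Eventually.of_forall fun _ => by positivity)
    (hf.norm.pow_const 2).aestronglyMeasurable]
  congr 1
  refine lintegral_congr fun z => ?_
  rw [ENNReal.ofReal_pow (norm_nonneg _), ofReal_norm]

/-- H¹ boundedness of the pulled-back averaging operator `λ_f^* ∘ A_{f,T}`
(special case of Lemma `H1-preserve-gen`): for `v` continuously differentiable, the
function `F(z) = ⨍_T v(G_m(λ'(z), y)) dy` is differentiable and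
`∫_{T'} ‖DF‖² ≤ c ∫_T ‖Dv‖²`, with `λ'` the first `m+1` barycentric coordinates with
respect to the vertices `x'` of `T'` (and `x'_j = x_j` for `j ≤ m`). -/
theorem average_H1_bounded (n m : ℕ) (hmn : m < n)
    (x : Fin (n + 1) → Fin n → ℝ) (hx : AffineIndependent ℝ x)
    (x' : Fin (n + 1) → Fin n → ℝ) (hx' : AffineIndependent ℝ x')
    (hagree : ∀ j : Fin (n + 1), (j : ℕ) ≤ m → x' j = x j)
    (lam : Fin (n + 1) → ((Fin n → ℝ) →ᵃ[ℝ] ℝ))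
    (hlam_sum : ∀ z : Fin n → ℝ, ∑ i, lam i z = 1)
    (hlam_basis : ∀ i j, lam i (x' j) = if i = j then 1 else 0) :
    ∃ c : ℝ, ∀ v : (Fin n → ℝ) → ℝ, ContDiff ℝ 1 v →
      Differentiable ℝ (fun z : Fin n → ℝ =>
        Avg n m (fun j : Fin (m + 1) => x (Fin.castLE (by omega) j))
          (convexHull ℝ (Set.range x)) v
          (fun i : Fin (m + 1) => lam (Fin.castLE (by omega) i) z)) ∧
      ∫ z in convexHull ℝ (Set.range x'),
          ‖fderiv ℝ (fun z : Fin n → ℝ =>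
            Avg n m (fun j : Fin (m + 1) => x (Fin.castLE (by omega) j))
              (convexHull ℝ (Set.range x)) v
              (fun i : Fin (m + 1) => lam (Fin.castLE (by omega) i) z)) z‖ ^ 2
        ≤ c * ∫ y in convexHull ℝ (Set.range x), ‖fderiv ℝ v y‖ ^ 2 := by
  have hm : m + 1 ≤ n + 1 := by omega
  set T := convexHull ℝ (Set.range x) with hTdef
  have hT : IsCompact T := (Set.finite_range x).isCompact_convexHull ℝ
  let G : (Fin n → ℝ) → (Fin n → ℝ) → (Fin n → ℝ) := fun z y =>
    Gmap n m (fun j : Fin (m + 1) => x (Fin.castLE hm j))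
      (fun i : Fin (m + 1) => lam (Fin.castLE hm i) z) y
  let ell : Fin (n + 1) → ((Fin n → ℝ) →L[ℝ] ℝ) := fun i => (lam i).linear.toContinuousLinearMap
  have hell : ∀ i z, HasFDerivAt (fun z => lam i z) (ell i) z := by
    intro i z
    have e : (fun z => lam i z) = fun z => ell i z + lam i 0 := by
      funext z
      have := congrFun (AffineMap.decomp (lam i)) z
      simpa [ell] using this
    rw [e]
    exact (ell i).hasFDerivAt.add_const _
  have hlc : ∀ i, Continuous fun z => lam i z := fun i =>
    continuous_iff_continuousAt.2 fun z => (hell i z).continuousAt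
  let D : (Fin n → ℝ) → ((Fin n → ℝ) →L[ℝ] (Fin n → ℝ)) := fun y =>
    (∑ j : Fin (m + 1), (ell (Fin.castLE hm j)).smulRight (x (Fin.castLE hm j))) +
      (-(∑ j : Fin (m + 1), ell (Fin.castLE hm j))).smulRight y
  have hG : Continuous fun p : (Fin n → ℝ) × (Fin n → ℝ) => G p.1 p.2 := by
    simp only [G, Gmap, bfun]
    fun_prop
  have hD : Continuous D := by
    refine continuous_const.add ?_
    exact (ContinuousLinearMap.smulRightL ℝ (Fin n → ℝ) (Fin n → ℝ)
      (-(∑ j : Fin (m + 1), ell (Fin.castLE hm j)))).continuous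
  have hGD : ∀ z y, HasFDerivAt (fun z => G z y) (D y) z := by
    intro z y
    simp only [G, Gmap, bfun, D]
    refine HasFDerivAt.add ?_ ?_
    · exact HasFDerivAt.fun_sum fun j _ => (hell _ z).smul_const _
    · refine HasFDerivAt.smul_const ?_ _
      exact (HasFDerivAt.fun_sum fun j _ => hell _ z).const_sub 1
  obtain ⟨C1, hC1, h1⟩ := diff_bound n T hT G hG D hD hGD (volume T).toReal⁻¹
  obtain ⟨C2, hC2, h2⟩ := core hmn
  set d := ENNReal.ofReal |(Llin n x).det| with hd
  set d' := ENNReal.ofReal |(Llin n x').det| with hd'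
  have hd0 : d ≠ 0 := by
    rw [hd, Ne, ENNReal.ofReal_eq_zero, not_le]
    exact abs_pos.2 (Llin_det n x hx)
  have hdt : d ≠ ⊤ := ENNReal.ofReal_ne_top
  have hdt' : d' ≠ ⊤ := ENNReal.ofReal_ne_top
  refine ⟨(C1 ^ 2 * d' * d * C2).toReal, fun v hv => ?_⟩
  obtain ⟨hdiff, hbd⟩ := h1 v hv
  refine ⟨hdiff, ?_⟩
  have hfv : Continuous (fderiv ℝ v) := hv.continuous_fderiv one_ne_zero
  change ∫ z in convexHull ℝ (Set.range x'),
    ‖fderiv ℝ (fun z => (volume T).toReal⁻¹ * ∫ y in T, v (G z y)) z‖ ^ 2 ≤ _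
  rw [int_sq_eq _ _ (measurable_fderiv ℝ _), int_sq_eq _ _ hfv.measurable, ← ENNReal.toReal_mul]
  have hfin : ∫⁻ y in T, ‖fderiv ℝ v y‖ₑ ^ 2 < ⊤ := by
    have hc : Continuous fun y => ‖fderiv ℝ v y‖ ^ 2 := by fun_prop
    have := (hc.continuousOn.integrableOn_compact (μ := volume) hT).lintegral_lt_top
    simpa only [ENNReal.ofReal_pow (norm_nonneg _), ofReal_norm] using this
  refine ENNReal.toReal_mono ?_ ?_
  · exact ENNReal.mul_ne_top (by finiteness) hfin.ne
  have hPhi : Continuous (Phi n x) := continuous_const.add (Llin n x).continuous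
  calc ∫⁻ z in convexHull ℝ (Set.range x'),
        ‖fderiv ℝ (fun z => (volume T).toReal⁻¹ * ∫ y in T, v (G z y)) z‖ₑ ^ 2
      ≤ ∫⁻ z in convexHull ℝ (Set.range x'), (C1 * ∫⁻ y in T, ‖fderiv ℝ v (G z y)‖ₑ) ^ 2 :=
        lintegral_mono fun z => pow_le_pow_left' (hbd z) 2
    _ = d' * ∫⁻ u in Scorn n, (C1 * (d * ∫⁻ y in Scorn n,
          ‖fderiv ℝ v (Phi n x (phead n m u + btail n m u • y))‖ₑ)) ^ 2 := by
        rw [lint_hull n x' hx']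
        congr 1
        refine lintegral_congr fun u => ?_
        rw [hTdef, lint_hull n x hx]
        simp only [G, G_Phi n m hmn hm x x' lam hlam_basis]
        rfl
    _ = d' * (C1 ^ 2 * d ^ 2 * ∫⁻ u in Scorn n, (∫⁻ y in Scorn n,
          ‖fderiv ℝ v (Phi n x (phead n m u + btail n m u • y))‖ₑ) ^ 2) := by
        congr 1
        rw [← lintegral_const_mul' _ _ (by finiteness)]
        refine lintegral_congr fun u => ?_
        ring
    _ ≤ d' * (C1 ^ 2 * d ^ 2 * (C2 * ∫⁻ w in Scorn n, ‖fderiv ℝ v (Phi n x w)‖ₑ ^ 2)) := by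
        gcongr
        exact h2 (fun w => ‖fderiv ℝ v (Phi n x w)‖ₑ)
          (hfv.comp hPhi).measurable.enorm
    _ = C1 ^ 2 * d' * d * C2 * ∫⁻ y in T, ‖fderiv ℝ v y‖ₑ ^ 2 := by
        rw [hTdef, lint_hull n x hx]
        ring
end

section
/- Let 0 ≤ m < n be integers, let x_0,…,x_n ∈ ℝ^n be affinely independent with T = conv{x_0,…,x_n}, let λ_0(x),…,λ_n(x) be the barycentric coordinates of x with respect to x_0,…,x_n, and set λ_f(x) = (λ_0(x),…,λ_m(x)) and ρ_f(x) = 1 − Σ_{j=0}^m λ_j(x). Then there exists a constant c, depending only on T and m, such that for every continuously differentiable function v : ℝ^n → ℝ: ∫_T ρ_f(x)^{−2} | v(x) − ⨍_T v(G_m(λ_f(x), y)) dy |² dx ≤ c ∫_T ‖Dv(x)‖² dx, where Dv denotes the total derivative of v. (This is the weak trace-preservation/decay estimate for the averaging operator: v − A_{f,T} v decays near the face f = conv{x_0,…,x_m}.) -/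
open Finset MeasureTheory

theorem adc_smul_change {n : ℕ} (h : (Fin n → ℝ) → ENNReal) (b : Fin n → ℝ) (κ : ℝ) (hκ : 0 < κ) :
    ∫⁻ y, h (b + κ • y) = ENNReal.ofReal ((κ ^ n)⁻¹) * ∫⁻ y, h y := by
  have e : MeasurableEmbedding (fun y : Fin n → ℝ => κ • y) :=
    (Homeomorph.smulOfNeZero κ hκ.ne').measurableEmbedding
  have h1 : ∫⁻ y, h (b + κ • y) = ∫⁻ y, h (b + y) ∂(Measure.map (fun y : Fin n → ℝ => κ • y) volume) := by
    rw [e.lintegral_map]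
  rw [h1]
  have := Measure.map_addHaar_smul (volume : Measure (Fin n → ℝ)) hκ.ne'
  erw [this]
  rw [lintegral_smul_measure, lintegral_add_left_eq_self (fun y => h y) b]
  simp only [Module.finrank_fin_fun, smul_eq_mul]
  rw [abs_of_pos (by positivity)]

theorem adc_I_fin (n : ℕ) :
    ∫⁻ z : Fin n → ℝ, ENNReal.ofReal (((1 + ‖z‖) ^ (n + 1))⁻¹) < ⊤ := by
  have := finite_integral_one_add_norm (E := Fin n → ℝ) (r := (n + 1 : ℝ)) (μ := volume) (by simp)
  refine lt_of_eq_of_lt ?_ this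
  congr 1
  ext z
  congr 1
  rw [Real.rpow_neg (by positivity)]
  norm_cast

theorem adc_kernel {n : ℕ} (r a : ℝ) (hr : 0 ≤ r) (ha : 0 < a) (q : Fin n → ℝ) :
    ∫⁻ z, ENNReal.ofReal (r * ((r + ‖z - q‖ / a) ^ (n + 1))⁻¹) ≤
      ENNReal.ofReal (a ^ n) * ∫⁻ z : Fin n → ℝ, ENNReal.ofReal (((1 + ‖z‖) ^ (n + 1))⁻¹) := by
  rcases hr.eq_or_lt with rfl | hr
  · simp
  have hk : 0 < (a * r)⁻¹ := by positivity
  have e := adc_smul_change (fun z : Fin n → ℝ => ENNReal.ofReal (((1 + ‖z‖) ^ (n + 1))⁻¹))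
    (-((a * r)⁻¹ • q)) (a * r)⁻¹ hk
  have e2 : ∀ z, ENNReal.ofReal (r * ((r + ‖z - q‖ / a) ^ (n + 1))⁻¹) =
      ENNReal.ofReal ((r ^ n)⁻¹) * 
        ENNReal.ofReal (((1 + ‖-((a * r)⁻¹ • q) + (a * r)⁻¹ • z‖) ^ (n + 1))⁻¹) := by
    intro z
    rw [← ENNReal.ofReal_mul (by positivity)]
    congr 1
    have : -((a * r)⁻¹ • q) + (a * r)⁻¹ • z = (a * r)⁻¹ • (z - q) := by rw [smul_sub]; abel
    rw [this, norm_smul, Real.norm_of_nonneg hk.le]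
    have : r + ‖z - q‖ / a = r * (1 + (a * r)⁻¹ * ‖z - q‖) := by field_simp
    rw [this, mul_pow, pow_succ r]
    have : 0 < 1 + (a * r)⁻¹ * ‖z - q‖ := by positivity
    generalize (1 + (a * r)⁻¹ * ‖z - q‖) = X at *
    field_simp
  simp_rw [e2]
  rw [lintegral_const_mul' _ _ ENNReal.ofReal_ne_top, e, ← mul_assoc, ← ENNReal.ofReal_mul (by positivity)]
  apply le_of_eq
  congr 2
  rw [inv_pow, inv_inv, mul_pow]
  field_simp

theorem adc_jensen {Ω : Type*} [MeasurableSpace Ω] (μ : Measure Ω) [IsProbabilityMeasure μ]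
    (g : Ω → ℝ) (h1 : Integrable g μ) (h2 : Integrable (fun x => g x ^ 2) μ) :
    (∫ x, g x ∂μ) ^ 2 ≤ ∫ x, g x ^ 2 ∂μ := by
  have := (even_two.convexOn_pow (𝕜 := ℝ)).map_integral_le (μ := μ) (f := g)
    (by fun_prop) isClosed_univ (by simp) h1 h2
  exact this

theorem adc_L3 {n : ℕ} (T : Set (Fin n → ℝ)) (hTm : MeasurableSet T) (ρ : (Fin n → ℝ) → ℝ)
    (hρc : Continuous ρ) (P : (Fin n → ℝ) → Fin n → ℝ) (d : ℝ) (hd : 0 < d)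
    (hρ0 : ∀ z ∈ T, 0 ≤ ρ z)
    (h2 : ∀ z ∈ T, ∀ y ∈ T, ∀ t : ℝ, 0 ≤ t → t ≤ 1 →
      P z + ρ z • y + t • (z - (P z + ρ z • y)) ∈ T ∧
      t * ρ z ≤ ρ (P z + ρ z • y + t • (z - (P z + ρ z • y))) ∧
      ρ (P z + ρ z • y + t • (z - (P z + ρ z • y))) ≤ ρ z)
    (h3 : ∀ z ∈ T, ∀ y ∈ T, ‖z - (P z + ρ z • y)‖ ≤ d * ρ z)
    (F : (Fin n → ℝ) → ENNReal) (hF : Measurable F) (t : ℝ) (ht0 : 0 < t) (ht1 : t < 1) :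
    ∫⁻ z in T ∩ {z | 0 < ρ z}, ∫⁻ y in T,
        ENNReal.ofReal t * F (P z + ρ z • y + t • (z - (P z + ρ z • y))) ≤
      (ENNReal.ofReal (2 ^ (n + 1) * d ^ n) *
        ∫⁻ z : Fin n → ℝ, ENNReal.ofReal (((1 + ‖z‖) ^ (n + 1))⁻¹)) * ∫⁻ z in T, F z := by
  set s := 1 - t with hs
  have hs0 : 0 < s := by linarith
  set I := ∫⁻ z : Fin n → ℝ, ENNReal.ofReal (((1 + ‖z‖) ^ (n + 1))⁻¹) with hI
  set H : (Fin n → ℝ) → (Fin n → ℝ) → ENNReal := fun z q =>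
    T.indicator F q * ENNReal.ofReal (ρ q * ((ρ q + ‖z - q‖ / (d * s)) ^ (n + 1))⁻¹) with hH
  have hρm := hρc.measurable
  have hHm : Measurable (Function.uncurry H) := by
    simp only [hH, Function.uncurry_def]
    have : Measurable (T.indicator F) := hF.indicator hTm
    fun_prop
  have hS : MeasurableSet (T ∩ {z | 0 < ρ z}) := hTm.inter (measurableSet_lt measurable_const hρm)
  -- pointwise bound
  have key : ∀ z ∈ T ∩ {z | 0 < ρ z}, ∫⁻ y in T,
      ENNReal.ofReal t * F (P z + ρ z • y + t • (z - (P z + ρ z • y))) ≤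
      ENNReal.ofReal (2 ^ (n + 1) * (s ^ n)⁻¹) * ∫⁻ q, H z q := by
    rintro z ⟨hz, hρz⟩
    have hρz : 0 < ρ z := hρz
    have hb : ∀ y, P z + ρ z • y + t • (z - (P z + ρ z • y)) =
        (P z + t • (z - P z)) + (s * ρ z) • y := by
      intro y
      ext i
      simp [hs]
      ring
    have hpt : ∀ y ∈ T, ENNReal.ofReal t * F (P z + ρ z • y + t • (z - (P z + ρ z • y))) ≤
        ENNReal.ofReal (2 ^ (n + 1) * ρ z ^ n) * H z ((P z + t • (z - P z)) + (s * ρ z) • y) := by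
      intro y hy
      obtain ⟨a1, a2, a3⟩ := h2 z hz y hy t ht0.le ht1.le
      have a4 : ‖z - (P z + ρ z • y + t • (z - (P z + ρ z • y)))‖ ≤ d * s * ρ z := by
        have : z - (P z + ρ z • y + t • (z - (P z + ρ z • y))) = s • (z - (P z + ρ z • y)) := by
          rw [hs, sub_smul, one_smul]; abel
        rw [this, norm_smul, Real.norm_of_nonneg hs0.le]
        nlinarith [h3 z hz y hy]
      rw [← hb]
      generalize P z + ρ z • y + t • (z - (P z + ρ z • y)) = q at *
      simp only [hH]
      rw [Set.indicator_of_mem a1, mul_left_comm, mul_comm (F q)]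
      gcongr
      rw [← ENNReal.ofReal_mul (by positivity)]
      apply ENNReal.ofReal_le_ofReal
      have hr : 0 < ρ q := lt_of_lt_of_le (by positivity) a2
      have hA : ρ q + ‖z - q‖ / (d * s) ≤ 2 * ρ z := by
        have : ‖z - q‖ / (d * s) ≤ ρ z := by
          rw [div_le_iff₀ (by positivity)]; linarith
        linarith
      have hA0 : 0 < ρ q + ‖z - q‖ / (d * s) := by positivity
      generalize ρ q + ‖z - q‖ / (d * s) = A at *
      rw [← mul_assoc, ← div_eq_mul_inv, le_div_iff₀ (by positivity)]
      calc t * A ^ (n + 1) ≤ t * (2 * ρ z) ^ (n + 1) := by gcongr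
        _ = 2 ^ (n + 1) * ρ z ^ n * (t * ρ z) := by ring
        _ ≤ _ := by gcongr
    calc _ ≤ ∫⁻ y in T, ENNReal.ofReal (2 ^ (n + 1) * ρ z ^ n) *
              H z ((P z + t • (z - P z)) + (s * ρ z) • y) := setLIntegral_mono' hTm hpt
      _ ≤ ∫⁻ y, ENNReal.ofReal (2 ^ (n + 1) * ρ z ^ n) *
              H z ((P z + t • (z - P z)) + (s * ρ z) • y) := setLIntegral_le_lintegral _ _
      _ = _ := by
        rw [lintegral_const_mul' _ _ ENNReal.ofReal_ne_top,
          adc_smul_change (H z) _ _ (by positivity), ← mul_assoc,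
          ← ENNReal.ofReal_mul (by positivity)]
        congr 2
        field_simp
        rw [mul_pow, mul_comm]
  calc _ ≤ ∫⁻ z in T ∩ {z | 0 < ρ z}, ENNReal.ofReal (2 ^ (n + 1) * (s ^ n)⁻¹) * ∫⁻ q, H z q :=
        setLIntegral_mono' hS key
    _ ≤ ∫⁻ z, ENNReal.ofReal (2 ^ (n + 1) * (s ^ n)⁻¹) * ∫⁻ q, H z q :=
        setLIntegral_le_lintegral _ _
    _ = ENNReal.ofReal (2 ^ (n + 1) * (s ^ n)⁻¹) * ∫⁻ q, ∫⁻ z, H z q := by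
        rw [lintegral_const_mul' _ _ ENNReal.ofReal_ne_top,
          lintegral_lintegral_swap hHm.aemeasurable]
    _ ≤ ENNReal.ofReal (2 ^ (n + 1) * (s ^ n)⁻¹) *
          ∫⁻ q, T.indicator F q * (ENNReal.ofReal ((d * s) ^ n) * I) := by
        gcongr with q
        simp only [hH]
        by_cases hq : q ∈ T
        · rw [lintegral_const_mul _ (by fun_prop)]
          gcongr
          exact adc_kernel _ _ (hρ0 q hq) (by positivity) q
        · simp [Set.indicator_of_notMem hq]
    _ = _ := by
        rw [lintegral_mul_const _ (hF.indicator hTm), lintegral_indicator hTm,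
          mul_comm (∫⁻ z in T, F z), ← mul_assoc, ← mul_assoc, ← ENNReal.ofReal_mul (by positivity)]
        congr 3
        field_simp
        rw [mul_pow, mul_comm]

theorem adc_line {n : ℕ} (v : (Fin n → ℝ) → ℝ) (hv : ContDiff ℝ 1 v) (z g : Fin n → ℝ) (K : ℝ)
    (hK : ‖z - g‖ ≤ K) :
    (v z - v g) ^ 2 ≤ ∫ τ in Set.Ioc (0:ℝ) 1,
      4 * K ^ 2 * (τ ^ 2 * ‖fderiv ℝ v (g + τ ^ 2 • (z - g))‖ ^ 2) := by
  have hK0 : 0 ≤ K := (norm_nonneg _).trans hK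
  have hc : Continuous (fderiv ℝ v) := hv.continuous_fderiv (by norm_num)
  have hder : ∀ τ : ℝ, HasDerivAt (fun τ : ℝ => v (g + τ ^ 2 • (z - g)))
      (fderiv ℝ v (g + τ ^ 2 • (z - g)) ((2 * τ) • (z - g))) τ := by
    intro τ
    have h1 : HasFDerivAt v (fderiv ℝ v (g + τ ^ 2 • (z - g))) (g + τ ^ 2 • (z - g)) :=
      ((hv.differentiable (by norm_num)) _).hasFDerivAt
    have h2 : HasDerivAt (fun τ : ℝ => g + τ ^ 2 • (z - g)) ((2 * τ) • (z - g)) τ := by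
      have := ((hasDerivAt_pow 2 τ).smul_const (z - g)).const_add g
      simpa using this
    exact h1.comp_hasDerivAt τ h2
  have hcont : Continuous (fun τ : ℝ => fderiv ℝ v (g + τ ^ 2 • (z - g)) ((2 * τ) • (z - g))) := by
    fun_prop
  have hftc := intervalIntegral.integral_eq_sub_of_hasDerivAt (a := 0) (b := 1)
    (fun τ _ => hder τ) (hcont.intervalIntegrable _ _)
  have e : v z - v g = ∫ τ in Set.Ioc (0:ℝ) 1,
      fderiv ℝ v (g + τ ^ 2 • (z - g)) ((2 * τ) • (z - g)) := by
    rw [← intervalIntegral.integral_of_le zero_le_one, hftc]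
    simp
  have : IsProbabilityMeasure (volume.restrict (Set.Ioc (0:ℝ) 1)) := ⟨by simp⟩
  rw [e]
  refine (adc_jensen _ _ hcont.integrableOn_Ioc (hcont.pow 2).integrableOn_Ioc).trans ?_
  apply setIntegral_mono_on (hcont.pow 2).integrableOn_Ioc
    (Continuous.integrableOn_Ioc (by fun_prop)) measurableSet_Ioc
  intro τ hτ
  have := (fderiv ℝ v (g + τ ^ 2 • (z - g))).le_opNorm ((2 * τ) • (z - g))
  rw [norm_smul, Real.norm_of_nonneg (by linarith [hτ.1] : (0:ℝ) ≤ 2 * τ)] at this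
  have h0 := hτ.1
  change (fderiv ℝ v (g + τ ^ 2 • (z - g)) ((2 * τ) • (z - g))) ^ 2 ≤ _
  rw [← sq_abs, ← Real.norm_eq_abs]
  calc _ ≤ (‖fderiv ℝ v (g + τ ^ 2 • (z - g))‖ * (2 * τ * ‖z - g‖)) ^ 2 := by gcongr
    _ ≤ (‖fderiv ℝ v (g + τ ^ 2 • (z - g))‖ * (2 * τ * K)) ^ 2 := by gcongr
    _ = _ := by ring

theorem adc_L4 {n : ℕ} (T : Set (Fin n → ℝ)) (hT : IsCompact T) (hT0 : volume T ≠ 0)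
    (v : (Fin n → ℝ) → ℝ) (hv : ContDiff ℝ 1 v) (z p : Fin n → ℝ) (r d : ℝ) (hr : 0 < r)
    (h3 : ∀ y ∈ T, ‖z - (p + r • y)‖ ≤ d * r) :
    ENNReal.ofReal ((r ^ 2)⁻¹ * (v z - (volume T).toReal⁻¹ * ∫ y in T, v (p + r • y)) ^ 2) ≤
      ENNReal.ofReal ((volume T).toReal⁻¹ * (4 * d ^ 2)) * ∫⁻ y in T, ∫⁻ τ in Set.Ioc (0:ℝ) 1,
        ENNReal.ofReal (τ ^ 2) *
          ENNReal.ofReal (‖fderiv ℝ v (p + r • y + τ ^ 2 • (z - (p + r • y)))‖ ^ 2) := by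
  have hTm := hT.measurableSet
  have hTf : volume T ≠ ⊤ := hT.measure_lt_top.ne
  set V := (volume T).toReal with hV
  have hV0 : 0 < V := ENNReal.toReal_pos hT0 hTf
  have hvc := hv.continuous
  have hc : Continuous (fderiv ℝ v) := hv.continuous_fderiv (by norm_num)
  have hcg : Continuous (fun y => v z - v (p + r • y)) := by fun_prop
  have i1 : IntegrableOn (fun y => v z - v (p + r • y)) T := hcg.continuousOn.integrableOn_compact hT
  have i2 : IntegrableOn (fun y => (v z - v (p + r • y)) ^ 2) T :=
    (hcg.pow 2).continuousOn.integrableOn_compact hT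
  have i3 : IntegrableOn (fun y => v (p + r • y)) T :=
    (Continuous.continuousOn (by fun_prop)).integrableOn_compact hT
  have iconst : Integrable (fun _ : Fin n → ℝ => v z) (volume.restrict T) :=
    continuous_const.continuousOn.integrableOn_compact hT
  have hfac : (volume T)⁻¹ ≠ ⊤ := ENNReal.inv_ne_top.2 hT0
  have : IsProbabilityMeasure ((volume T)⁻¹ • volume.restrict T) := ⟨by
    simp [ENNReal.inv_mul_cancel hT0 hTf]⟩
  have J := adc_jensen ((volume T)⁻¹ • volume.restrict T) _ (Integrable.smul_measure i1 hfac)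
    (Integrable.smul_measure i2 hfac)
  rw [integral_smul_measure, integral_smul_measure, ENNReal.toReal_inv, smul_eq_mul, smul_eq_mul,
    integral_sub iconst i3] at J
  simp only [integral_const, smul_eq_mul, measureReal_def, Measure.restrict_apply_univ] at J
  rw [mul_sub, ← hV, inv_mul_cancel_left₀ hV0.ne'] at J
  calc _ ≤ ENNReal.ofReal ((r ^ 2)⁻¹ * (V⁻¹ * ∫ y in T, (v z - v (p + r • y)) ^ 2)) := by
        apply ENNReal.ofReal_le_ofReal
        gcongr
    _ = ENNReal.ofReal ((r ^ 2)⁻¹ * V⁻¹) * ∫⁻ y in T, ENNReal.ofReal ((v z - v (p + r • y)) ^ 2) := by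
        rw [← mul_assoc, ENNReal.ofReal_mul (by positivity),
          ofReal_integral_eq_lintegral_ofReal i2 (ae_of_all _ fun y => sq_nonneg _)]
    _ ≤ ENNReal.ofReal ((r ^ 2)⁻¹ * V⁻¹) * ∫⁻ y in T, ENNReal.ofReal (4 * (d * r) ^ 2) *
          ∫⁻ τ in Set.Ioc (0:ℝ) 1, ENNReal.ofReal (τ ^ 2) *
          ENNReal.ofReal (‖fderiv ℝ v (p + r • y + τ ^ 2 • (z - (p + r • y)))‖ ^ 2) := by
        refine mul_le_mul_right (setLIntegral_mono' hTm fun y hy => ?_) _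
        refine (ENNReal.ofReal_le_ofReal (adc_line v hv z _ _ (h3 y hy))).trans ?_
        rw [ofReal_integral_eq_lintegral_ofReal (Continuous.integrableOn_Ioc (by fun_prop))
          (ae_of_all _ fun τ => by positivity),
          ← lintegral_const_mul' _ _ ENNReal.ofReal_ne_top]
        apply le_of_eq
        congr 1
        ext τ
        rw [ENNReal.ofReal_mul (by positivity : (0:ℝ) ≤ 4 * (d * r) ^ 2),
          ENNReal.ofReal_mul (by positivity : (0:ℝ) ≤ τ ^ 2)]
    _ = _ := by
        rw [lintegral_const_mul' _ _ ENNReal.ofReal_ne_top, ← mul_assoc,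
          ← ENNReal.ofReal_mul (by positivity)]
        congr 2
        field_simp

theorem adc_core {n : ℕ} (T : Set (Fin n → ℝ)) (hT : IsCompact T) (ρ : (Fin n → ℝ) → ℝ)
    (hρc : Continuous ρ) (P : (Fin n → ℝ) → Fin n → ℝ) (hPc : Continuous P) (d : ℝ) (hd : 0 < d)
    (hρ0 : ∀ z ∈ T, 0 ≤ ρ z)
    (h2 : ∀ z ∈ T, ∀ y ∈ T, ∀ t : ℝ, 0 ≤ t → t ≤ 1 →
      P z + ρ z • y + t • (z - (P z + ρ z • y)) ∈ T ∧
      t * ρ z ≤ ρ (P z + ρ z • y + t • (z - (P z + ρ z • y))) ∧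
      ρ (P z + ρ z • y + t • (z - (P z + ρ z • y))) ≤ ρ z)
    (h3 : ∀ z ∈ T, ∀ y ∈ T, ‖z - (P z + ρ z • y)‖ ≤ d * ρ z) :
    ∃ c : ℝ, ∀ v : (Fin n → ℝ) → ℝ, ContDiff ℝ 1 v →
      ∫ z in T, ((ρ z) ^ 2)⁻¹ *
          (v z - (volume T).toReal⁻¹ * ∫ y in T, v (P z + ρ z • y)) ^ 2
        ≤ c * ∫ z in T, ‖fderiv ℝ v z‖ ^ 2 := by
  have hTm := hT.measurableSet
  by_cases hT0 : volume T = 0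
  · refine ⟨0, fun v _ => ?_⟩
    rw [Measure.restrict_eq_zero.2 hT0]
    simp
  set C : ENNReal := ENNReal.ofReal ((volume T).toReal⁻¹ * (4 * d ^ 2)) *
    (ENNReal.ofReal (2 ^ (n + 1) * d ^ n) *
        ∫⁻ z : Fin n → ℝ, ENNReal.ofReal (((1 + ‖z‖) ^ (n + 1))⁻¹)) with hC
  have hCf : C ≠ ⊤ := ENNReal.mul_ne_top ENNReal.ofReal_ne_top
    (ENNReal.mul_ne_top ENNReal.ofReal_ne_top (adc_I_fin n).ne)
  refine ⟨C.toReal, fun v hv => ?_⟩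
  have hc : Continuous (fderiv ℝ v) := hv.continuous_fderiv (by norm_num)
  set F : (Fin n → ℝ) → ENNReal := fun q => ENNReal.ofReal (‖fderiv ℝ v q‖ ^ 2) with hFdef
  have hFc : Continuous F := ENNReal.continuous_ofReal.comp (hc.norm.pow 2)
  set f : (Fin n → ℝ) → ℝ := fun z => ((ρ z) ^ 2)⁻¹ *
          (v z - (volume T).toReal⁻¹ * ∫ y in T, v (P z + ρ z • y)) ^ 2 with hf
  have hf0 : ∀ z, 0 ≤ f z := fun z => by positivity
  have iR : IntegrableOn (fun z => ‖fderiv ℝ v z‖ ^ 2) T :=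
    (Continuous.continuousOn (by fun_prop)).integrableOn_compact hT
  have hR0 : 0 ≤ ∫ z in T, ‖fderiv ℝ v z‖ ^ 2 := integral_nonneg fun z => by positivity
  by_cases hfi : IntegrableOn f T
  swap
  · rw [integral_undef hfi]
    positivity
  rw [← ENNReal.ofReal_le_ofReal_iff (by positivity), ENNReal.ofReal_mul (by positivity),
    ENNReal.ofReal_toReal hCf, ofReal_integral_eq_lintegral_ofReal hfi (ae_of_all _ hf0),
    ofReal_integral_eq_lintegral_ofReal iR (ae_of_all _ fun z => by positivity)]
  change _ ≤ C * ∫⁻ z in T, F z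
  have hS : MeasurableSet (T ∩ {z | 0 < ρ z}) :=
    hTm.inter (measurableSet_lt measurable_const hρc.measurable)
  have e1 : ∫⁻ z in T, ENNReal.ofReal (f z) ≤
      ∫⁻ z in T ∩ {z | 0 < ρ z}, ENNReal.ofReal (f z) := by
    rw [← lintegral_indicator hTm, ← lintegral_indicator hS]
    apply lintegral_mono
    intro z
    by_cases hz : z ∈ T
    · rcases (hρ0 z hz).eq_or_lt with h | h
      · simp [Set.indicator, hz, hf, ← h]
      · simp [Set.indicator, hz, h]
    · simp [Set.indicator, hz]
  refine e1.trans ?_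
  set Φ : (Fin n → ℝ) → (Fin n → ℝ) → ℝ → ENNReal := fun z y τ => ENNReal.ofReal (τ ^ 2) *
          F (P z + ρ z • y + τ ^ 2 • (z - (P z + ρ z • y))) with hΦ
  have hΦc : Measurable (fun w : (Fin n → ℝ) × (Fin n → ℝ) × ℝ => Φ w.1 w.2.1 w.2.2) := by
    have := hFc.measurable
    have := hρc.measurable
    have := hPc.measurable
    simp only [hΦ]
    fun_prop
  calc _ ≤ ∫⁻ z in T ∩ {z | 0 < ρ z}, ENNReal.ofReal ((volume T).toReal⁻¹ * (4 * d ^ 2)) *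
          ∫⁻ y in T, ∫⁻ τ in Set.Ioc (0:ℝ) 1, Φ z y τ :=
        setLIntegral_mono' hS fun z hz => adc_L4 T hT hT0 v hv z (P z) (ρ z) d hz.2 (h3 z hz.1)
    _ = ENNReal.ofReal ((volume T).toReal⁻¹ * (4 * d ^ 2)) * ∫⁻ z in T ∩ {z | 0 < ρ z},
          ∫⁻ y in T, ∫⁻ τ in Set.Ioc (0:ℝ) 1, Φ z y τ :=
        lintegral_const_mul' _ _ ENNReal.ofReal_ne_top
    _ = ENNReal.ofReal ((volume T).toReal⁻¹ * (4 * d ^ 2)) * ∫⁻ z in T ∩ {z | 0 < ρ z},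
          ∫⁻ τ in Set.Ioc (0:ℝ) 1, ∫⁻ y in T, Φ z y τ := by
        congr 2
        ext z
        rw [lintegral_lintegral_swap]
        exact (hΦc.comp (measurable_const.prodMk measurable_id : Measurable
          (fun w : (Fin n → ℝ) × ℝ => (z, w)))).aemeasurable
    _ = ENNReal.ofReal ((volume T).toReal⁻¹ * (4 * d ^ 2)) * ∫⁻ τ in Set.Ioc (0:ℝ) 1,
          ∫⁻ z in T ∩ {z | 0 < ρ z}, ∫⁻ y in T, Φ z y τ := by
        congr 1
        rw [lintegral_lintegral_swap]
        refine Measurable.aemeasurable ?_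
        have : Measurable (fun w : ((Fin n → ℝ) × ℝ) × (Fin n → ℝ) => Φ w.1.1 w.2 w.1.2) :=
          hΦc.comp (by fun_prop : Measurable
            (fun w : ((Fin n → ℝ) × ℝ) × (Fin n → ℝ) => (w.1.1, w.2, w.1.2)))
        exact this.lintegral_prod_right'
    _ = ENNReal.ofReal ((volume T).toReal⁻¹ * (4 * d ^ 2)) * ∫⁻ τ in Set.Ioo (0:ℝ) 1,
          ∫⁻ z in T ∩ {z | 0 < ρ z}, ∫⁻ y in T, Φ z y τ := by
        rw [setLIntegral_congr Ioo_ae_eq_Ioc]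
    _ ≤ ENNReal.ofReal ((volume T).toReal⁻¹ * (4 * d ^ 2)) * ∫⁻ τ in Set.Ioo (0:ℝ) 1,
          (ENNReal.ofReal (2 ^ (n + 1) * d ^ n) *
          ∫⁻ z : Fin n → ℝ, ENNReal.ofReal (((1 + ‖z‖) ^ (n + 1))⁻¹)) * ∫⁻ z in T, F z := by
        refine mul_le_mul_right (setLIntegral_mono' measurableSet_Ioo fun τ hτ => ?_) _
        exact adc_L3 T hTm ρ hρc P d hd hρ0 h2 h3 F hFc.measurable (τ ^ 2) (pow_pos hτ.1 2)
          (by nlinarith [hτ.1, hτ.2])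
    _ = _ := by
        rw [setLIntegral_const]
        simp [hC, mul_assoc]

theorem adc_aff {n k : ℕ} (g : (Fin n → ℝ) →ᵃ[ℝ] ℝ) (a : Fin k → ℝ) (u : Fin k → Fin n → ℝ)
    (ha : ∑ i, a i = 1) : g (∑ i, a i • u i) = ∑ i, a i * g (u i) := by
  have h : ∀ w, g w = g.linear w + g 0 := fun w => by
    have := g.map_vadd 0 w
    simpa using this
  rw [h, map_sum]
  simp_rw [h (u _), mul_add, sum_add_distrib, ← sum_mul, ha, map_smul, smul_eq_mul]
  ring

theorem adc_sum_split {M : Type*} [AddCommMonoid M] (n m : ℕ) (h : m + 1 ≤ n + 1)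
    (f : Fin (n + 1) → M) :
    ∑ j : Fin (m + 1), f (Fin.castLE h j) = ∑ i : Fin (n + 1), if (i : ℕ) ≤ m then f i else 0 := by
  rw [← sum_filter]
  refine sum_bij (fun j _ => Fin.castLE h j) ?_ ?_ ?_ ?_
  · intro j _
    simp
    omega
  · intro a _ b _ hab
    exact Fin.castLE_injective h hab
  · intro b hb
    simp at hb
    exact ⟨⟨b, by omega⟩, by simp, by ext; simp⟩
  · intros; rfl

/-- The trace-preservation/decay estimate for the averaging operator
(Lemma `decay-create`, single element version): on the simplex `T = conv{x_0,…,x_n}`,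
with `λ_f(z) = (λ_0(z),…,λ_m(z))` the first `m+1` barycentric coordinates and
`ρ_f = 1 − Σ_{j≤m} λ_j`,
`∫_T ρ_f⁻² |v − ⨍_T v(G_m(λ_f(·),y)) dy|² ≤ c ∫_T ‖Dv‖²`. -/
theorem average_decay_create (n m : ℕ) (hmn : m < n)
    (x : Fin (n + 1) → Fin n → ℝ) (hx : AffineIndependent ℝ x)
    (lam : Fin (n + 1) → ((Fin n → ℝ) →ᵃ[ℝ] ℝ))
    (hlam_sum : ∀ z : Fin n → ℝ, ∑ i, lam i z = 1)
    (hlam_basis : ∀ i j, lam i (x j) = if i = j then 1 else 0) :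
    ∃ c : ℝ, ∀ v : (Fin n → ℝ) → ℝ, ContDiff ℝ 1 v →
      ∫ z in convexHull ℝ (Set.range x),
          ((1 - ∑ j : Fin (m + 1), lam (Fin.castLE (by omega) j) z) ^ 2)⁻¹ *
            (v z - Avg n m (fun j : Fin (m + 1) => x (Fin.castLE (by omega) j))
              (convexHull ℝ (Set.range x)) v
              (fun i : Fin (m + 1) => lam (Fin.castLE (by omega) i) z)) ^ 2
        ≤ c * ∫ z in convexHull ℝ (Set.range x), ‖fderiv ℝ v z‖ ^ 2 := by
  have hle : m + 1 ≤ n + 1 := by omega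
  set T := convexHull ℝ (Set.range x) with hTdef
  have hTc : IsCompact T := (Set.finite_range x).isCompact_convexHull ℝ
  have hTconv : Convex ℝ T := convex_convexHull ℝ _
  have hxT : ∀ i, x i ∈ T := fun i => subset_convexHull ℝ _ ⟨i, rfl⟩
  have hlamc : ∀ i, Continuous (lam i) := fun i => (lam i).continuous_of_finiteDimensional
  have hT1 : ∀ z ∈ T, (∀ i, 0 ≤ lam i z) ∧ z = ∑ i, lam i z • x i := by
    have : T ⊆ {z | (∀ i, 0 ≤ lam i z) ∧ z = ∑ i, lam i z • x i} := by
      apply convexHull_min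
      · rintro _ ⟨j, rfl⟩
        refine ⟨fun i => ?_, ?_⟩
        · rw [hlam_basis]; split_ifs <;> norm_num
        · simp [hlam_basis]
      · intro z hz y hy a b ha hb hab
        have e : ∀ i, lam i (a • z + b • y) = a * lam i z + b * lam i y := fun i => by
          rw [Convex.combo_affine_apply hab]; simp
        refine ⟨fun i => ?_, ?_⟩
        · rw [e]
          have := hz.1 i
          have := hy.1 i
          positivity
        · simp_rw [e, add_smul, sum_add_distrib, mul_smul, ← smul_sum]
          rw [← hz.2, ← hy.2]
    exact fun z hz => this hz
  set ρ : (Fin n → ℝ) → ℝ := fun z => 1 - ∑ j : Fin (m + 1), lam (Fin.castLE hle j) z with hρ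
  set P : (Fin n → ℝ) → Fin n → ℝ := fun z =>
    ∑ j : Fin (m + 1), lam (Fin.castLE hle j) z • x (Fin.castLE hle j) with hP
  have hρc : Continuous ρ := by
    simp only [hρ]; fun_prop
  have hPc : Continuous P := by
    simp only [hP]; fun_prop
  have hρe : ∀ z, ρ z = ∑ i : Fin (n + 1), if (i : ℕ) ≤ m then 0 else lam i z := by
    intro z
    simp only [hρ]
    rw [adc_sum_split n m hle (fun i => lam i z), ← hlam_sum z, ← sum_sub_distrib]
    refine sum_congr rfl fun i _ => ?_
    split_ifs <;> simp
  have hρ0 : ∀ z ∈ T, 0 ≤ ρ z := by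
    intro z hz
    rw [hρe]
    refine sum_nonneg fun i _ => ?_
    split_ifs
    · exact le_rfl
    · exact (hT1 z hz).1 i
  have hρ1 : ∀ z ∈ T, ρ z ≤ 1 := by
    intro z hz
    have : 0 ≤ ∑ j : Fin (m + 1), lam (Fin.castLE hle j) z := sum_nonneg fun j _ => (hT1 z hz).1 _
    simp only [hρ]
    linarith
  have hG : ∀ z y, P z + ρ z • y = ∑ i : Fin (n + 1), lam i z • (if (i : ℕ) ≤ m then x i else y) := by
    intro z y
    rw [hρe, sum_smul]
    simp only [hP]
    rw [adc_sum_split n m hle (fun i => lam i z • x i), ← sum_add_distrib]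
    refine sum_congr rfl fun i _ => ?_
    split_ifs <;> simp
  have hGT : ∀ z ∈ T, ∀ y ∈ T, P z + ρ z • y ∈ T := by
    intro z hz y hy
    rw [hG]
    refine hTconv.sum_mem (fun i _ => (hT1 z hz).1 i) (hlam_sum z) fun i _ => ?_
    split_ifs
    · exact hxT i
    · exact hy
  have hρG : ∀ z y, ρ (P z + ρ z • y) = ρ z * ρ y := by
    intro z y
    rw [hρe (P z + ρ z • y), hρe y, mul_sum]
    refine sum_congr rfl fun i _ => ?_
    split_ifs with hi
    · simp
    · rw [hG, adc_aff _ _ _ (hlam_sum z), hρe z, sum_mul]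
      refine sum_congr rfl fun k _ => ?_
      split_ifs with hk
      · rw [hlam_basis, if_neg (by rintro rfl; exact hi hk)]
        simp
      · rfl
  have hρaff : ∀ g z t, ρ (g + t • (z - g)) = (1 - t) * ρ g + t * ρ z := by
    intro g z t
    have e : ∀ i, lam i (g + t • (z - g)) = (1 - t) * lam i g + t * lam i z := fun i => by
      have : g + t • (z - g) = (1 - t) • g + t • z := by
        rw [smul_sub, sub_smul, one_smul]; abel
      rw [this, Convex.combo_affine_apply (by ring)]; simp
    simp only [hρ, e, sum_add_distrib, ← mul_sum]
    ring
  obtain ⟨D, hD⟩ := Metric.isBounded_iff.1 hTc.isBounded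
  have hcore := adc_core T hTc ρ hρc P hPc (|D| + 1) (by positivity) hρ0 ?_ ?_
  · obtain ⟨c, hc⟩ := hcore
    exact ⟨c, fun v hv => hc v hv⟩
  · intro z hz y hy t ht0 ht1
    have h1 := hρ0 z hz
    have h2 := hρ0 y hy
    have h3 := hρ1 y hy
    refine ⟨hTconv.add_smul_sub_mem (hGT z hz y hy) hz ⟨ht0, ht1⟩, ?_, ?_⟩
    · rw [hρaff, hρG]
      have : 0 ≤ (1 - t) * (ρ z * ρ y) := mul_nonneg (by linarith) (by positivity)
      linarith
    · rw [hρaff, hρG]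
      have : 0 ≤ (1 - t) * (ρ z * (1 - ρ y)) :=
        mul_nonneg (by linarith) (mul_nonneg h1 (by linarith))
      nlinarith
  · intro z hz y hy
    have e : z - (P z + ρ z • y) =
        ∑ i : Fin (n + 1), if (i : ℕ) ≤ m then 0 else lam i z • (x i - y) := by
      rw [hG]
      trans (∑ i, lam i z • x i) - ∑ i : Fin (n + 1), lam i z • (if (i : ℕ) ≤ m then x i else y)
      · rw [← (hT1 z hz).2]
      rw [← sum_sub_distrib]
      refine sum_congr rfl fun i _ => ?_
      split_ifs
      · simp
      · rw [smul_sub]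
    rw [e, hρe, mul_sum]
    refine (norm_sum_le _ _).trans (sum_le_sum fun i _ => ?_)
    split_ifs
    · simp
    · rw [norm_smul, Real.norm_of_nonneg ((hT1 z hz).1 i), mul_comm]
      have := hD (hxT i) hy
      rw [dist_eq_norm] at this
      have h0 := (hT1 z hz).1 i
      gcongr
      linarith [le_abs_self D]
end

section
/- Let 0 ≤ j < n be integers, let x_0,…,x_n ∈ ℝ^n be affinely independent with T = conv{x_0,…,x_n}, let λ_0(x),…,λ_n(x) be the barycentric coordinates of x with respect to x_0,…,x_n, and set λ_g(x) = (λ_0(x),…,λ_j(x)) and ρ_g(x) = 1 − Σ_{i=0}^j λ_i(x), where g = conv{x_0,…,x_j}. Then there exists a constant c, depending only on T and j, such that for every continuously differentiable function v : ℝ^n → ℝ with ∫_T ρ_g(x)^{−2} |v(x)|² dx < ∞: ∫_T ρ_g(x)^{−2} | ⨍_T v(G_j(λ_g(x), y)) dy |² dx ≤ c [ ∫_T ρ_g(x)^{−2} |v(x)|² dx + ∫_T ‖Dv(x)‖² dx ]. (This says the averaging operator preserves decay toward the face g.) -/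
open Finset MeasureTheory

lemma scale_aux (q : ℕ) (ρ : ℝ) (g : (Fin q → ℝ) → ENNReal) (hg : Measurable g) :
    ENNReal.ofReal ρ ^ q * ∫⁻ r, g (ρ • r) ≤ ∫⁻ r, g r := by
  rcases Nat.eq_zero_or_pos q with hq | hq
  · subst hq
    have : ∀ r : Fin 0 → ℝ, ρ • r = r := fun r => Subsingleton.elim _ _
    simp [this]
  rcases le_or_gt ρ 0 with h | h
  · rw [ENNReal.ofReal_of_nonpos h, zero_pow hq.ne', zero_mul]; exact zero_le
  have h1 : ∫⁻ r, g (ρ • r) = ∫⁻ r, g r ∂(Measure.map (ρ • ·) (volume : Measure (Fin q → ℝ))) :=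
    (lintegral_map hg (by fun_prop)).symm
  rw [h1, Measure.map_addHaar_smul _ h.ne', lintegral_smul_measure, smul_eq_mul, ← mul_assoc,
    Module.finrank_fin_fun, ← ENNReal.ofReal_pow h.le, ← ENNReal.ofReal_mul (by positivity),
    abs_of_pos (by positivity), mul_inv_cancel₀ (by positivity)]
  simp

lemma shear_aux (p : ℕ) (s : Fin p → ℝ) (F : (Fin p → ℝ) → ENNReal) (hF : Measurable F) :
    ENNReal.ofReal (1 - ∑ i, s i) * ∫⁻ l : Fin p → ℝ, F (l + (1 - ∑ i, l i) • s) ≤ ∫⁻ l, F l := by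
  rcases le_or_gt (1 - ∑ i, s i) 0 with h | h
  · rw [ENNReal.ofReal_of_nonpos h, zero_mul]; exact zero_le
  let φ : Module.Dual ℝ (Fin p → ℝ) := ∑ i, LinearMap.proj i
  have hφ : ∀ l, φ l = ∑ i, l i := fun l => by simp [φ]
  let A := LinearMap.transvection φ (-s)
  have hA : LinearMap.det A = 1 - ∑ i, s i := by
    simp [A, LinearMap.transvection.det, hφ, sub_eq_add_neg]
  have h0 : ∀ l : Fin p → ℝ, l + (1 - ∑ i, l i) • s = A l + s := by
    intro l
    simp only [A, LinearMap.transvection.apply, hφ]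
    module
  have h1 : ∫⁻ l, F (A l + s) = ∫⁻ r, F (r + s) ∂(Measure.map A (volume : Measure (Fin p → ℝ))) :=
    (lintegral_map (f := fun r => F (r + s)) (hF.comp (measurable_id.add_const s)) A.continuous_of_finiteDimensional.measurable).symm
  simp_rw [h0]
  rw [h1, Measure.map_linearMap_addHaar_eq_smul_addHaar _ (by rw [hA]; exact h.ne'),
    lintegral_smul_measure, smul_eq_mul, ← mul_assoc, hA, ← ENNReal.ofReal_mul h.le,
    abs_of_pos (by positivity), mul_inv_cancel₀ h.ne', lintegral_add_right_eq_self]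
  simp

def stdT (p q : ℕ) : Set ((Fin p → ℝ) × (Fin q → ℝ)) :=
  {u | (∀ i, 0 ≤ u.1 i) ∧ (∀ i, 0 ≤ u.2 i) ∧ ∑ i, u.1 i + ∑ i, u.2 i ≤ 1}

lemma stdT_meas (p q : ℕ) : MeasurableSet (stdT p q) := by
  unfold stdT
  measurability

lemma coord_aux (p q : ℕ) (f : (Fin p → ℝ) × (Fin q → ℝ) → ENNReal) (hf : Measurable f) :
    ∫⁻ u in stdT p q, ∫⁻ w in stdT p q, ENNReal.ofReal (1 - ∑ i, w.1 i) *
      f (u.1 + (1 - ∑ i, u.1 i) • w.1, (1 - ∑ i, u.1 i) • w.2) ≤ ∫⁻ u, f u := by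
  set F : (Fin p → ℝ) → ENNReal := fun a => ∫⁻ r, f (a, r) with hFdef
  have hF : Measurable F := hf.lintegral_prod_right'
  have hle : ∀ u ∈ stdT p q, ∀ i, u.2 i ≤ 1 - ∑ i, u.1 i := by
    rintro u ⟨h1, h2, h3⟩ i
    have := Finset.single_le_sum (f := u.2) (fun i _ => h2 i) (Finset.mem_univ i)
    linarith
  have hle1 : ∀ u ∈ stdT p q, u.1 ∈ Set.Icc (0 : Fin p → ℝ) 1 := by
    rintro u ⟨h1, h2, h3⟩
    refine ⟨h1, fun i => ?_⟩
    have := Finset.single_le_sum (f := u.1) (fun i _ => h1 i) (Finset.mem_univ i)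
    have := Finset.sum_nonneg (f := u.2) (s := Finset.univ) (fun i _ => h2 i)
    simp only [Pi.one_apply]
    linarith
  set I : Set (Fin p → ℝ) := Set.Icc 0 1 with hI
  have hIm : MeasurableSet I := measurableSet_Icc
  set k : (Fin p → ℝ) → (Fin p → ℝ) × (Fin q → ℝ) → ENNReal := fun l w =>
    ENNReal.ofReal (1 - ∑ i, w.1 i) * f (l + (1 - ∑ i, l i) • w.1, (1 - ∑ i, l i) • w.2) with hk
  have hkm : Measurable (Function.uncurry k) := by
    simp only [hk, Function.uncurry_def]
    refine Measurable.mul (by fun_prop) (hf.comp (by fun_prop))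
  have hkm1 : ∀ l, Measurable (k l) := fun l => hkm.of_uncurry_left
  set H : (Fin p → ℝ) → ENNReal := fun l => ∫⁻ w in stdT p q, k l w with hH
  have hHm : Measurable H := by
    exact Measurable.lintegral_prod_right' (f := Function.uncurry k) hkm
  -- bound of H
  have hHb : ∀ l, ENNReal.ofReal (1 - ∑ i, l i) ^ q * H l ≤
      ∫⁻ s in I, ENNReal.ofReal (1 - ∑ i, s i) * F (l + (1 - ∑ i, l i) • s) := by
    intro l
    have e1 : H l ≤ ∫⁻ s in I, ∫⁻ r, k l (s, r) := by
      have : stdT p q ⊆ I ×ˢ Set.univ := fun u hu => ⟨hle1 u hu, trivial⟩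
      refine (lintegral_mono_set this).trans ?_
      rw [Measure.volume_eq_prod, setLIntegral_prod _ (hkm1 l).aemeasurable]
      simp
    refine (mul_le_mul_right e1 _).trans ?_
    rw [← lintegral_const_mul _ (hkm1 l).lintegral_prod_right']
    refine lintegral_mono fun s => ?_
    simp only [hk]
    rw [lintegral_const_mul' _ _ ENNReal.ofReal_ne_top, mul_left_comm]
    gcongr
    exact scale_aux q _ (fun r => f (l + (1 - ∑ i, l i) • s, r)) (hf.comp (by fun_prop))
  calc ∫⁻ u in stdT p q, H u.1
      = ∫⁻ u, (stdT p q).indicator (fun u => H u.1) u := (lintegral_indicator (stdT_meas p q) _).symm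
    _ = ∫⁻ l, ∫⁻ r, (stdT p q).indicator (fun u => H u.1) (l, r) := by
        rw [Measure.volume_eq_prod, lintegral_prod]
        exact ((hHm.comp measurable_fst).indicator (stdT_meas p q)).aemeasurable
    _ ≤ ∫⁻ l, ENNReal.ofReal (1 - ∑ i, l i) ^ q * H l := by
        refine lintegral_mono fun l => ?_
        have : ∀ r, (stdT p q).indicator (fun u => H u.1) (l, r) ≤
            (Set.Icc (0 : Fin q → ℝ) (fun _ => 1 - ∑ i, l i)).indicator (fun _ => H l) r := by
          intro r
          by_cases h : (l, r) ∈ stdT p q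
          · rw [Set.indicator_of_mem h, Set.indicator_of_mem]
            exact ⟨h.2.1, hle _ h⟩
          · rw [Set.indicator_of_notMem h]; exact zero_le
        refine (lintegral_mono this).trans ?_
        rw [lintegral_indicator measurableSet_Icc, setLIntegral_const, Real.volume_Icc_pi, mul_comm]
        simp
    _ ≤ ∫⁻ l, ∫⁻ s in I, ENNReal.ofReal (1 - ∑ i, s i) * F (l + (1 - ∑ i, l i) • s) :=
        lintegral_mono hHb
    _ = ∫⁻ s in I, ∫⁻ l, ENNReal.ofReal (1 - ∑ i, s i) * F (l + (1 - ∑ i, l i) • s) := by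
        rw [lintegral_lintegral_swap]
        refine Measurable.aemeasurable ?_
        simp only [Function.uncurry_def]
        exact Measurable.mul (by fun_prop) (hF.comp (by fun_prop))
    _ ≤ ∫⁻ s in I, ∫⁻ l, F l := by
        refine lintegral_mono fun s => ?_
        simp only
        rw [lintegral_const_mul' _ _ ENNReal.ofReal_ne_top]
        exact shear_aux p s F hF
    _ = ∫⁻ u, f u := by
        rw [setLIntegral_const, hI, Real.volume_Icc_pi, Measure.volume_eq_prod,
          lintegral_prod _ hf.aemeasurable]
        simp [hFdef]

lemma transfer_aux (n p q : ℕ) (hn : n = p + q)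
    (Φ : (Fin n → ℝ) →ᵃ[ℝ] ((Fin p → ℝ) × (Fin q → ℝ))) (hΦ : Function.Injective Φ)
    (G : (Fin n → ℝ) → (Fin n → ℝ) → (Fin n → ℝ))
    (hG : ∀ z y, Φ (G z y) = ((Φ z).1 + (1 - ∑ i, (Φ z).1 i) • (Φ y).1,
      (1 - ∑ i, (Φ z).1 i) • (Φ y).2)) :
    ∃ C : NNReal, ∀ f : (Fin n → ℝ) → ENNReal, Measurable f →
      ∫⁻ z in Φ ⁻¹' stdT p q, ∫⁻ y in Φ ⁻¹' stdT p q,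
        ENNReal.ofReal (1 - ∑ i, (Φ y).1 i) * f (G z y) ≤ C * ∫⁻ z, f z := by
  have hfin : Module.finrank ℝ (Fin n → ℝ) = Module.finrank ℝ ((Fin p → ℝ) × (Fin q → ℝ)) := by
    simp [hn]
  let L := (LinearMap.linearEquivOfInjective Φ.linear (Φ.linear_injective_iff.2 hΦ)
    hfin).toContinuousLinearEquiv
  have hL : ∀ z, Φ z = L z + Φ 0 := fun z => by
    have := congrFun Φ.decomp z
    simp only [Pi.add_apply] at this
    exact this
  have hΦm : Measurable Φ := Φ.continuous_of_finiteDimensional.measurable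
  have hHaar : (volume : Measure ((Fin p → ℝ) × (Fin q → ℝ))).IsAddHaarMeasure := by
    exact Measure.prod.instIsAddHaarMeasure volume volume
  have hHaarL := L.isAddHaarMeasure_map (volume : Measure (Fin n → ℝ))
  let C : NNReal := (Measure.map L (volume : Measure (Fin n → ℝ))).addHaarScalarFactor
    (volume : Measure ((Fin p → ℝ) × (Fin q → ℝ)))
  have hmapL : Measure.map L (volume : Measure (Fin n → ℝ)) = C • volume := by
    exact Measure.isAddLeftInvariant_eq_smul _ _
  have hmap : Measure.map Φ (volume : Measure (Fin n → ℝ)) = C • volume := by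
    have e : (Φ : (Fin n → ℝ) → _) = (fun u => u + Φ 0) ∘ L := funext hL
    rw [e, ← Measure.map_map (g := fun u => u + Φ 0) (measurable_id.add_const _) L.continuous.measurable, hmapL,
      Measure.map_smul, map_add_right_eq_self]
  have hint : ∀ (S : Set ((Fin p → ℝ) × (Fin q → ℝ))), MeasurableSet S → ∀ h : (Fin p → ℝ) × (Fin q → ℝ) → ENNReal, Measurable h →
      ∫⁻ z in Φ ⁻¹' S, h (Φ z) = C * ∫⁻ u in S, h u := by
    intro S hS h hh
    rw [← setLIntegral_map hS hh hΦm, hmap, Measure.restrict_smul, lintegral_smul_measure]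
    rfl
  let Ψ : (Fin p → ℝ) × (Fin q → ℝ) → (Fin n → ℝ) := fun u => L.symm (u - Φ 0)
  have hΨm : Measurable Ψ := L.symm.continuous.measurable.comp (measurable_id.sub_const _)
  have hΨ : ∀ z, Ψ (Φ z) = z := fun z => by simp [Ψ, hL z]
  refine ⟨C, fun f hf => ?_⟩
  set h : (Fin p → ℝ) × (Fin q → ℝ) → ENNReal := f ∘ Ψ with hh
  have hhm : Measurable h := hf.comp hΨm
  have hfh : ∀ z, f z = h (Φ z) := fun z => by simp [hh, hΨ]
  set k : (Fin p → ℝ) × (Fin q → ℝ) → (Fin p → ℝ) × (Fin q → ℝ) → ENNReal := fun u w =>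
    ENNReal.ofReal (1 - ∑ i, w.1 i) *
      h (u.1 + (1 - ∑ i, u.1 i) • w.1, (1 - ∑ i, u.1 i) • w.2) with hk
  have hkm : Measurable (Function.uncurry k) := by
    simp only [hk, Function.uncurry_def]
    exact Measurable.mul (by fun_prop) (hhm.comp (by fun_prop))
  have hKm : Measurable (fun u => ∫⁻ w in stdT p q, k u w) :=
    Measurable.lintegral_prod_right' (f := Function.uncurry k) hkm
  have hT := stdT_meas p q
  have e2 : ∫⁻ z, f z = C * ∫⁻ u, h u := by
    have := hint Set.univ MeasurableSet.univ h hhm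
    simpa [hfh] using this
  calc ∫⁻ z in Φ ⁻¹' stdT p q, ∫⁻ y in Φ ⁻¹' stdT p q,
        ENNReal.ofReal (1 - ∑ i, (Φ y).1 i) * f (G z y)
      = ∫⁻ z in Φ ⁻¹' stdT p q, ∫⁻ y in Φ ⁻¹' stdT p q, k (Φ z) (Φ y) := by
        simp only [hfh, hG, hk]
    _ = ∫⁻ z in Φ ⁻¹' stdT p q, C * ∫⁻ w in stdT p q, k (Φ z) w := by
        refine lintegral_congr fun z => ?_
        exact hint _ hT (k (Φ z)) hkm.of_uncurry_left
    _ = C * (C * ∫⁻ u in stdT p q, ∫⁻ w in stdT p q, k u w) := by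
        rw [lintegral_const_mul' _ _ ENNReal.coe_ne_top, hint _ hT _ hKm]
    _ ≤ C * (C * ∫⁻ u, h u) := by
        refine mul_le_mul_right (mul_le_mul_right ?_ _) _
        exact coord_aux p q h hhm
    _ = C * ∫⁻ z, f z := by rw [e2]

lemma cs_aux {X : Type*} [MeasurableSpace X] (μ : Measure X) [IsFiniteMeasure μ] (g : X → ℝ)
    (hg : Integrable g μ) (hg2 : Integrable (fun x => g x ^ 2) μ) :
    (∫ x, g x ∂μ) ^ 2 ≤ μ.real Set.univ * ∫ x, g x ^ 2 ∂μ := by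
  set V := μ.real Set.univ with hV
  set M := ∫ x, g x ∂μ with hM
  rcases (measureReal_nonneg : 0 ≤ μ.real Set.univ).eq_or_lt with h | h
  · have : μ = 0 := by
      rw [← Measure.measure_univ_eq_zero]
      exact (measureReal_eq_zero_iff).1 h.symm
    simp [hM, hV, this]
  have h0 : 0 ≤ ∫ x, (V * g x - M) ^ 2 ∂μ := integral_nonneg fun x => sq_nonneg _
  have h1 : ∫ x, (V * g x - M) ^ 2 ∂μ = V ^ 2 * (∫ x, g x ^ 2 ∂μ) - 2 * V * M * M + V * M ^ 2 := by
    have : ∀ x, (V * g x - M) ^ 2 = V ^ 2 * g x ^ 2 - 2 * V * M * g x + M ^ 2 := fun x => by ring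
    simp_rw [this]
    rw [integral_add, integral_sub, integral_const_mul, integral_const_mul, integral_const]
    · rfl
    · exact hg2.const_mul _
    · exact hg.const_mul _
    · exact (hg2.const_mul _).sub (hg.const_mul _)
    · exact integrable_const _
  rw [h1] at h0
  have h2 : 0 ≤ V * (V * (∫ x, g x ^ 2 ∂μ) - M ^ 2) := by nlinarith
  have := nonneg_of_mul_nonneg_right h2 h
  linarith

/-- The averaging operator preserves decay toward the face `g = conv{x_0,…,x_j}`
(Lemma `decay-preserve`, single element version): writing `ρ_g = 1 − Σ_{i≤j} λ_i` (the
face dimension `j` of the statement is denoted `m` here), if `ρ_g⁻² v²` is integrable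
on `T`, then
`∫_T ρ_g⁻² |⨍_T v(G_j(λ_g(·),y)) dy|² ≤ c [∫_T ρ_g⁻² v² + ∫_T ‖Dv‖²]`. -/
theorem average_decay_preserve (n m : ℕ) (hmn : m < n)
    (x : Fin (n + 1) → Fin n → ℝ) (hx : AffineIndependent ℝ x)
    (lam : Fin (n + 1) → ((Fin n → ℝ) →ᵃ[ℝ] ℝ))
    (hlam_sum : ∀ z : Fin n → ℝ, ∑ i, lam i z = 1)
    (hlam_basis : ∀ i j, lam i (x j) = if i = j then 1 else 0) :
    ∃ c : ℝ, ∀ v : (Fin n → ℝ) → ℝ, ContDiff ℝ 1 v →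
      IntegrableOn (fun z : Fin n → ℝ =>
          ((1 - ∑ j : Fin (m + 1), lam (Fin.castLE (by omega) j) z) ^ 2)⁻¹ * (v z) ^ 2)
        (convexHull ℝ (Set.range x)) volume →
      ∫ z in convexHull ℝ (Set.range x),
          ((1 - ∑ j : Fin (m + 1), lam (Fin.castLE (by omega) j) z) ^ 2)⁻¹ *
            (Avg n m (fun j : Fin (m + 1) => x (Fin.castLE (by omega) j))
              (convexHull ℝ (Set.range x)) v
              (fun i : Fin (m + 1) => lam (Fin.castLE (by omega) i) z)) ^ 2
        ≤ c * ((∫ z in convexHull ℝ (Set.range x),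
              ((1 - ∑ j : Fin (m + 1), lam (Fin.castLE (by omega) j) z) ^ 2)⁻¹ *
                (v z) ^ 2) +
            ∫ z in convexHull ℝ (Set.range x), ‖fderiv ℝ v z‖ ^ 2) := by
  obtain ⟨q, rfl⟩ : ∃ q, n = m + 1 + q := ⟨n - (m + 1), by omega⟩
  set T := convexHull ℝ (Set.range x) with hTdef
  have hcast : ∀ i : Fin (m + 1), (Fin.castLE (by omega) i : Fin (m + 1 + q + 1)) =
      Fin.castSucc (Fin.castAdd q i) := fun i => rfl
  -- affine coordinates
  let Φ : (Fin (m + 1 + q) → ℝ) →ᵃ[ℝ] ((Fin (m + 1) → ℝ) × (Fin q → ℝ)) :=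
    (AffineMap.pi (fun i : Fin (m + 1) => lam (Fin.castLE (by omega) i))).prod
      (AffineMap.pi (fun k : Fin q => lam (Fin.castSucc (Fin.natAdd (m + 1) k))))
  have hΦ1 : ∀ z i, (Φ z).1 i = lam (Fin.castLE (by omega) i) z := fun z i => rfl
  have hΦ2 : ∀ z k, (Φ z).2 k = lam (Fin.castSucc (Fin.natAdd (m + 1) k)) z := fun z k => rfl
  have hsum : ∀ z, ∑ i, (Φ z).1 i + ∑ k, (Φ z).2 k + lam (Fin.last _) z = 1 := by
    intro z
    have := hlam_sum z
    rw [Fin.sum_univ_castSucc, Fin.sum_univ_add] at this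
    exact this
  have hspan : affineSpan ℝ (Set.range x) = ⊤ := by
    rw [hx.affineSpan_eq_top_iff_card_eq_finrank_add_one]
    simp
  let b : AffineBasis (Fin (m + 1 + q + 1)) ℝ (Fin (m + 1 + q) → ℝ) := ⟨x, hx, hspan⟩
  have hbx : ∀ i, b i = x i := fun i => rfl
  have haff : ∀ i z, lam i z = (lam i).linear z + lam i 0 := fun i z => congrFun (lam i).decomp z
  have hb : ∀ i z, lam i z = b.coord i z := by
    intro i z
    conv_lhs => rw [← b.affineCombination_coord_eq_self z]
    rw [Finset.map_affineCombination _ _ _ (b.sum_coord_apply_eq_one z),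
      Finset.affineCombination_eq_linear_combination _ _ _ (b.sum_coord_apply_eq_one z)]
    simp [hbx, hlam_basis]
  have hΦinj : Function.Injective Φ := by
    intro z w h
    refine b.ext_elem fun i => ?_
    rw [← hb, ← hb]
    have h1 : ∀ j, lam (Fin.castSucc j) z = lam (Fin.castSucc j) w := by
      intro j
      induction j using Fin.addCases with
      | left i => rw [← hcast, ← hΦ1, ← hΦ1, h]
      | right k => rw [← hΦ2, ← hΦ2, h]
    induction i using Fin.lastCases with
    | last =>
      have e1 := hsum z
      have e2 := hsum w
      rw [h] at e1
      linarith
    | cast j => exact h1 j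
  have hTΦ : T = Φ ⁻¹' stdT (m + 1) q := by
    have : T = {z | ∀ i, 0 ≤ b.coord i z} := b.convexHull_eq_nonneg_coord
    rw [this]
    ext z
    simp only [Set.mem_ofPred_eq, Set.mem_preimage, stdT, ← hb]
    have e := hsum z
    constructor
    · intro h
      refine ⟨fun i => h _, fun k => h _, ?_⟩
      have := h (Fin.last _)
      linarith
    · rintro ⟨h1, h2, h3⟩ i
      induction i using Fin.lastCases with
      | last => linarith
      | cast j =>
        induction j using Fin.addCases with
        | left i => exact h1 i
        | right k => exact h2 k
  set ρ : (Fin (m + 1 + q) → ℝ) → ℝ := fun z => 1 - ∑ i, (Φ z).1 i with hρ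
  let G : (Fin (m + 1 + q) → ℝ) → (Fin (m + 1 + q) → ℝ) → (Fin (m + 1 + q) → ℝ) := fun z y =>
    Gmap (m + 1 + q) m (fun j : Fin (m + 1) => x (Fin.castLE (by omega) j))
      (fun i : Fin (m + 1) => lam (Fin.castLE (by omega) i) z) y
  have hlamG : ∀ k z y, lam k (G z y) =
      ∑ j : Fin (m + 1), (Φ z).1 j * lam k (x (Fin.castLE (by omega) j)) + ρ z * lam k y := by
    intro k z y
    rw [haff k (G z y), haff k y]
    simp_rw [haff k (x _)]
    simp only [G, Gmap, bfun, map_add, map_sum, map_smul, smul_eq_mul, hρ, hΦ1, mul_add,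
      Finset.sum_add_distrib, ← Finset.sum_mul]
    ring
  have hG : ∀ z y, Φ (G z y) = ((Φ z).1 + (1 - ∑ i, (Φ z).1 i) • (Φ y).1,
      (1 - ∑ i, (Φ z).1 i) • (Φ y).2) := by
    intro z y
    refine Prod.ext (funext fun i => ?_) (funext fun k => ?_)
    · rw [hΦ1, hlamG]
      simp only [hlam_basis, Pi.add_apply, Pi.smul_apply, smul_eq_mul, hρ]
      congr 1
      rw [Finset.sum_eq_single i]
      · simp
      · intro j _ hj
        rw [if_neg, mul_zero]
        intro h
        exact hj (Fin.castLE_injective _ h).symm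
      · simp
    · rw [hΦ2, hlamG]
      simp only [hlam_basis, Pi.smul_apply, smul_eq_mul, hρ]
      rw [Finset.sum_eq_zero, zero_add]
      · rfl
      · intro j _
        rw [if_neg, mul_zero]
        intro h
        have := congrArg Fin.val h
        simp at this
        omega
  obtain ⟨C, hC⟩ := transfer_aux (m + 1 + q) (m + 1) q rfl Φ hΦinj G hG
  rw [← hTΦ] at hC
  have hρG : ∀ z y, ρ (G z y) = ρ z * ρ y := by
    intro z y
    simp only [hρ, hG, Pi.add_apply, Pi.smul_apply, smul_eq_mul, Finset.sum_add_distrib,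
      ← Finset.mul_sum]
    ring
  have hρT : ∀ z ∈ T, 0 ≤ ρ z ∧ ρ z ≤ 1 := by
    intro z hz
    rw [hTΦ] at hz
    obtain ⟨h1, h2, h3⟩ := hz
    have a1 := Finset.sum_nonneg (s := Finset.univ) (fun i _ => h1 i)
    have a2 := Finset.sum_nonneg (s := Finset.univ) (fun i _ => h2 i)
    constructor <;> simp only [hρ] <;> linarith
  have hGT : ∀ z ∈ T, ∀ y ∈ T, G z y ∈ T := by
    intro z hz y hy
    have hz0 := (hρT z hz).1
    rw [hTΦ] at hz hy ⊢
    obtain ⟨h1, h2, h3⟩ := hz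
    obtain ⟨k1, k2, k3⟩ := hy
    rw [Set.mem_preimage, hG]
    refine ⟨fun i => ?_, fun i => ?_, ?_⟩
    · exact add_nonneg (h1 i) (mul_nonneg hz0 (k1 i))
    · exact mul_nonneg hz0 (k2 i)
    · simp only [Pi.add_apply, Pi.smul_apply, smul_eq_mul, Finset.sum_add_distrib,
        ← Finset.mul_sum]
      have := mul_le_mul_of_nonneg_left k3 hz0
      simp only [hρ] at this
      linarith
  have hTc : IsCompact T := (Set.finite_range x).isCompact_convexHull ℝ
  have hTm : MeasurableSet T := hTc.isClosed.measurableSet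
  have hρc : Continuous ρ := by
    have : Continuous Φ := Φ.continuous_of_finiteDimensional
    simp only [hρ]
    fun_prop
  have hnull : ∀ᵐ y : Fin (m + 1 + q) → ℝ, ρ y ≠ 0 := by
    let r : (Fin (m + 1 + q) → ℝ) →ᵃ[ℝ] ℝ :=
      (∑ i : Fin (m + 1), (LinearMap.proj i : (Fin (m + 1) → ℝ) →ₗ[ℝ] ℝ)).toAffineMap.comp
        (AffineMap.pi (fun i : Fin (m + 1) => lam (Fin.castLE (by omega) i)))
    have hr : ∀ y, r y = ∑ i, (Φ y).1 i := by
      intro y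
      simp [r, hΦ1]
    let S : AffineSubspace ℝ (Fin (m + 1 + q) → ℝ) := (affineSpan ℝ {(1 : ℝ)}).comap r
    have hS : ∀ y, y ∈ S ↔ r y = 1 := by
      intro y
      simp [S]
    have hne : S ≠ ⊤ := by
      intro h
      have : x (Fin.last _) ∈ S := by rw [h]; trivial
      rw [hS, hr] at this
      have h0 : ∀ i, (Φ (x (Fin.last _))).1 i = 0 := by
        intro i
        rw [hΦ1, hlam_basis, if_neg]
        intro h
        have := congrArg Fin.val h
        simp at this
        omega
      simp [h0] at this
    have h0 := Measure.addHaar_affineSubspace (volume : Measure (Fin (m + 1 + q) → ℝ)) S hne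
    rw [ae_iff]
    refine measure_mono_null (fun y hy => ?_) h0
    simp only [ne_eq, not_not, Set.mem_ofPred_eq, hρ] at hy
    change y ∈ S
    rw [hS, hr]
    linarith
  set K : ℝ := ((volume T).toReal⁻¹) ^ 2 * (volume T).toReal with hK
  have hK0 : 0 ≤ K := by positivity
  refine ⟨K * C, fun v hv hint => ?_⟩
  have hvc : Continuous v := hv.continuous
  change IntegrableOn (fun z => (ρ z ^ 2)⁻¹ * v z ^ 2) T volume at hint
  set D := ∫ z in T, ‖fderiv ℝ v z‖ ^ 2 with hD
  have hD0 : 0 ≤ D := integral_nonneg fun z => by positivity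
  set I := ∫ z in T, (ρ z ^ 2)⁻¹ * v z ^ 2 with hI
  have hI0 : 0 ≤ I := integral_nonneg fun z => by positivity
  let A : (Fin (m + 1 + q) → ℝ) → ℝ := fun z => (volume T).toReal⁻¹ * ∫ y in T, v (G z y)
  change ∫ z in T, (ρ z ^ 2)⁻¹ * A z ^ 2 ≤ K * C * (I + D)
  set f : (Fin (m + 1 + q) → ℝ) → ENNReal :=
    T.indicator (fun z => ENNReal.ofReal ((ρ z ^ 2)⁻¹ * v z ^ 2)) with hf
  have hfm : Measurable f := by
    refine Measurable.indicator ?_ hTm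
    have := hρc.measurable
    have := hvc.measurable
    fun_prop
  have hfint : ∫⁻ z, f z = ENNReal.ofReal I := by
    rw [hf, lintegral_indicator hTm, hI, ofReal_integral_eq_lintegral_ofReal hint]
    exact Filter.Eventually.of_forall fun z => by positivity
  have hpt : ∀ z ∈ T, ENNReal.ofReal ((ρ z ^ 2)⁻¹ * A z ^ 2) ≤
      ENNReal.ofReal K * ∫⁻ y in T, ENNReal.ofReal (ρ y) * f (G z y) := by
    intro z hz
    have hGc : Continuous (fun y => v (G z y)) := by
      simp only [G, Gmap]
      fun_prop
    have : IsFiniteMeasure ((volume : Measure (Fin (m + 1 + q) → ℝ)).restrict T) :=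
      ⟨by simpa using hTc.measure_lt_top⟩
    have i1 : IntegrableOn (fun y => v (G z y)) T volume := hGc.continuousOn.integrableOn_compact hTc
    have i2 : IntegrableOn (fun y => v (G z y) ^ 2) T volume :=
      (hGc.pow 2).continuousOn.integrableOn_compact hTc
    have cs := cs_aux (volume.restrict T) (fun y => v (G z y)) i1 i2
    have e1 : (volume.restrict T).real Set.univ = (volume T).toReal := by
      simp [Measure.real]
    rw [e1] at cs
    have e2 : (ρ z ^ 2)⁻¹ * A z ^ 2 ≤ K * ∫ y in T, (ρ z ^ 2)⁻¹ * v (G z y) ^ 2 := by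
      rw [integral_const_mul]
      simp only [A, mul_pow]
      have h1 := mul_le_mul_of_nonneg_left cs
        (show 0 ≤ (ρ z ^ 2)⁻¹ * ((volume T).toReal⁻¹) ^ 2 by positivity)
      calc _ = (ρ z ^ 2)⁻¹ * ((volume T).toReal⁻¹) ^ 2 * (∫ y in T, v (G z y)) ^ 2 := by ring
        _ ≤ _ := h1
        _ = _ := by rw [hK]; ring
    refine (ENNReal.ofReal_le_ofReal e2).trans ?_
    rw [ENNReal.ofReal_mul hK0, ofReal_integral_eq_lintegral_ofReal (i2.const_mul _)
      (Filter.Eventually.of_forall fun y => by positivity)]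
    refine mul_le_mul_right ?_ _
    refine lintegral_mono_ae ?_
    filter_upwards [ae_restrict_of_ae hnull, ae_restrict_mem hTm] with y hy0 hyT
    rw [hf, Set.indicator_of_mem (hGT z hz y hyT), ← ENNReal.ofReal_mul (hρT y hyT).1, hρG]
    refine ENNReal.ofReal_le_ofReal ?_
    rcases eq_or_ne (ρ z) 0 with h | h
    · simp [h]
    obtain ⟨hy1, hy2⟩ := hρT y hyT
    have hy3 : 0 < ρ y := lt_of_le_of_ne hy1 hy0.symm
    have e3 : ρ y * (((ρ z * ρ y) ^ 2)⁻¹ * v (G z y) ^ 2) =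
        (ρ y)⁻¹ * ((ρ z ^ 2)⁻¹ * v (G z y) ^ 2) := by
      field_simp
    rw [e3]
    exact le_mul_of_one_le_left (by positivity) ((one_le_inv₀ hy3).2 hy2)
  have hmain : ∫⁻ z in T, ENNReal.ofReal ((ρ z ^ 2)⁻¹ * A z ^ 2) ≤ ENNReal.ofReal (K * C * I) := by
    calc _ ≤ ∫⁻ z in T, ENNReal.ofReal K * ∫⁻ y in T, ENNReal.ofReal (ρ y) * f (G z y) :=
          setLIntegral_mono' hTm hpt
      _ = ENNReal.ofReal K * ∫⁻ z in T, ∫⁻ y in T, ENNReal.ofReal (ρ y) * f (G z y) :=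
          lintegral_const_mul' _ _ ENNReal.ofReal_ne_top
      _ ≤ ENNReal.ofReal K * (C * ∫⁻ z, f z) := mul_le_mul_right (hC f hfm) _
      _ = ENNReal.ofReal (K * C * I) := by
          rw [hfint, ENNReal.ofReal_mul (p := K * C) (by positivity), ENNReal.ofReal_mul (p := K) hK0,
            ENNReal.ofReal_coe_nnreal, mul_assoc]
  have hKC : 0 ≤ K * C := by positivity
  have hfin : ∫ z in T, (ρ z ^ 2)⁻¹ * A z ^ 2 ≤ K * C * I := by
    by_cases hi : IntegrableOn (fun z => (ρ z ^ 2)⁻¹ * A z ^ 2) T volume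
    · rw [← ofReal_integral_eq_lintegral_ofReal hi
        (Filter.Eventually.of_forall fun z => by positivity)] at hmain
      exact (ENNReal.ofReal_le_ofReal_iff (by positivity)).1 hmain
    · rw [integral_undef hi]
      positivity
  nlinarith [mul_nonneg hKC hD0]
end

section
/- Let 0 ≤ j < n be integers, let x_0,…,x_n ∈ ℝ^n be affinely independent with T = conv{x_0,…,x_n}, let λ_0(x),…,λ_n(x) be the barycentric coordinates of x with respect to x_0,…,x_n, and set λ_g(x) = (λ_0(x),…,λ_j(x)). Let P : ℝ^{j+1} → ℝ^{j+1} be the map that sets the 0-th coordinate to zero and leaves the other coordinates unchanged. Then there exists a constant c, depending only on T and j, such that for every continuously differentiable function v : ℝ^n → ℝ: ∫_T λ_0(x)^{−2} ( ⨍_T v(G_j(λ_g(x), y)) dy − ⨍_T v(G_j(P λ_g(x), y)) dy )² dx ≤ c ∫_T ‖Dv(x)‖² dx. (This is the cancellation estimate: the difference of the two averaged pullbacks decays like λ_0 near the face opposite the vertex x_0, with a bound depending only on the gradient of v.) -/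
open Finset MeasureTheory

lemma cs_weight {α : Type*} [MeasurableSpace α] (μ : Measure α) (φ g : α → ENNReal)
    (hφ : Measurable φ) (hg : Measurable g) (h0 : ∀ᵐ a ∂μ, φ a ≠ 0) (ht : ∀ a, φ a ≠ ⊤) :
    (∫⁻ a, g a ∂μ) ^ 2 ≤ (∫⁻ a, (φ a)⁻¹ ∂μ) * ∫⁻ a, φ a * g a ^ 2 ∂μ := by
  have key := ENNReal.lintegral_mul_le_Lp_mul_Lq μ (p := 2) (q := 2)
    ((Real.holderConjugate_iff).2 ⟨by norm_num, by norm_num⟩)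
    (f := fun a => φ a ^ (-(1/2) : ℝ)) (g := fun a => φ a ^ ((1/2) : ℝ) * g a)
    (by fun_prop) (by fun_prop)
  have e1 : ∫⁻ a, g a ∂μ = ∫⁻ a, ((fun a => φ a ^ (-(1/2) : ℝ)) *
      (fun a => φ a ^ ((1/2) : ℝ) * g a)) a ∂μ := by
    apply lintegral_congr_ae
    filter_upwards [h0] with a ha
    simp only [Pi.mul_apply]
    rw [← mul_assoc, ← ENNReal.rpow_add _ _ ha (ht a)]
    simp
  have e2 : ∀ a, (φ a ^ (-(1/2) : ℝ)) ^ (2 : ℝ) = (φ a)⁻¹ := by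
    intro a
    rw [← ENNReal.rpow_mul, ← ENNReal.rpow_neg_one]
    norm_num
  have e3 : ∀ a, (φ a ^ ((1/2) : ℝ) * g a) ^ (2 : ℝ) = φ a * g a ^ 2 := by
    intro a
    rw [ENNReal.mul_rpow_of_nonneg _ _ (by norm_num), ← ENNReal.rpow_mul]
    norm_num
  rw [← e1] at key
  simp only [e2, e3] at key
  calc (∫⁻ a, g a ∂μ) ^ 2 ≤ ((∫⁻ a, (φ a)⁻¹ ∂μ) ^ ((1:ℝ) / 2) *
        (∫⁻ a, φ a * g a ^ 2 ∂μ) ^ ((1:ℝ) / 2)) ^ 2 := by gcongr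
    _ = _ := by
      rw [mul_pow, ← ENNReal.rpow_natCast, ← ENNReal.rpow_natCast, ← ENNReal.rpow_mul,
        ← ENNReal.rpow_mul]
      norm_num

lemma lintegral_affine_comp (n : ℕ) (c : Fin n → ℝ) (β : ℝ) (hβ : 0 < β)
    (H : (Fin n → ℝ) → ENNReal) (hH : Measurable H) :
    ∫⁻ y, H (c + β • y) = ENNReal.ofReal ((β ^ n)⁻¹) * ∫⁻ w, H w := by
  have h1 := Measure.map_addHaar_smul (volume : Measure (Fin n → ℝ)) hβ.ne'
  have h2 : ∫⁻ y, H (c + β • y) = ∫⁻ w, H (c + w) ∂(Measure.map (fun x => β • x) volume) := by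
    rw [lintegral_map (by fun_prop) (by fun_prop)]
  rw [h2, h1, lintegral_smul_measure, lintegral_add_left_eq_self]
  rw [Module.finrank_fin_fun, abs_of_pos (by positivity)]
  rfl

lemma kernel_lemma (n : ℕ) (hn : 0 < n) (T : Set (Fin n → ℝ)) (hT : MeasurableSet T)
    (ℓ : (Fin n → ℝ) → ℝ) (hℓ : Measurable ℓ) (hℓ0 : ∀ y ∈ T, 0 ≤ ℓ y) (hℓ1 : ∀ y ∈ T, ℓ y ≤ 1)
    (d : (Fin n → ℝ) → (Fin n → ℝ) → ℝ) (hd : Measurable (Function.uncurry d))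
    (M : ENNReal)
    (hM : ∀ w, ∀ R : ℝ, 0 < R → volume {z | d z w ≤ R} ≤ M * ENNReal.ofReal (R ^ n))
    (c : (Fin n → ℝ) → (Fin n → ℝ)) (β : (Fin n → ℝ) → ℝ)
    (hβ : ∀ᵐ z ∂(volume.restrict T), 0 < β z)
    (hwT : ∀ z ∈ T, ∀ y ∈ T, c z + β z • y ∈ T)
    (hwℓ : ∀ z ∈ T, ∀ y ∈ T, ℓ (c z + β z • y) = β z * ℓ y)
    (hwd : ∀ z ∈ T, ∀ y ∈ T, d z (c z + β z • y) ≤ β z)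
    (F : (Fin n → ℝ) → ENNReal) (hF : Measurable F) :
    ∫⁻ z in T, ∫⁻ y in T, ENNReal.ofReal (√(ℓ y)) * F (c z + β z • y) ≤
      (M * (2 ^ n * (1 - ENNReal.ofReal (√(1/2)))⁻¹)) * ∫⁻ w in T, F w := by
  classical
  set ρ : ℝ := √(1/2) with hρ
  have hρ0 : 0 ≤ ρ := Real.sqrt_nonneg _
  let S : ℕ → Set ((Fin n → ℝ) × (Fin n → ℝ)) := fun k => {p | d p.1 p.2 ≤ 2 ^ (k+1) * ℓ p.2}
  have hS : ∀ k, MeasurableSet (S k) := fun k => by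
    apply measurableSet_le
    · exact hd
    · fun_prop
  let a : ℕ → (Fin n → ℝ) → ENNReal := fun k w => ENNReal.ofReal (ρ ^ k * ((2 ^ k * ℓ w) ^ n)⁻¹)
  have ha : ∀ k, Measurable (a k) := fun k => by
    simp only [a]; fun_prop
  let K : (Fin n → ℝ) → (Fin n → ℝ) → ENNReal := fun z w =>
    ∑' k, a k w * (S k).indicator (fun _ => 1) (z, w)
  have hK : Measurable (Function.uncurry K) := by
    apply Measurable.tsum
    intro k
    apply Measurable.mul
    · exact (ha k).comp measurable_snd
    · exact measurable_const.indicator (hS k)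
  -- step 1: pointwise in z
  have step1 : ∀ᵐ z ∂(volume.restrict T),
      ∫⁻ y in T, ENNReal.ofReal (√(ℓ y)) * F (c z + β z • y) ≤ ∫⁻ w in T, K z w * F w := by
    filter_upwards [hβ, ae_restrict_mem hT] with z hz hzT
    have hKz : Measurable (K z) := hK.comp measurable_prodMk_left
    let H : (Fin n → ℝ) → ENNReal := T.indicator (fun w => K z w * F w)
    have hH : Measurable H := (hKz.mul hF).indicator hT
    have e1 : ∫⁻ w in T, K z w * F w
        = ∫⁻ y, ENNReal.ofReal (β z ^ n) * H (c z + β z • y) := by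
      rw [lintegral_const_mul _ (by fun_prop), lintegral_affine_comp n _ _ hz _ hH, ← mul_assoc,
        ← ENNReal.ofReal_mul (by positivity), mul_inv_cancel₀ (by positivity),
        ENNReal.ofReal_one, one_mul, lintegral_indicator hT]
    rw [e1, ← lintegral_indicator hT]
    apply lintegral_mono
    intro y
    by_cases hy : y ∈ T
    swap
    · simp [hy]
    simp only [Set.indicator_of_mem hy]
    set w := c z + β z • y with hw
    have hwmem : w ∈ T := hwT z hzT y hy
    simp only [H, Set.indicator_of_mem hwmem]
    rw [← mul_assoc]
    gcongr
    rcases (hℓ0 y hy).eq_or_lt with h0 | h0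
    · simp [← h0]
    have hlw : ℓ w = β z * ℓ y := hwℓ z hzT y hy
    have hlw0 : 0 < ℓ w := by rw [hlw]; positivity
    obtain ⟨k, hk1, hk2⟩ := exists_nat_pow_near (x := (ℓ y)⁻¹) (y := (2:ℝ))
      ((one_le_inv₀ h0).2 (hℓ1 y hy)) (by norm_num)
    have hk1' : 2 ^ k * ℓ y ≤ 1 := by
      rw [← le_div_iff₀ h0, one_div]; exact hk1
    have hk2' : 1 < 2 ^ (k+1) * ℓ y := by
      rw [← div_lt_iff₀ h0, one_div]; exact hk2
    have hmemS : (z, w) ∈ S k := by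
      change d z w ≤ 2 ^ (k+1) * ℓ w
      refine (hwd z hzT y hy).trans ?_
      rw [hlw]
      nlinarith
    have hle : a k w ≤ K z w := by
      refine le_trans (le_of_eq ?_) (ENNReal.le_tsum k)
      simp [Set.indicator_of_mem hmemS]
    refine le_trans ?_ (mul_le_mul_right hle _)
    simp only [a]
    rw [← ENNReal.ofReal_mul (by positivity)]
    apply ENNReal.ofReal_le_ofReal
    have hs : √(ℓ y) ≤ ρ ^ k := by
      apply Real.sqrt_le_iff.2 ⟨by positivity, ?_⟩
      rw [← pow_mul, mul_comm k 2, pow_mul, hρ, Real.sq_sqrt (by norm_num), one_div, inv_pow]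
      rw [← one_div, le_div_iff₀ (by positivity)]
      linarith
    have h1 : 1 ≤ β z ^ n * ((2 ^ k * ℓ w) ^ n)⁻¹ := by
      rw [← div_eq_mul_inv, one_le_div (by positivity)]
      gcongr
      rw [hlw]
      nlinarith
    calc √(ℓ y) ≤ ρ ^ k * 1 := by simpa using hs
      _ ≤ ρ ^ k * (β z ^ n * ((2 ^ k * ℓ w) ^ n)⁻¹) := by gcongr
      _ = _ := by ring
  have step2 : ∀ w ∈ T, ∫⁻ z in T, K z w ≤ M * (2 ^ n * (1 - ENNReal.ofReal ρ)⁻¹) := by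
    intro w hw
    have hi : ∀ k, Measurable fun z => (S k).indicator (fun _ => (1:ENNReal)) (z, w) := fun k =>
      (measurable_const.indicator (hS k)).comp (measurable_prodMk_right)
    simp only [K]
    rw [lintegral_tsum (fun k => ((hi k).const_mul _).aemeasurable)]
    have : ∀ k, ∫⁻ z in T, a k w * (S k).indicator (fun _ => 1) (z, w)
        ≤ M * (2 ^ n * ENNReal.ofReal ρ ^ k) := by
      intro k
      rw [lintegral_const_mul _ (hi k)]
      rcases (hℓ0 w hw).eq_or_lt with h0 | h0
      · simp [a, ← h0, hn.ne']
      have e : ∫⁻ z in T, (S k).indicator (fun _ => (1:ENNReal)) (z, w)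
          ≤ M * ENNReal.ofReal ((2 ^ (k+1) * ℓ w) ^ n) := by
        refine le_trans (setLIntegral_le_lintegral _ _) ?_
        refine le_trans (le_of_eq ?_) (hM w (2 ^ (k+1) * ℓ w) (by positivity))
        rw [← lintegral_indicator_one]
        · rfl
        · exact measurable_prodMk_right (hS k)
      calc _ ≤ a k w * (M * ENNReal.ofReal ((2 ^ (k+1) * ℓ w) ^ n)) := by gcongr
        _ = M * (a k w * ENNReal.ofReal ((2 ^ (k+1) * ℓ w) ^ n)) := by ring
        _ = M * (2 ^ n * ENNReal.ofReal ρ ^ k) := by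
          congr 1
          simp only [a]
          rw [← ENNReal.ofReal_mul (by positivity), ← ENNReal.ofReal_pow hρ0]
          rw [show (2:ENNReal) ^ n = ENNReal.ofReal (2 ^ n) by
            rw [ENNReal.ofReal_pow (by norm_num)]; norm_num]
          rw [← ENNReal.ofReal_mul (by positivity)]
          congr 1
          rw [pow_succ 2 k, mul_pow, mul_pow, mul_pow]
          field_simp
    calc _ ≤ ∑' k, M * (2 ^ n * ENNReal.ofReal ρ ^ k) := ENNReal.tsum_le_tsum this
      _ = _ := by rw [ENNReal.tsum_mul_left, ENNReal.tsum_mul_left, ENNReal.tsum_geometric]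
  calc _ ≤ ∫⁻ z in T, ∫⁻ w in T, K z w * F w := lintegral_mono_ae step1
    _ = ∫⁻ w in T, ∫⁻ z in T, K z w * F w := by
      apply lintegral_lintegral_swap
      exact (hK.mul (hF.comp measurable_snd)).aemeasurable
    _ ≤ ∫⁻ w in T, (M * (2 ^ n * (1 - ENNReal.ofReal ρ)⁻¹)) * F w := by
      apply lintegral_mono_ae
      filter_upwards [ae_restrict_mem hT] with w hw
      have hKw : Measurable fun z => K z w := hK.comp measurable_prodMk_right
      rw [lintegral_mul_const _ hKw]
      gcongr
      exact step2 w hw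
    _ = _ := lintegral_const_mul _ hF

lemma affine_map_volume (n : ℕ) (x : Fin (n + 1) → Fin n → ℝ)
    (lam : Fin (n + 1) → ((Fin n → ℝ) →ᵃ[ℝ] ℝ))
    (hlam_basis : ∀ i j, lam i (x j) = if i = j then 1 else 0) :
    ∃ C : ENNReal, C ≠ ⊤ ∧
      Measure.map (fun z => fun i : Fin n => lam i.succ z) volume = C • volume := by
  let L : (Fin n → ℝ) →ₗ[ℝ] (Fin n → ℝ) := LinearMap.pi (fun i => (lam i.succ).linear)
  let M : (Fin n → ℝ) →ₗ[ℝ] (Fin n → ℝ) :=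
    (Pi.basisFun ℝ (Fin n)).constr ℝ (fun j => x j.succ - x 0)
  have hLM : L ∘ₗ M = LinearMap.id := by
    apply (Pi.basisFun ℝ (Fin n)).ext
    intro j
    ext i
    have h : (lam i.succ).linear (x j.succ - x 0) = lam i.succ (x j.succ) - lam i.succ (x 0) := by
      rw [← vsub_eq_sub, AffineMap.linearMap_vsub, vsub_eq_sub]
    have hM : M (Pi.basisFun ℝ (Fin n) j) = x j.succ - x 0 := Module.Basis.constr_basis _ _ _ _
    rw [LinearMap.comp_apply, hM]
    simp only [L, LinearMap.pi_apply]
    rw [h, hlam_basis, hlam_basis]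
    simp [Pi.single_apply]
  have hdet : LinearMap.det L ≠ 0 := by
    intro h0
    have := congrArg LinearMap.det hLM
    rw [LinearMap.det_comp, h0, LinearMap.det_id] at this
    simp at this
  refine ⟨ENNReal.ofReal |(LinearMap.det L)⁻¹|, ENNReal.ofReal_ne_top, ?_⟩
  have e : (fun z => fun i : Fin n => lam i.succ z)
      = (fun w => w + (fun i : Fin n => lam i.succ 0)) ∘ (L : (Fin n → ℝ) → (Fin n → ℝ)) := by
    funext z i
    simp only [Function.comp_apply, Pi.add_apply, L, LinearMap.pi_apply]
    have := congrFun (AffineMap.decomp (lam i.succ)) z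
    simpa using this
  rw [e, ← Measure.map_map (by fun_prop) (L.continuous_of_finiteDimensional.measurable),
    Measure.map_linearMap_addHaar_eq_smul_addHaar _ hdet, Measure.map_smul,
    map_add_right_eq_self]

lemma lam_nonneg (n : ℕ) (x : Fin (n + 1) → Fin n → ℝ)
    (lam : Fin (n + 1) → ((Fin n → ℝ) →ᵃ[ℝ] ℝ))
    (hlam_basis : ∀ i j, lam i (x j) = if i = j then 1 else 0) (i : Fin (n + 1))
    (z : Fin n → ℝ) (hz : z ∈ convexHull ℝ (Set.range x)) : 0 ≤ lam i z := by
  have : convexHull ℝ (Set.range x) ⊆ (lam i) ⁻¹' (Set.Ici 0) := by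
    apply convexHull_min
    · rintro _ ⟨j, rfl⟩
      simp only [Set.mem_preimage, hlam_basis, Set.mem_Ici]
      split_ifs <;> norm_num
    · exact (convex_Ici 0).affine_preimage _
  exact this hz

lemma lam_Gmap (n m : ℕ) (hmn : m + 1 ≤ n + 1)
    (x : Fin (n + 1) → Fin n → ℝ)
    (lam : Fin (n + 1) → ((Fin n → ℝ) →ᵃ[ℝ] ℝ))
    (hlam_basis : ∀ i j, lam i (x j) = if i = j then 1 else 0)
    (μ : Fin (m + 1) → ℝ) (y : Fin n → ℝ) (i : Fin (n + 1)) :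
    lam i (Gmap n m (fun j => x (Fin.castLE hmn j)) μ y) =
      (if h : i.val < m + 1 then μ ⟨i.val, h⟩ else 0) + bfun m μ * lam i y := by
  have hdec : ∀ z, lam i z = (lam i).linear z + lam i 0 := by
    intro z
    have := congrFun (AffineMap.decomp (lam i)) z
    simpa using this
  have h1 : ∀ j : Fin (m+1), (lam i).linear (x (Fin.castLE hmn j))
      = (if i = Fin.castLE hmn j then 1 else 0) - lam i 0 := by
    intro j
    rw [← hlam_basis i, hdec (x _)]; ring
  rw [hdec (Gmap _ _ _ _ _), Gmap, map_add, map_sum]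
  simp only [map_smul, smul_eq_mul, h1]
  rw [hdec y]
  have h2 : ∑ j : Fin (m+1), μ j * ((if i = Fin.castLE hmn j then 1 else 0) - lam i 0)
      = (if h : i.val < m + 1 then μ ⟨i.val, h⟩ else 0) - (∑ j, μ j) * lam i 0 := by
    simp only [mul_sub, Finset.sum_sub_distrib, Finset.sum_mul]
    congr 1
    split_ifs with h
    · rw [Finset.sum_eq_single ⟨i.val, h⟩]
      · simp 
      · intro b _ hb
        rw [if_neg, mul_zero]
        intro hc
        apply hb
        ext; simp [hc]
      · simp
    · apply Finset.sum_eq_zero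
      intro j _
      rw [if_neg, mul_zero]
      intro hc
      apply h
      rw [hc]; exact j.isLt
  rw [h2, bfun]
  ring

lemma Gmap_mem (n m : ℕ) (X : Fin (m + 1) → Fin n → ℝ) (T : Set (Fin n → ℝ)) (hT : Convex ℝ T)
    (hX : ∀ j, X j ∈ T) (μ : Fin (m + 1) → ℝ) (hμ : ∀ j, 0 ≤ μ j) (hb : 0 ≤ bfun m μ)
    (y : Fin n → ℝ) (hy : y ∈ T) : Gmap n m X μ y ∈ T := by
  have h := hT.sum_mem (t := Finset.univ) (w := (Fin.cons (bfun m μ) μ : Fin (m+2) → ℝ))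
    (z := (Fin.cons y X : Fin (m+2) → Fin n → ℝ))
    (by intro i _; refine Fin.cases ?_ ?_ i <;> simp [hb, hμ])
    (by rw [Fin.sum_univ_succ]; simp [bfun])
    (by intro i _; refine Fin.cases ?_ ?_ i <;> simp [hy, hX])
  rw [Fin.sum_univ_succ] at h
  simp only [Fin.cons_zero, Fin.cons_succ] at h
  rw [Gmap, add_comm]
  exact h

lemma bfun_ge (n m : ℕ) (hmn : m + 1 ≤ n + 1) (a : Fin (n + 1) → ℝ) (ha : ∀ i, 0 ≤ a i)
    (hsum : ∑ i, a i = 1) (s : ℝ) (hs1 : s ≤ 1) (i : Fin (n + 1)) (hi : m < i.val) :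
    a i ≤ bfun m (Function.update (fun j : Fin (m + 1) => a (Fin.castLE hmn j)) 0 (s * a 0)) := by
  have h1 : ∑ j, Function.update (fun j : Fin (m + 1) => a (Fin.castLE hmn j)) 0 (s * a 0) j
      ≤ ∑ j : Fin (m + 1), a (Fin.castLE hmn j) := by
    apply Finset.sum_le_sum
    intro j _
    by_cases hj : j = 0
    · subst hj
      simp only [Function.update_self]
      have : Fin.castLE hmn 0 = 0 := by ext; simp
      rw [this]
      nlinarith [ha 0]
    · simp [Function.update_of_ne hj]
  have h2 : ∑ j : Fin (m + 1), a (Fin.castLE hmn j) + a i ≤ ∑ i, a i := by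
    have e : ∑ j : Fin (m + 1), a (Fin.castLE hmn j)
        = ∑ k ∈ Finset.univ.map (Fin.castLEEmb hmn), a k := by
      rw [Finset.sum_map]; rfl
    have hni : i ∉ Finset.univ.map (Fin.castLEEmb hmn) := by
      simp only [Finset.mem_map, Finset.mem_univ, true_and, not_exists]
      intro j hj
      have := congrArg Fin.val hj
      simp at this
      omega
    rw [e, add_comm, ← Finset.sum_insert hni]
    exact Finset.sum_le_sum_of_subset_of_nonneg (Finset.subset_univ _) (fun k _ _ => ha k)
  rw [bfun]
  linarith

lemma inv_sqrt_finite (n : ℕ) (T : Set (Fin n → ℝ)) (hT : MeasurableSet T)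
    (Λ : (Fin n → ℝ) → (Fin n → ℝ)) (hΛ : Measurable Λ) (C : ENNReal) (hC : C ≠ ⊤)
    (hmap : Measure.map Λ volume = C • volume)
    (hcube : ∀ z ∈ T, ∀ i, 0 ≤ Λ z i ∧ Λ z i ≤ 1) (i : Fin n) :
    ∫⁻ z in T, (ENNReal.ofReal (√(Λ z i)))⁻¹ < ⊤ := by
  let f : ℝ → ENNReal := fun t => (ENNReal.ofReal (√t))⁻¹
  have hf : Measurable f := by simp only [f]; fun_prop
  let Q : Set (Fin n → ℝ) := Set.univ.pi fun _ => Set.Icc 0 1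
  have hQ : MeasurableSet Q := MeasurableSet.univ_pi fun _ => measurableSet_Icc
  let g : (Fin n → ℝ) → ENNReal := Q.indicator (fun w => f (w i))
  have hg : Measurable g := (hf.comp (measurable_pi_apply i)).indicator hQ
  have h1 : ∫⁻ z in T, f (Λ z i) ≤ ∫⁻ z, g (Λ z) := by
    rw [← lintegral_indicator hT]
    apply lintegral_mono
    intro z
    by_cases hz : z ∈ T
    · have : Λ z ∈ Q := fun j _ => hcube z hz j
      simp [hz, g, this]
    · simp [hz]
  have h2 : ∫⁻ z, g (Λ z) = C * ∫⁻ w in Q, f (w i) := by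
    rw [← lintegral_map hg hΛ, hmap, lintegral_smul_measure, smul_eq_mul,
      lintegral_indicator hQ]
  have h3 : ∫⁻ w in Q, f (w i) = ∫⁻ t in Set.Icc (0:ℝ) 1, f t := by
    have hr : (volume : Measure (Fin n → ℝ)).restrict Q
        = Measure.pi (fun _ => (volume : Measure ℝ).restrict (Set.Icc 0 1)) :=
      Measure.restrict_pi_pi _ _
    have : IsProbabilityMeasure ((volume : Measure ℝ).restrict (Set.Icc 0 1)) := ⟨by simp⟩
    rw [hr]
    exact (measurePreserving_eval (fun _ : Fin n => (volume : Measure ℝ).restrict (Set.Icc 0 1))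
      i).lintegral_comp hf
  have h4 : ∫⁻ t in Set.Icc (0:ℝ) 1, f t < ⊤ := by
    rw [← restrict_Ioc_eq_restrict_Icc]
    have hi := (intervalIntegral.intervalIntegrable_rpow' (a := 0) (b := 1)
      (r := -(1/2)) (by norm_num)).1
    have := hi.lintegral_lt_top
    refine lt_of_le_of_lt (le_of_eq ?_) this
    apply setLIntegral_congr_fun measurableSet_Ioc
    intro t ht
    simp only [f]
    rw [← ENNReal.ofReal_inv_of_pos (Real.sqrt_pos.2 ht.1), Real.sqrt_eq_rpow,
      Real.rpow_neg ht.1.le]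
  calc _ ≤ _ := h1
    _ = C * ∫⁻ t in Set.Icc (0:ℝ) 1, f t := by rw [h2, h3]
    _ < ⊤ := ENNReal.mul_lt_top hC.lt_top h4

lemma ftc_bound (n : ℕ) (v : (Fin n → ℝ) → ℝ) (hv : ContDiff ℝ 1 v) (a e : Fin n → ℝ) :
    ‖v (a + e) - v a‖ₑ ≤ ∫⁻ s in Set.Ioc (0:ℝ) 1, ‖fderiv ℝ v (a + s • e)‖ₑ * ‖e‖ₑ := by
  have hd : ∀ s : ℝ, HasDerivAt (fun s : ℝ => v (a + s • e)) (fderiv ℝ v (a + s • e) e) s := by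
    intro s
    have h1 : HasDerivAt (fun s : ℝ => a + s • e) e s := by
      simpa using ((hasDerivAt_id s).smul_const e).const_add a
    exact ((hv.differentiable (by norm_num) (a + s • e)).hasFDerivAt).comp_hasDerivAt s h1
  have hc : Continuous fun s : ℝ => fderiv ℝ v (a + s • e) e := by
    have := hv.continuous_fderiv (by norm_num)
    fun_prop
  have h := intervalIntegral.integral_eq_sub_of_hasDerivAt (a := 0) (b := 1) (fun s _ => hd s)
    (hc.intervalIntegrable _ _)
  simp only [one_smul, zero_smul, add_zero] at h
  rw [← h, intervalIntegral.integral_of_le zero_le_one]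
  refine (enorm_integral_le_lintegral_enorm _).trans ?_
  apply lintegral_mono
  intro s
  exact ContinuousLinearMap.le_opENorm _ _

/-- Uniform-in-s bound obtained by applying the kernel lemma to the simplex. -/
lemma J_bound (n m : ℕ) (hmn : m < n) (hmn' : m + 1 ≤ n + 1)
    (x : Fin (n + 1) → Fin n → ℝ)
    (lam : Fin (n + 1) → ((Fin n → ℝ) →ᵃ[ℝ] ℝ))
    (hlam_sum : ∀ z : Fin n → ℝ, ∑ i, lam i z = 1)
    (hlam_basis : ∀ i j, lam i (x j) = if i = j then 1 else 0)
    (C : ENNReal)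
    (hmap : Measure.map (fun z => fun i : Fin n => lam i.succ z) volume = C • volume)
    (hae : ∀ᵐ z ∂(volume.restrict (convexHull ℝ (Set.range x))), lam (Fin.last n) z ≠ 0)
    (s : ℝ) (hs0 : 0 ≤ s) (hs1 : s ≤ 1)
    (F : (Fin n → ℝ) → ENNReal) (hF : Measurable F) :
    ∫⁻ z in convexHull ℝ (Set.range x), ∫⁻ y in convexHull ℝ (Set.range x),
      ENNReal.ofReal (√(lam (Fin.last n) y)) *
        F (Gmap n m (fun j => x (Fin.castLE hmn' j))
          (Function.update (fun i : Fin (m + 1) => lam (Fin.castLE hmn' i) z) 0 (s * lam 0 z)) y) ≤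
      ((C * 2 ^ n) * (2 ^ n * (1 - ENNReal.ofReal (√(1/2)))⁻¹)) *
        ∫⁻ w in convexHull ℝ (Set.range x), F w := by
  set T := convexHull ℝ (Set.range x) with hTdef
  have hlc : ∀ i, Continuous (lam i) := fun i => (lam i).continuous_of_finiteDimensional
  have hTm : MeasurableSet T := ((Set.finite_range x).isCompact_convexHull ℝ).measurableSet
  have hnn : ∀ i, ∀ z ∈ T, 0 ≤ lam i z := fun i z hz => lam_nonneg n x lam hlam_basis i z hz
  have hle1 : ∀ i, ∀ z ∈ T, lam i z ≤ 1 := fun i z hz => by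
    rw [← hlam_sum z]
    exact Finset.single_le_sum (f := fun i => lam i z) (fun j _ => hnn j z hz) (Finset.mem_univ i)
  let μ : (Fin n → ℝ) → Fin (m + 1) → ℝ := fun z =>
    Function.update (fun i : Fin (m + 1) => lam (Fin.castLE hmn' i) z) 0 (s * lam 0 z)
  let X : Fin (m + 1) → Fin n → ℝ := fun j => x (Fin.castLE hmn' j)
  let q : (Fin n → ℝ) → (Fin n → ℝ) := fun w i => if i.succ.val < m + 1 then lam i.succ w else 0
  have hβge : ∀ z ∈ T, ∀ i : Fin (n + 1), m < i.val → lam i z ≤ bfun m (μ z) := fun z hz i hi =>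
    bfun_ge n m hmn' (fun i => lam i z) (fun i => hnn i z hz) (hlam_sum z) s hs1 i hi
  have hβ0 : ∀ z ∈ T, 0 ≤ bfun m (μ z) := fun z hz =>
    (hnn _ z hz).trans (hβge z hz (Fin.last n) (by simpa using hmn))
  have hμ0 : ∀ z ∈ T, ∀ j, 0 ≤ μ z j := by
    intro z hz j
    by_cases hj : j = 0
    · subst hj
      simp only [μ, Function.update_self]
      exact mul_nonneg hs0 (hnn 0 z hz)
    · simp only [μ, Function.update_of_ne hj]
      exact hnn _ z hz
  have hXT : ∀ j, X j ∈ T := fun j => subset_convexHull ℝ _ ⟨_, rfl⟩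
  refine kernel_lemma n (by omega) T hTm (fun y => lam (Fin.last n) y) (hlc _).measurable
    (fun y hy => hnn _ y hy) (fun y hy => hle1 _ y hy)
    (fun z w => dist (fun i : Fin n => lam i.succ z) (q w)) ?_ (C * 2 ^ n) ?_
    (fun z => ∑ j, μ z j • X j) (fun z => bfun m (μ z)) ?_ ?_ ?_ ?_ F hF
  · have hq : Continuous q := by
      apply continuous_pi
      intro i
      simp only [q]
      split_ifs
      · exact hlc _
      · exact continuous_const
    have hΛ : Continuous fun z => fun i : Fin n => lam i.succ z :=
      continuous_pi fun i => hlc _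
    exact ((hΛ.comp continuous_fst).dist (hq.comp continuous_snd)).measurable
  · intro w R hR
    have hΛ : Continuous fun z => fun i : Fin n => lam i.succ z :=
      continuous_pi fun i => hlc _
    have : {z | dist (fun i : Fin n => lam i.succ z) (q w) ≤ R}
        = (fun z => fun i : Fin n => lam i.succ z) ⁻¹' (Metric.closedBall (q w) R) := rfl
    rw [this, ← Measure.map_apply hΛ.measurable Metric.isClosed_closedBall.measurableSet, hmap,
      Measure.smul_apply, Real.volume_pi_closedBall _ hR.le, smul_eq_mul, Fintype.card_fin, mul_pow,
      ENNReal.ofReal_mul (by positivity), ENNReal.ofReal_pow (by norm_num), mul_assoc]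
    norm_num
  · filter_upwards [hae, ae_restrict_mem hTm] with z hz hzT
    exact lt_of_lt_of_le ((hnn _ z hzT).lt_of_ne' hz)
      (hβge z hzT (Fin.last n) (by simpa using hmn))
  · intro z hz y hy
    exact Gmap_mem n m X T (convex_convexHull ℝ _) hXT (μ z) (hμ0 z hz) (hβ0 z hz) y hy
  · intro z hz y hy
    have h := lam_Gmap n m hmn' x lam hlam_basis (μ z) y (Fin.last n)
    rw [dif_neg (by simp; omega), zero_add] at h
    exact h
  · intro z hz y hy
    rw [dist_pi_le_iff (hβ0 z hz)]
    intro i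
    have h := lam_Gmap n m hmn' x lam hlam_basis (μ z) y i.succ
    change dist (lam i.succ z) (if i.succ.val < m + 1 then
      lam i.succ (Gmap n m X (μ z) y) else 0) ≤ _
    by_cases hi : i.succ.val < m + 1
    · rw [dif_pos hi] at h
      have hne : (⟨i.succ.val, hi⟩ : Fin (m + 1)) ≠ 0 := by
        intro hc
        have := congrArg Fin.val hc
        simp at this
      have hμi : μ z ⟨i.succ.val, hi⟩ = lam i.succ z := by
        simp only [μ, Function.update_of_ne hne]
        rfl
      rw [if_pos hi, h, hμi, Real.dist_eq]
      have e : lam i.succ z - (lam i.succ z + bfun m (μ z) * lam i.succ y)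
        = - (bfun m (μ z) * lam i.succ y) := by ring
      rw [e, abs_neg, abs_of_nonneg (mul_nonneg (hβ0 z hz) (hnn _ y hy))]
      exact mul_le_of_le_one_right (hβ0 z hz) (hle1 _ y hy)
    · rw [if_neg hi, Real.dist_eq, sub_zero, abs_of_nonneg (hnn _ z hz)]
      exact hβge z hz i.succ (by omega)

lemma Gmap_update (n m : ℕ) (X : Fin (m + 1) → Fin n → ℝ) (μ : Fin (m + 1) → ℝ) (r : ℝ)
    (y : Fin n → ℝ) :
    Gmap n m X (Function.update μ 0 r) y
      = Gmap n m X (Function.update μ 0 0) y + r • (X 0 - y) := by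
  simp only [Gmap, bfun, Fin.sum_univ_succ, Function.update_self,
    Function.update_of_ne (Fin.succ_ne_zero _)]
  module

/-- The cancellation estimate (Lemma `decay-cancel`, single element version): with
`λ_g(z) = (λ_0(z),…,λ_j(z))` the first `j+1` barycentric coordinates (the face
dimension `j` of the statement is denoted `m` here) and `P` the map setting the 0-th
coordinate to zero,
`∫_T λ_0⁻² (⨍_T v(G_j(λ_g(·),y)) dy − ⨍_T v(G_j(Pλ_g(·),y)) dy)² ≤ c ∫_T ‖Dv‖²`. -/
theorem average_decay_cancel (n m : ℕ) (hmn : m < n)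
    (x : Fin (n + 1) → Fin n → ℝ) (hx : AffineIndependent ℝ x)
    (lam : Fin (n + 1) → ((Fin n → ℝ) →ᵃ[ℝ] ℝ))
    (hlam_sum : ∀ z : Fin n → ℝ, ∑ i, lam i z = 1)
    (hlam_basis : ∀ i j, lam i (x j) = if i = j then 1 else 0) :
    ∃ c : ℝ, ∀ v : (Fin n → ℝ) → ℝ, ContDiff ℝ 1 v →
      ∫ z in convexHull ℝ (Set.range x),
          ((lam 0 z) ^ 2)⁻¹ *
            (Avg n m (fun j : Fin (m + 1) => x (Fin.castLE (by omega) j))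
                (convexHull ℝ (Set.range x)) v
                (fun i : Fin (m + 1) => lam (Fin.castLE (by omega) i) z) -
              Avg n m (fun j : Fin (m + 1) => x (Fin.castLE (by omega) j))
                (convexHull ℝ (Set.range x)) v
                (Function.update
                  (fun i : Fin (m + 1) => lam (Fin.castLE (by omega) i) z) 0 0)) ^ 2
        ≤ c * ∫ z in convexHull ℝ (Set.range x), ‖fderiv ℝ v z‖ ^ 2 := by
  have hmn' : m + 1 ≤ n + 1 := by omega
  obtain ⟨C, hC, hmap⟩ := affine_map_volume n x lam hlam_basis
  set T := convexHull ℝ (Set.range x) with hTdef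
  have hlc : ∀ i, Continuous (lam i) := fun i => (lam i).continuous_of_finiteDimensional
  have hTc : IsCompact T := (Set.finite_range x).isCompact_convexHull ℝ
  have hTm : MeasurableSet T := hTc.measurableSet
  have hnn : ∀ i, ∀ z ∈ T, 0 ≤ lam i z := fun i z hz => lam_nonneg n x lam hlam_basis i z hz
  have hle1 : ∀ i, ∀ z ∈ T, lam i z ≤ 1 := fun i z hz => by
    rw [← hlam_sum z]
    exact Finset.single_le_sum (f := fun i => lam i z) (fun j _ => hnn j z hz) (Finset.mem_univ i)
  let ℓ : (Fin n → ℝ) → ℝ := fun y => lam (Fin.last n) y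
  let φ : (Fin n → ℝ) → ENNReal := fun y => ENNReal.ofReal (√(ℓ y))
  have hℓc : Continuous ℓ := hlc _
  have hφm : Measurable φ := by
    have := hℓc.measurable
    simp only [φ]; fun_prop
  -- finiteness of the weight integral
  have hA : ∫⁻ y in T, (φ y)⁻¹ < ⊤ := by
    have h := inv_sqrt_finite n T hTm (fun z => fun i : Fin n => lam i.succ z)
      (continuous_pi fun i => hlc _).measurable C hC hmap
      (fun z hz i => ⟨hnn _ z hz, hle1 _ z hz⟩) ⟨n - 1, by omega⟩
    have e : (⟨n - 1, by omega⟩ : Fin n).succ = Fin.last n := by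
      ext; simp; omega
    simpa only [e] using h
  have hφ0 : ∀ᵐ y ∂(volume.restrict T), φ y ≠ 0 := by
    filter_upwards [ae_lt_top hφm.inv hA.ne] with y hy h0
    simp [h0] at hy
  have hae : ∀ᵐ z ∂(volume.restrict T), lam (Fin.last n) z ≠ 0 := by
    filter_upwards [hφ0] with y hy h0
    apply hy
    simp [φ, ℓ, h0]
  obtain ⟨D, hD⟩ := hTc.isBounded.exists_norm_le
  have hx0T : ∀ j, x j ∈ T := fun j => subset_convexHull ℝ _ ⟨_, rfl⟩
  let A : ENNReal := ∫⁻ y in T, (φ y)⁻¹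
  let V : ENNReal := ‖(volume T).toReal⁻¹‖ₑ
  let Dtwo : ENNReal := ENNReal.ofReal (D + D)
  let KC : ENNReal := ((C * 2 ^ n) * (2 ^ n * (1 - ENNReal.ofReal (√(1/2)))⁻¹))
  let CC : ENNReal := ((V * Dtwo) ^ 2 * A) * KC
  have hKC : KC ≠ ⊤ := by
    have h1 : ENNReal.ofReal (√(1/2)) < 1 := by
      rw [ENNReal.ofReal_lt_one, Real.sqrt_lt' one_pos]; norm_num
    have h2 : (1 - ENNReal.ofReal (√(1/2)))⁻¹ ≠ ⊤ := by
      rw [ENNReal.inv_ne_top]; exact (tsub_pos_of_lt h1).ne'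
    have h3 : (2:ENNReal) ^ n ≠ ⊤ := ENNReal.pow_ne_top (by norm_num)
    exact ENNReal.mul_ne_top (ENNReal.mul_ne_top hC h3) (ENNReal.mul_ne_top h3 h2)
  have hCC : CC ≠ ⊤ := ENNReal.mul_ne_top (ENNReal.mul_ne_top (ENNReal.pow_ne_top
    (ENNReal.mul_ne_top enorm_ne_top ENNReal.ofReal_ne_top)) hA.ne) hKC
  refine ⟨CC.toReal, fun v hv => ?_⟩
  have hDv : Continuous (fderiv ℝ v) := hv.continuous_fderiv (by norm_num)
  let F : (Fin n → ℝ) → ENNReal := fun w => ‖fderiv ℝ v w‖ₑ ^ 2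
  have hFm : Measurable F := by
    have : Measurable fun w => ‖fderiv ℝ v w‖ₑ := hDv.enorm.measurable
    exact this.pow_const 2
  let X : Fin (m + 1) → Fin n → ℝ := fun j => x (Fin.castLE hmn' j)
  let Lg : (Fin n → ℝ) → Fin (m + 1) → ℝ := fun z i => lam (Fin.castLE hmn' i) z
  let W : ℝ → (Fin n → ℝ) → (Fin n → ℝ) → (Fin n → ℝ) := fun s z y =>
    Gmap n m X (Function.update (Lg z) 0 (s * lam 0 z)) y
  have hLgc : Continuous Lg := continuous_pi fun i => hlc _
  have hWc : Continuous fun p : ℝ × (Fin n → ℝ) × (Fin n → ℝ) => W p.1 p.2.1 p.2.2 := by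
    have h1 : Continuous fun p : ℝ × (Fin n → ℝ) × (Fin n → ℝ) =>
        Function.update (Lg p.2.1) 0 (p.1 * lam 0 p.2.1) :=
      (hLgc.comp (by fun_prop)).update 0 (continuous_fst.mul ((hlc 0).comp (by fun_prop)))
    simp only [W, Gmap, bfun]
    fun_prop
  have hJ : ∀ s : ℝ, 0 ≤ s → s ≤ 1 →
      ∫⁻ z in T, ∫⁻ y in T, φ y * F (W s z y) ≤ KC * ∫⁻ w in T, F w := fun s hs0 hs1 =>
    J_bound n m hmn hmn' x lam hlam_sum hlam_basis C hmap hae s hs0 hs1 F hFm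
  -- pointwise bound
  have hpt : ∀ z ∈ T, ENNReal.ofReal (((lam 0 z) ^ 2)⁻¹ *
      (Avg n m X T v (Lg z) - Avg n m X T v (Function.update (Lg z) 0 0)) ^ 2) ≤
      ((V * Dtwo) ^ 2 * A) * ∫⁻ s in Set.Ioc (0:ℝ) 1, ∫⁻ y in T, φ y * F (W s z y) := by
    intro z hz
    rcases (hnn 0 z hz).eq_or_lt with h0 | h0
    · simp [← h0]
    have hLg0 : Function.update (Lg z) 0 (lam 0 z) = Lg z := by
      apply Function.update_eq_self_iff.2
      simp only [Lg]
      congr 2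
    have hGc : ∀ μ, Continuous fun y => v (Gmap n m X μ y) := by
      intro μ
      have hG : Continuous fun y => Gmap n m X μ y := by
        simp only [Gmap]
        fun_prop
      exact hv.continuous.comp hG
    have hint : ∀ μ, IntegrableOn (fun y => v (Gmap n m X μ y)) T volume := fun μ =>
      (hGc μ).continuousOn.integrableOn_compact hTc
    have hdiff : Avg n m X T v (Lg z) - Avg n m X T v (Function.update (Lg z) 0 0)
        = (volume T).toReal⁻¹ * ∫ y in T, (v (Gmap n m X (Lg z) y)
          - v (Gmap n m X (Function.update (Lg z) 0 0) y)) := by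
      rw [integral_sub (hint _) (hint _), Avg, Avg]
      ring
    have hWz : Continuous fun p : ℝ × (Fin n → ℝ) => W p.1 z p.2 :=
      hWc.comp (f := fun p : ℝ × (Fin n → ℝ) => (p.1, z, p.2)) (by fun_prop)
    have hb1 : ‖∫ y in T, (v (Gmap n m X (Lg z) y)
          - v (Gmap n m X (Function.update (Lg z) 0 0) y))‖ₑ ≤
        (ENNReal.ofReal (lam 0 z) * Dtwo) *
          ∫⁻ s in Set.Ioc (0:ℝ) 1, ∫⁻ y in T, ‖fderiv ℝ v (W s z y)‖ₑ := by
      refine (enorm_integral_le_lintegral_enorm _).trans ?_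
      rw [lintegral_lintegral_swap (f := fun s y => ‖fderiv ℝ v (W s z y)‖ₑ)
        ((hDv.comp hWz).enorm.measurable.aemeasurable)]
      have hmeas : Measurable fun y => ∫⁻ s in Set.Ioc (0:ℝ) 1, ‖fderiv ℝ v (W s z y)‖ₑ :=
        Measurable.lintegral_prod_left' (f := fun p : ℝ × (Fin n → ℝ) => ‖fderiv ℝ v (W p.1 z p.2)‖ₑ)
          (hDv.comp hWz).enorm.measurable
      rw [← lintegral_const_mul _ hmeas]
      apply lintegral_mono_ae
      filter_upwards [ae_restrict_mem hTm] with y hy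
      have hG1 : Gmap n m X (Lg z) y = Gmap n m X (Function.update (Lg z) 0 0) y
          + lam 0 z • (X 0 - y) := by
        rw [← Gmap_update, hLg0]
      rw [hG1]
      refine (ftc_bound n v hv _ _).trans ?_
      have hms : Measurable fun s => ‖fderiv ℝ v (W s z y)‖ₑ :=
        (hDv.comp (hWz.comp (f := fun s : ℝ => (s, y)) (by fun_prop))).enorm.measurable
      rw [← lintegral_const_mul _ hms]
      apply lintegral_mono
      intro s
      have hWs : Gmap n m X (Function.update (Lg z) 0 0) y + s • (lam 0 z • (X 0 - y))
          = W s z y := by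
        simp only [W]
        rw [Gmap_update n m X (Lg z) (s * lam 0 z), smul_smul]
      simp only [hWs]
      rw [mul_comm]
      gcongr
      rw [enorm_smul, Real.enorm_of_nonneg h0.le]
      gcongr
      rw [← ofReal_norm]
      apply ENNReal.ofReal_le_ofReal
      exact (norm_sub_le _ _).trans (add_le_add (hD _ (hx0T _)) (hD _ hy))
    have hb2 : (∫⁻ s in Set.Ioc (0:ℝ) 1, ∫⁻ y in T, ‖fderiv ℝ v (W s z y)‖ₑ) ^ 2 ≤
        A * ∫⁻ s in Set.Ioc (0:ℝ) 1, ∫⁻ y in T, φ y * F (W s z y) := by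
      have hms : Measurable fun s => ∫⁻ y in T, ‖fderiv ℝ v (W s z y)‖ₑ :=
        Measurable.lintegral_prod_right'
          (f := fun p : ℝ × (Fin n → ℝ) => ‖fderiv ℝ v (W p.1 z p.2)‖ₑ)
          (hDv.comp hWz).enorm.measurable
      have h1 := cs_weight (volume.restrict (Set.Ioc (0:ℝ) 1)) (fun _ => 1) _ measurable_const hms
        (by simp) (by simp)
      simp only [inv_one, lintegral_const, Measure.restrict_apply_univ, Real.volume_Ioc, sub_zero,
        ENNReal.ofReal_one, mul_one, one_mul] at h1
      refine h1.trans ?_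
      rw [← lintegral_const_mul' _ _ hA.ne]
      apply lintegral_mono
      intro s
      have hmy : Measurable fun y => ‖fderiv ℝ v (W s z y)‖ₑ :=
        (hDv.comp (hWz.comp (f := fun y : Fin n → ℝ => (s, y)) (by fun_prop))).enorm.measurable
      exact cs_weight (volume.restrict T) φ _ hφm hmy hφ0 (fun _ => ENNReal.ofReal_ne_top)
    have e1 : ENNReal.ofReal (((lam 0 z) ^ 2)⁻¹ *
        (Avg n m X T v (Lg z) - Avg n m X T v (Function.update (Lg z) 0 0)) ^ 2)
        = (ENNReal.ofReal ((lam 0 z)⁻¹) *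
          ‖Avg n m X T v (Lg z) - Avg n m X T v (Function.update (Lg z) 0 0)‖ₑ) ^ 2 := by
      rw [← ofReal_norm, ← ENNReal.ofReal_mul (by positivity), ← ENNReal.ofReal_pow
        (by positivity), mul_pow, Real.norm_eq_abs, sq_abs, inv_pow]
    rw [e1, hdiff, enorm_mul]
    have hcancel : ENNReal.ofReal ((lam 0 z)⁻¹) * ENNReal.ofReal (lam 0 z) = 1 := by
      rw [← ENNReal.ofReal_mul (by positivity), inv_mul_cancel₀ h0.ne', ENNReal.ofReal_one]
    calc _ ≤ (ENNReal.ofReal ((lam 0 z)⁻¹) * (V * ((ENNReal.ofReal (lam 0 z) * Dtwo) *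
          ∫⁻ s in Set.Ioc (0:ℝ) 1, ∫⁻ y in T, ‖fderiv ℝ v (W s z y)‖ₑ))) ^ 2 := by
          gcongr
      _ = ((ENNReal.ofReal ((lam 0 z)⁻¹) * ENNReal.ofReal (lam 0 z)) * (V * Dtwo)) ^ 2 *
          (∫⁻ s in Set.Ioc (0:ℝ) 1, ∫⁻ y in T, ‖fderiv ℝ v (W s z y)‖ₑ) ^ 2 := by ring
      _ ≤ (V * Dtwo) ^ 2 * (A * ∫⁻ s in Set.Ioc (0:ℝ) 1, ∫⁻ y in T, φ y * F (W s z y)) := by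
          rw [hcancel, one_mul]
          gcongr
      _ = _ := by ring
  -- integrated bound
  have hmain : ∫⁻ z in T, ENNReal.ofReal (((lam 0 z) ^ 2)⁻¹ *
      (Avg n m X T v (Lg z) - Avg n m X T v (Function.update (Lg z) 0 0)) ^ 2) ≤
      CC * ∫⁻ w in T, F w := by
    have hm3 : Measurable fun p : ((Fin n → ℝ) × ℝ) × (Fin n → ℝ) =>
        φ p.2 * F (W p.1.2 p.1.1 p.2) := by
      have hw : Continuous fun p : ((Fin n → ℝ) × ℝ) × (Fin n → ℝ) => W p.1.2 p.1.1 p.2 :=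
        hWc.comp (f := fun p : ((Fin n → ℝ) × ℝ) × (Fin n → ℝ) => (p.1.2, p.1.1, p.2))
          (by fun_prop)
      exact (hφm.comp measurable_snd).mul (hFm.comp hw.measurable)
    have hm2 : Measurable fun p : (Fin n → ℝ) × ℝ => ∫⁻ y in T, φ y * F (W p.2 p.1 y) :=
      Measurable.lintegral_prod_right' (ν := volume.restrict T) hm3
    calc _ ≤ ∫⁻ z in T, ((V * Dtwo) ^ 2 * A) *
          ∫⁻ s in Set.Ioc (0:ℝ) 1, ∫⁻ y in T, φ y * F (W s z y) := by
          apply lintegral_mono_ae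
          filter_upwards [ae_restrict_mem hTm] with z hz
          exact hpt z hz
      _ = ((V * Dtwo) ^ 2 * A) * ∫⁻ z in T,
          ∫⁻ s in Set.Ioc (0:ℝ) 1, ∫⁻ y in T, φ y * F (W s z y) :=
          lintegral_const_mul _ (Measurable.lintegral_prod_right' hm2)
      _ = ((V * Dtwo) ^ 2 * A) * ∫⁻ s in Set.Ioc (0:ℝ) 1, ∫⁻ z in T,
          ∫⁻ y in T, φ y * F (W s z y) := by
          congr 1
          exact lintegral_lintegral_swap hm2.aemeasurable
      _ ≤ ((V * Dtwo) ^ 2 * A) * ∫⁻ s in Set.Ioc (0:ℝ) 1, KC * ∫⁻ w in T, F w := by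
          refine mul_le_mul_right ?_ _
          apply lintegral_mono_ae
          filter_upwards [ae_restrict_mem measurableSet_Ioc] with s hs
          exact hJ s hs.1.le hs.2
      _ = _ := by
          simp only [lintegral_const, Measure.restrict_apply_univ, Real.volume_Ioc, sub_zero,
            ENNReal.ofReal_one, mul_one, CC]
          ring
  have hFint : IntegrableOn (fun z => ‖fderiv ℝ v z‖ ^ 2) T volume :=
    (hDv.norm.pow 2).continuousOn.integrableOn_compact hTc
  have hFe : ENNReal.ofReal (∫ z in T, ‖fderiv ℝ v z‖ ^ 2) = ∫⁻ w in T, F w := by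
    rw [ofReal_integral_eq_lintegral_ofReal hFint (Filter.Eventually.of_forall fun _ => by positivity)]
    apply lintegral_congr
    intro w
    rw [ENNReal.ofReal_pow (norm_nonneg _), ofReal_norm]
  have hR0 : 0 ≤ ∫ z in T, ‖fderiv ℝ v z‖ ^ 2 := integral_nonneg fun _ => by positivity
  change ∫ z in T, ((lam 0 z) ^ 2)⁻¹ *
      (Avg n m X T v (Lg z) - Avg n m X T v (Function.update (Lg z) 0 0)) ^ 2 ≤ _
  by_cases hi : Integrable (fun z => ((lam 0 z) ^ 2)⁻¹ *
      (Avg n m X T v (Lg z) - Avg n m X T v (Function.update (Lg z) 0 0)) ^ 2)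
      (volume.restrict T)
  · rw [← ENNReal.ofReal_le_ofReal_iff (by positivity),
      ofReal_integral_eq_lintegral_ofReal hi (Filter.Eventually.of_forall fun _ => by positivity),
      ENNReal.ofReal_mul ENNReal.toReal_nonneg, ENNReal.ofReal_toReal hCC, hFe]
    exact hmain
  · rw [integral_undef hi]
    positivity
end

section
/- Let 0 ≤ m < n be integers, let x_0,…,x_n ∈ ℝ^n be affinely independent, let F = conv{x_{m+1},…,x_n} (the face opposite f = conv{x_0,…,x_m}), and let μ denote the (n−m−1)-dimensional Hausdorff measure restricted to F. Then there exists a constant c, depending only on x_0,…,x_n, such that for every λ ∈ S_m^c and every continuously differentiable function v : ℝ^n → ℝ: ∫_F | v(G_m(λ, q)) − ⨍_F v(G_m(λ, q')) dμ(q') |² dμ(q) ≤ c · b(λ)² · ∫_F ‖Dv(G_m(λ, q))‖² dμ(q), where ⨍_F denotes the μ-average over F and Dv the total derivative of v. (Scaled Poincaré inequality on the opposite face along the contraction G_m(λ, ·).) -/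
open Finset MeasureTheory

open scoped ENNReal NNReal

/-- Homotheties with ratio at least one half distort the restricted measure boundedly. -/
lemma homothety_lintegral_le {n : ℕ} {F : Set (Fin n → ℝ)} (hFm : MeasurableSet F)
    (hconv : Convex ℝ F) {d : ℝ} (hd : 0 ≤ d) {p : Fin n → ℝ} (hp : p ∈ F) {t : ℝ}
    (ht : 1 / 2 ≤ t) (ht1 : t ≤ 1) {g : (Fin n → ℝ) → ℝ≥0∞} (hg : Measurable g) :
    ∫⁻ q in F, g (AffineMap.lineMap p q t) ∂μH[d] ≤
      (2 : ℝ≥0∞) ^ d * ∫⁻ q in F, g q ∂μH[d] := by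
  have hmeas : Measurable (AffineMap.homothety p t : (Fin n → ℝ) → (Fin n → ℝ)) :=
    (AffineMap.homothety_continuous p t).measurable
  have e1 : ∫⁻ q in F, g (AffineMap.lineMap p q t) ∂μH[d] =
      ∫⁻ q, g q ∂(Measure.map (AffineMap.homothety p t) ((μH[d]).restrict F)) := by
    rw [lintegral_map hg hmeas]
    rfl
  have e2 : Measure.map (AffineMap.homothety p t) ((μH[d]).restrict F) ≤
      (2 : ℝ≥0∞) ^ d • (μH[d]).restrict F := by
    refine Measure.le_iff.2 fun s hs => ?_
    rw [Measure.map_apply hmeas hs, Measure.restrict_apply (hmeas hs), Measure.smul_apply,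
      Measure.restrict_apply hs, smul_eq_mul]
    have hsub : (AffineMap.homothety p t) ⁻¹' s ∩ F ⊆ (AffineMap.homothety p t) ⁻¹' (s ∩ F) := by
      rintro q ⟨hq, hqF⟩
      refine ⟨hq, ?_⟩
      have : AffineMap.lineMap p q t ∈ F := hconv.lineMap_mem hp hqF ⟨by linarith, ht1⟩
      exact this
    refine (measure_mono hsub).trans ?_
    rw [hausdorffMeasure_homothety_preimage hd p (by linarith : t ≠ 0)]
    rw [ENNReal.smul_def, smul_eq_mul]
    gcongr
    rw [ENNReal.coe_rpow_of_nonneg _ hd]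
    gcongr
    rw [show (2 : ℝ≥0∞) = ((2 : ℝ≥0) : ℝ≥0∞) by simp, ENNReal.coe_le_coe, ← NNReal.coe_le_coe]
    simp only [NNReal.coe_inv, coe_nnnorm, NNReal.coe_ofNat]
    rw [Real.norm_of_nonneg (by linarith), inv_le_comm₀ (by linarith) (by norm_num)]
    linarith
  rw [e1]
  refine (lintegral_mono' e2 le_rfl).trans ?_
  rw [lintegral_smul_measure, smul_eq_mul]

lemma lineMap_prod_le {n : ℕ} {F : Set (Fin n → ℝ)} (hFm : MeasurableSet F)
    (hconv : Convex ℝ F) {d : ℝ} (hd : 0 ≤ d) [IsFiniteMeasure ((μH[d]).restrict F)] {t : ℝ}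
    (ht : 0 ≤ t) (ht1 : t ≤ 1) {g : (Fin n → ℝ) → ℝ≥0∞} (hg : Measurable g) :
    ∫⁻ z, g (AffineMap.lineMap z.1 z.2 t) ∂(((μH[d]).restrict F).prod ((μH[d]).restrict F)) ≤
      ((2 : ℝ≥0∞) ^ d * ∫⁻ q in F, g q ∂μH[d]) * μH[d] F := by
  have hm : Measurable fun z : (Fin n → ℝ) × (Fin n → ℝ) =>
      g (AffineMap.lineMap z.1 z.2 t) := by
    refine hg.comp (Continuous.measurable ?_)
    simp only [AffineMap.lineMap_apply_module]
    fun_prop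
  have key : ∀ f : (Fin n → ℝ) → ℝ≥0∞, (∀ p ∈ F, f p ≤ (2 : ℝ≥0∞) ^ d * ∫⁻ q in F, g q ∂μH[d]) →
      ∫⁻ p in F, f p ∂μH[d] ≤ ((2 : ℝ≥0∞) ^ d * ∫⁻ q in F, g q ∂μH[d]) * μH[d] F := by
    intro f hf
    calc ∫⁻ p in F, f p ∂μH[d] ≤ ∫⁻ p in F, ((2 : ℝ≥0∞) ^ d * ∫⁻ q in F, g q ∂μH[d]) ∂μH[d] :=
          setLIntegral_mono' hFm hf
      _ = _ := by rw [setLIntegral_const]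
  rcases le_total (1 / 2) t with h | h
  · rw [lintegral_prod _ hm.aemeasurable]
    exact key _ fun p hp => homothety_lintegral_le hFm hconv hd hp h ht1 hg
  · rw [lintegral_prod_symm _ hm.aemeasurable]
    refine key _ fun q hq => ?_
    have := homothety_lintegral_le hFm hconv hd hq (t := 1 - t) (by linarith) (by linarith) hg
    simpa only [AffineMap.lineMap_apply_one_sub] using this

lemma sq_integral_le {f : ℝ → ℝ} (hf : Continuous f) :
    (∫ t in (0:ℝ)..1, f t) ^ 2 ≤ ∫ t in (0:ℝ)..1, f t ^ 2 := by
  set I := ∫ t in (0:ℝ)..1, f t with hI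
  have h0 : 0 ≤ ∫ t in (0:ℝ)..1, (f t - I) ^ 2 :=
    intervalIntegral.integral_nonneg (by norm_num) fun _ _ => sq_nonneg _
  have h1 : ∫ t in (0:ℝ)..1, (f t - I) ^ 2 = (∫ t in (0:ℝ)..1, f t ^ 2) - I ^ 2 := by
    have : ∀ t, (f t - I) ^ 2 = f t ^ 2 - 2 * I * f t + I ^ 2 := fun t => by ring
    simp only [this]
    rw [intervalIntegral.integral_add, intervalIntegral.integral_sub,
      intervalIntegral.integral_const_mul, intervalIntegral.integral_const, ← hI]
    · simp; ring
    all_goals exact Continuous.intervalIntegrable (by fun_prop) _ _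
  linarith

lemma variance_prod {α : Type*} [MeasurableSpace α] (ν : Measure α) [IsFiniteMeasure ν]
    (hν : ν Set.univ ≠ 0) {w : α → ℝ} (h1 : Integrable w ν) (h2 : Integrable (fun p => w p ^ 2) ν) :
    Integrable (fun z : α × α => (w z.1 - w z.2) ^ 2) (ν.prod ν) ∧
    2 * (ν Set.univ).toReal * ∫ p, (w p - (ν Set.univ).toReal⁻¹ * ∫ q, w q ∂ν) ^ 2 ∂ν =
      ∫ z, (w z.1 - w z.2) ^ 2 ∂(ν.prod ν) := by
  have hM : (ν Set.univ).toReal ≠ 0 := ENNReal.toReal_ne_zero.2 ⟨hν, measure_ne_top _ _⟩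
  have ia : Integrable (fun z : α × α => w z.1 ^ 2) (ν.prod ν) := h2.comp_fst ν
  have ib : Integrable (fun z : α × α => w z.2 ^ 2) (ν.prod ν) := h2.comp_snd ν
  have ic : Integrable (fun z : α × α => w z.1 * w z.2) (ν.prod ν) := h1.mul_prod h1
  have e : ∀ z : α × α, (w z.1 - w z.2) ^ 2 = w z.1 ^ 2 + w z.2 ^ 2 - 2 * (w z.1 * w z.2) :=
    fun z => by ring
  simp only [e]
  refine ⟨(ia.add ib).sub (ic.const_mul 2), ?_⟩
  have iab : Integrable (fun z : α × α => w z.1 ^ 2 + w z.2 ^ 2) (ν.prod ν) := ia.add ib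
  rw [integral_sub iab (ic.const_mul 2), integral_add ia ib, integral_const_mul,
    integral_prod_mul, integral_fun_fst (fun p => w p ^ 2), integral_fun_snd (fun p => w p ^ 2)]
  set I := ∫ q, w q ∂ν
  set M := (ν Set.univ).toReal with hMd
  have e2 : ∀ p, (w p - M⁻¹ * I) ^ 2 = w p ^ 2 - 2 * (M⁻¹ * I) * w p + (M⁻¹ * I) ^ 2 :=
    fun z => by ring
  simp only [e2]
  have i2 : Integrable (fun p => w p ^ 2 - 2 * (M⁻¹ * I) * w p) ν := h2.sub (h1.const_mul _)
  rw [integral_add i2 (integrable_const _),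
    integral_sub h2 (h1.const_mul _), integral_const_mul, integral_const]
  simp only [smul_eq_mul, measureReal_def, ← hMd]
  change 2 * M * (_ - 2 * (M⁻¹ * I) * I + _) = _
  field_simp
  ring

/-- Poincaré inequality for a convex compact set of finite Hausdorff measure. -/
lemma poincare_convex {n : ℕ} {F : Set (Fin n → ℝ)} (hF : IsCompact F)
    (hconv : Convex ℝ F) {d : ℝ} (hd : 0 ≤ d) (hfin : μH[d] F ≠ ∞) {C : ℝ} (hC : 0 ≤ C)
    {w g : (Fin n → ℝ) → ℝ} (hw : Continuous w) (hg : Continuous g) (hg0 : ∀ p, 0 ≤ g p)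
    (hwg : ∀ p ∈ F, ∀ q ∈ F,
      (w p - w q) ^ 2 ≤ C * ∫ t in (0:ℝ)..1, g (AffineMap.lineMap p q t)) :
    ∫ q in F, (w q - (μH[d] F).toReal⁻¹ * ∫ q' in F, w q' ∂μH[d]) ^ 2 ∂μH[d] ≤
      C * 2 ^ d * ∫ q in F, g q ∂μH[d] := by
  have hFm : MeasurableSet F := hF.measurableSet
  have : IsFiniteMeasure ((μH[d]).restrict F) := ⟨by simpa using hfin.lt_top⟩
  set ν := (μH[d]).restrict F with hν
  have hνu : ν Set.univ = μH[d] F := by simp [hν]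
  by_cases h0 : μH[d] F = 0
  · have : ν = 0 := by rw [hν, Measure.restrict_eq_zero, h0]
    simp [this]
  have hint : ∀ f : (Fin n → ℝ) → ℝ, Continuous f → Integrable f ν := by
    intro f hf
    obtain ⟨K, hK⟩ := hF.exists_bound_of_continuousOn hf.continuousOn
    exact Integrable.of_bound hf.aestronglyMeasurable K
      ((ae_restrict_iff' hFm).2 (Filter.Eventually.of_forall hK))
  obtain ⟨hi, hv⟩ := variance_prod ν (by rwa [hνu]) (hint w hw) (hint _ (hw.pow 2))
  rw [hνu] at hv
  set V := ∫ q, (w q - (μH[d] F).toReal⁻¹ * ∫ q' , w q' ∂ν) ^ 2 ∂ν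
  set M := (μH[d] F).toReal with hM
  have hMpos : 0 < M := ENNReal.toReal_pos h0 hfin
  have hV : 0 ≤ V := integral_nonneg fun _ => sq_nonneg _
  have hG : 0 ≤ ∫ q, g q ∂ν := integral_nonneg hg0
  -- main estimate
  have main : ENNReal.ofReal (∫ z, (w z.1 - w z.2) ^ 2 ∂(ν.prod ν)) ≤
      ENNReal.ofReal (C * (2 ^ d * (∫ q, g q ∂ν) * M)) := by
    rw [ofReal_integral_eq_lintegral_ofReal hi (Filter.Eventually.of_forall fun _ => sq_nonneg _)]
    have hae : ∀ᵐ z ∂(ν.prod ν), z ∈ F ×ˢ F := by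
      have h : ∀ᵐ p ∂ν, p ∈ F := ae_restrict_mem hFm
      filter_upwards [Measure.quasiMeasurePreserving_fst.ae h,
        Measure.quasiMeasurePreserving_snd.ae h] with z h1 h2
      exact ⟨h1, h2⟩
    have hGm : Measurable fun p => ENNReal.ofReal (g p) := by fun_prop
    have hcl : Continuous fun u : ((Fin n → ℝ) × (Fin n → ℝ)) × ℝ =>
        (AffineMap.lineMap u.1.1 u.1.2 u.2 : Fin n → ℝ) := by
      simp only [AffineMap.lineMap_apply_module]
      fun_prop
    have hm : Measurable fun u : ((Fin n → ℝ) × (Fin n → ℝ)) × ℝ =>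
        ENNReal.ofReal (g (AffineMap.lineMap u.1.1 u.1.2 u.2)) :=
      hGm.comp hcl.measurable
    calc ∫⁻ z, ENNReal.ofReal ((w z.1 - w z.2) ^ 2) ∂(ν.prod ν)
        ≤ ∫⁻ z, ENNReal.ofReal C * (∫⁻ t in Set.Ioc (0:ℝ) 1,
            ENNReal.ofReal (g (AffineMap.lineMap z.1 z.2 t))) ∂(ν.prod ν) := by
          refine lintegral_mono_ae ?_
          filter_upwards [hae] with z hz
          refine (ENNReal.ofReal_le_ofReal (hwg z.1 hz.1 z.2 hz.2)).trans ?_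
          rw [ENNReal.ofReal_mul hC, intervalIntegral.integral_of_le zero_le_one,
            ofReal_integral_eq_lintegral_ofReal]
          · refine (Continuous.integrableOn_Ioc ?_)
            exact hg.comp AffineMap.lineMap_continuous
          · exact Filter.Eventually.of_forall fun _ => hg0 _
      _ = ENNReal.ofReal C * ∫⁻ t in Set.Ioc (0:ℝ) 1, ∫⁻ z,
            ENNReal.ofReal (g (AffineMap.lineMap z.1 z.2 t)) ∂(ν.prod ν) := by
          rw [lintegral_const_mul, lintegral_lintegral_swap]
          · exact hm.aemeasurable
          · exact hm.lintegral_prod_right'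
      _ ≤ ENNReal.ofReal C * ∫⁻ t in Set.Ioc (0:ℝ) 1,
            (((2 : ℝ≥0∞) ^ d * ∫⁻ q, ENNReal.ofReal (g q) ∂ν) * μH[d] F) := by
          gcongr ENNReal.ofReal C * ?_
          exact setLIntegral_mono' measurableSet_Ioc fun t ht =>
            lineMap_prod_le hFm hconv hd ht.1.le ht.2 hGm
      _ = _ := by
          rw [setLIntegral_const, Real.volume_Ioc, sub_zero, ENNReal.ofReal_one, mul_one,
            ← ofReal_integral_eq_lintegral_ofReal (hint g hg) (Filter.Eventually.of_forall hg0),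
            ENNReal.ofReal_mul hC, ENNReal.ofReal_mul (by positivity),
            ENNReal.ofReal_mul (by positivity), hM, ENNReal.ofReal_toReal hfin,
            ← ENNReal.ofReal_rpow_of_pos (by norm_num : (0:ℝ) < 2)]
          simp
  have main' := (ENNReal.ofReal_le_ofReal_iff (by positivity)).1 main
  rw [← hv] at main'
  have h3 : 2 * V ≤ C * 2 ^ d * ∫ q, g q ∂ν := by
    have : M * (2 * V) ≤ M * (C * 2 ^ d * ∫ q, g q ∂ν) := by linarith
    exact le_of_mul_le_mul_left this hMpos
  linarith

lemma face_finite (n m : ℕ) (hmn : m < n) (x : Fin (n + 1) → Fin n → ℝ) :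
    μH[(n : ℝ) - m - 1] (convexHull ℝ (x '' {j : Fin (n + 1) | m < (j : ℕ)})) ≠ ∞ := by
  obtain ⟨k, rfl⟩ : ∃ k, n = m + 1 + k := ⟨n - m - 1, by omega⟩
  have hk : ((m + 1 + k : ℕ) : ℝ) - m - 1 = k := by push_cast; ring
  rw [hk]
  let y : Fin k → Fin (m + 1 + k) → ℝ := fun i => x ⟨m + 1 + i, by omega⟩ - x (Fin.last _)
  let L : (Fin k → ℝ) →L[ℝ] (Fin (m + 1 + k) → ℝ) :=
    ∑ i, (ContinuousLinearMap.proj i : (Fin k → ℝ) →L[ℝ] ℝ).smulRight (y i)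
  have hL : ∀ a, L a = ∑ i, a i • y i := fun a => by simp [L]
  let f : (Fin k → ℝ) → (Fin (m + 1 + k) → ℝ) := fun a => x (Fin.last _) + L a
  have hf : LipschitzWith ‖L‖₊ f := by
    refine LipschitzWith.of_dist_le_mul fun a b => ?_
    simpa [f] using L.lipschitz.dist_le_mul a b
  have hsub : convexHull ℝ (x '' {j : Fin (m + 1 + k + 1) | m < (j : ℕ)}) ⊆
      f '' Set.Icc 0 1 := by
    refine convexHull_min ?_ ?_
    · rintro _ ⟨j, hj, rfl⟩
      by_cases hjl : j = Fin.last _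
      · exact ⟨0, ⟨le_rfl, zero_le_one⟩, by simp [f, hjl]⟩
      · have hj' : m < (j : ℕ) := hj
        have hjlt : (j : ℕ) < m + 1 + k := by
          have := Fin.val_lt_last hjl
          simpa using this
        refine ⟨Pi.single ⟨(j : ℕ) - (m + 1), by omega⟩ 1, ⟨?_, ?_⟩, ?_⟩
        · intro i
          by_cases h : i = ⟨(j : ℕ) - (m + 1), by omega⟩
          · subst h; simp
          · simp [Pi.single_eq_of_ne h]
        · intro i
          by_cases h : i = ⟨(j : ℕ) - (m + 1), by omega⟩
          · subst h; simp
          · simp [Pi.single_eq_of_ne h]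
        · have hjj : (⟨m + 1 + ((j : ℕ) - (m + 1)), by omega⟩ : Fin (m + 1 + k + 1)) = j := by
            ext; simp; omega
          simp only [f, hL]
          rw [Finset.sum_eq_single ⟨(j : ℕ) - (m + 1), by omega⟩]
          · simp only [Pi.single_eq_same, one_smul, y]
            rw [hjj]
            abel
          · intro b _ hb
            simp [Pi.single_eq_of_ne hb]
          · simp
    · have hc : Convex ℝ (Set.Icc (0 : Fin k → ℝ) 1) := convex_Icc _ _
      have := (hc.linear_image (L : (Fin k → ℝ) →ₗ[ℝ] _)).translate (x (Fin.last _))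
      rw [Set.image_image] at this
      exact this
  refine ne_of_lt ((measure_mono hsub).trans_lt ?_)
  refine (hf.hausdorffMeasure_image_le (Nat.cast_nonneg k) _).trans_lt ?_
  have hv : (μH[(k : ℝ)] : Measure (Fin k → ℝ)) = volume := by
    simpa using (hausdorffMeasure_pi_real (ι := Fin k))
  rw [hv]
  refine ENNReal.mul_lt_top ?_ isCompact_Icc.measure_lt_top
  exact ENNReal.rpow_lt_top_of_nonneg (Nat.cast_nonneg k) (by simp)

/-- Scaled Poincaré inequality on the opposite face along the contraction `G_m(λ,·)`
(estimate \eqref{tilde-est}): with `F = conv{x_{m+1},…,x_n}` the face opposite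
`f = conv{x_0,…,x_m}` and `μ` the `(n−m−1)`-dimensional Hausdorff measure, for every
`λ ∈ S_m^c` and every `C¹` function `v`,
`∫_F |v(G_m(λ,q)) − ⨍_F v(G_m(λ,q')) dμ(q')|² dμ(q)
  ≤ c b(λ)² ∫_F ‖Dv(G_m(λ,q))‖² dμ(q)`. -/
theorem scaled_poincare_opposite_face (n m : ℕ) (hmn : m < n)
    (x : Fin (n + 1) → Fin n → ℝ) (hx : AffineIndependent ℝ x) :
    ∃ c : ℝ, ∀ lam : Fin (m + 1) → ℝ, (∀ j, 0 ≤ lam j) → ∑ j, lam j ≤ 1 →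
      ∀ v : (Fin n → ℝ) → ℝ, ContDiff ℝ 1 v →
        ∫ q in convexHull ℝ (x '' {j : Fin (n + 1) | m < (j : ℕ)}),
            (v (Gmap n m (fun j : Fin (m + 1) => x (Fin.castLE (by omega) j)) lam q) -
              ((μH[(n : ℝ) - m - 1] (convexHull ℝ (x '' {j : Fin (n + 1) | m < (j : ℕ)}))).toReal⁻¹ *
                ∫ q' in convexHull ℝ (x '' {j : Fin (n + 1) | m < (j : ℕ)}),
                  v (Gmap n m (fun j : Fin (m + 1) => x (Fin.castLE (by omega) j)) lam q')
                  ∂(μH[(n : ℝ) - m - 1]))) ^ 2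
            ∂(μH[(n : ℝ) - m - 1])
          ≤ c * (bfun m lam) ^ 2 *
            ∫ q in convexHull ℝ (x '' {j : Fin (n + 1) | m < (j : ℕ)}),
              ‖fderiv ℝ v
                (Gmap n m (fun j : Fin (m + 1) => x (Fin.castLE (by omega) j)) lam q)‖ ^ 2
              ∂(μH[(n : ℝ) - m - 1]) := by
  set F := convexHull ℝ (x '' {j : Fin (n + 1) | m < (j : ℕ)}) with hFdef
  have hF : IsCompact F := ((Set.toFinite _).image x).isCompact_convexHull ℝ
  have hd : (0 : ℝ) ≤ (n : ℝ) - m - 1 := by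
    have : ((m + 1 : ℕ) : ℝ) ≤ n := by exact_mod_cast hmn
    push_cast at this
    linarith
  have hdiam : ∀ p ∈ F, ∀ q ∈ F, ‖q - p‖ ≤ Metric.diam F := fun p hp q hq => by
    rw [← dist_eq_norm]
    exact Metric.dist_le_diam_of_mem hF.isBounded hq hp
  refine ⟨Metric.diam F ^ 2 * 2 ^ ((n : ℝ) - m - 1), fun lam _ _ v hv => ?_⟩
  set G := Gmap n m (fun j : Fin (m + 1) => x (Fin.castLE (by omega) j)) lam with hG
  set b := bfun m lam with hb
  have hGc : Continuous G := by
    simp only [hG]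
    unfold Gmap
    fun_prop
  have hDv : Continuous (fderiv ℝ v) := hv.continuous_fderiv (by norm_num)
  have key := poincare_convex hF (convex_convexHull ℝ _) hd (face_finite n m hmn x)
    (C := b ^ 2 * Metric.diam F ^ 2) (by positivity)
    (w := fun q => v (G q)) (g := fun q => ‖fderiv ℝ v (G q)‖ ^ 2)
    (hv.continuous.comp hGc) (by fun_prop) (fun _ => by positivity) ?_
  · refine key.trans (le_of_eq ?_)
    ring
  intro p hp q hq
  have hder : ∀ t : ℝ, HasDerivAt (fun t : ℝ => v (G (AffineMap.lineMap p q t)))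
      (fderiv ℝ v (G (AffineMap.lineMap p q t)) (b • (q - p))) t := by
    intro t
    have h1 : HasDerivAt (fun t : ℝ => G (AffineMap.lineMap p q t)) (b • (q - p)) t :=
      (AffineMap.hasDerivAt_lineMap.const_smul b).const_add _
    exact ((hv.differentiable (by norm_num)) _).hasFDerivAt.comp_hasDerivAt t h1
  have hlc : Continuous fun t : ℝ => (AffineMap.lineMap p q t : Fin n → ℝ) :=
    AffineMap.lineMap_continuous
  have hcont : Continuous fun t : ℝ =>
      fderiv ℝ v (G (AffineMap.lineMap p q t)) (b • (q - p)) :=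
    (hDv.comp (hGc.comp hlc)).clm_apply continuous_const
  have hftc := intervalIntegral.integral_eq_sub_of_hasDerivAt (a := 0) (b := 1)
    (fun t _ => hder t) (hcont.intervalIntegrable _ _)
  simp only [AffineMap.lineMap_apply_one, AffineMap.lineMap_apply_zero] at hftc
  have hsq := sq_integral_le hcont
  rw [hftc] at hsq
  have e : (v (G p) - v (G q)) ^ 2 = (v (G q) - v (G p)) ^ 2 := by ring
  simp only [e]
  refine hsq.trans ?_
  rw [← intervalIntegral.integral_const_mul]
  refine intervalIntegral.integral_mono_on zero_le_one
    (Continuous.intervalIntegrable (by fun_prop) _ _)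
    (Continuous.intervalIntegrable
      (continuous_const.mul ((hDv.comp (hGc.comp hlc)).norm.pow 2)) _ _) fun t _ => ?_
  set A := fderiv ℝ v (G (AffineMap.lineMap p q t))
  have h1 : |A (b • (q - p))| ≤ ‖A‖ * (|b| * Metric.diam F) := by
    refine (A.le_opNorm _).trans ?_
    rw [norm_smul, Real.norm_eq_abs]
    gcongr
    exact hdiam p hp q hq
  calc (A (b • (q - p))) ^ 2 = |A (b • (q - p))| ^ 2 := (sq_abs _).symm
    _ ≤ (‖A‖ * (|b| * Metric.diam F)) ^ 2 := by gcongr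
    _ = _ := by rw [mul_pow, mul_pow, sq_abs]; ring
end
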